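/- For every integer n ≥ 3, σ(n) < e^γ · n · log(log(n)) + 0.6483·n/log(log(n)). -/

import Mathlib

section

open Filter Topology

theorem log_le_sum_artanh {y : ℝ} (h0 : 0 ≤ y) (h1 : y < 1) (n : ℕ) :
    Real.log ((1 + y) / (1 - y)) ≤
      2 * ∑ k ∈ Finset.range n, y ^ (2 * k + 1) / (2 * k + 1) +
        2 * y ^ (2 * n + 1) / ((2 * n + 1) * (1 - y ^ 2)) := by
  have h := Real.hasSum_log_sub_log_of_abs_lt_one (x := y) (by rwa [abs_of_nonneg h0])
  have hy2 : y ^ 2 < 1 := by nlinarith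
  rw [Real.log_div (by linarith) (by linarith), ← h.tsum_eq, Finset.mul_sum,
    ← h.summable.sum_add_tsum_nat_add n]
  have hg := (hasSum_geometric_of_lt_one (sq_nonneg y) hy2).mul_left
    (2 * y ^ (2 * n + 1) / (2 * n + 1))
  refine add_le_add (le_of_eq (Finset.sum_congr rfl fun k _ => by ring)) ?_
  have h2 : ∑' k : ℕ, 2 * (1 / (2 * ((k + n : ℕ) : ℝ) + 1)) * y ^ (2 * (k + n) + 1) ≤
      2 * y ^ (2 * n + 1) / (2 * n + 1) * (1 - y ^ 2)⁻¹ := by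
    rw [← hg.tsum_eq]
    refine ((summable_nat_add_iff n).2 h.summable).tsum_le_tsum (fun k => ?_) hg.summable
    have e : y ^ (2 * (k + n) + 1) = y ^ (2 * n + 1) * (y ^ 2) ^ k := by ring
    rw [e]
    push_cast
    have : 1 / (2 * ((k : ℝ) + n) + 1) ≤ 1 / (2 * n + 1) := by
      gcongr; linarith [(Nat.cast_nonneg k : (0 : ℝ) ≤ k)]
    calc 2 * (1 / (2 * ((k : ℝ) + n) + 1)) * (y ^ (2 * n + 1) * (y ^ 2) ^ k)
        ≤ 2 * (1 / (2 * n + 1)) * (y ^ (2 * n + 1) * (y ^ 2) ^ k) := by gcongr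
      _ = _ := by ring
  refine h2.trans (le_of_eq ?_)
  have : 1 - y ^ 2 ≠ 0 := by linarith
  field_simp

theorem log_one_add_inv_le (n : ℕ) (hn : 0 < n) :
    Real.log ((n + 1 : ℝ) / n) ≤ (1 / n + 1 / (n + 1)) / 2 := by
  have hn' : (0 : ℝ) < n := by exact_mod_cast hn
  have hx : (0 : ℝ) < (n + 1) / n := by positivity
  have h1 : 0 ≤ Real.log ((n + 1 : ℝ) / n) := by
    refine Real.log_nonneg ?_
    rw [le_div_iff₀ hn']; linarith
  have h := Real.self_le_sinh_iff.2 h1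
  rw [Real.sinh_log hx] at h
  refine h.trans (le_of_eq ?_)
  field_simp
  ring

theorem harmonic_sub_log_le_eulerMascheroniConstant (n : ℕ) (hn : 0 < n) :
    (harmonic n : ℝ) - Real.log n - 1 / (2 * n) ≤ Real.eulerMascheroniConstant := by
  have hmono : ∀ m : ℕ, n ≤ m → (harmonic n : ℝ) - Real.log n - 1 / (2 * n) ≤
      (harmonic m : ℝ) - Real.log m - 1 / (2 * m) := by
    intro m hm
    induction m, hm using Nat.le_induction with
    | base => exact le_rfl
    | succ m hm ih =>
      refine ih.trans ?_
      have hm0 : 0 < m := hn.trans_le hm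
      have hm' : (0 : ℝ) < m := by exact_mod_cast hm0
      have h := log_one_add_inv_le m hm0
      rw [Real.log_div (by positivity) (by positivity)] at h
      rw [harmonic_succ]
      push_cast
      have e1 : (1 : ℝ) / (2 * (m + 1)) = 1 / (m + 1) / 2 := by field_simp
      have e2 : (1 : ℝ) / (2 * m) = 1 / m / 2 := by field_simp
      rw [e1, e2, ← one_div]
      linarith
  have hlim : Tendsto (fun m : ℕ => (harmonic m : ℝ) - Real.log m - 1 / (2 * m)) atTop
      (𝓝 Real.eulerMascheroniConstant) := by
    have h2 : Tendsto (fun m : ℕ => 1 / (2 * (m : ℝ))) atTop (𝓝 0) := by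
      refine tendsto_const_nhds.div_atTop ?_
      exact tendsto_natCast_atTop_atTop.const_mul_atTop (by norm_num)
    simpa using Real.tendsto_harmonic_sub_log.sub h2
  exact ge_of_tendsto hlim (eventually_atTop.2 ⟨n, hmono⟩)

theorem eulerMascheroniConstant_le_harmonic_sub_log (n : ℕ) :
    Real.eulerMascheroniConstant ≤ (harmonic n : ℝ) - Real.log (n + 1 / 2) := by
  have hmono : ∀ m : ℕ, n ≤ m → (harmonic m : ℝ) - Real.log (m + 1 / 2) ≤
      (harmonic n : ℝ) - Real.log (n + 1 / 2) := by
    intro m hm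
    induction m, hm using Nat.le_induction with
    | base => exact le_rfl
    | succ m hm ih =>
      refine le_trans ?_ ih
      have hm' : (0 : ℝ) ≤ m := by positivity
      have h := Real.le_log_one_add_of_nonneg (x := 1 / (m + 1 / 2)) (by positivity)
      have e : 2 * (1 / ((m : ℝ) + 1 / 2)) / (1 / (m + 1 / 2) + 2) = 1 / (m + 1) := by
        field_simp
        ring
      have e2 : (1 : ℝ) + 1 / (m + 1 / 2) = (m + 1 + 1 / 2) / (m + 1 / 2) := by
        field_simp
        ring
      rw [e, e2, Real.log_div (by positivity) (by positivity)] at h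
      rw [harmonic_succ]
      push_cast
      rw [← one_div]
      linarith
  have hlim : Tendsto (fun m : ℕ => (harmonic m : ℝ) - Real.log (m + 1 / 2)) atTop
      (𝓝 Real.eulerMascheroniConstant) := by
    have h2 : Tendsto (fun m : ℕ => Real.log ((m + 1 / 2) / m)) atTop (𝓝 0) := by
      rw [← Real.log_one]
      refine (Real.continuousAt_log one_ne_zero).tendsto.comp ?_
      have h3 : Tendsto (fun m : ℕ => 1 + 1 / 2 / (m : ℝ)) atTop (𝓝 (1 + 0)) :=
        tendsto_const_nhds.add (tendsto_const_nhds.div_atTop tendsto_natCast_atTop_atTop)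
      rw [add_zero] at h3
      refine h3.congr' ?_
      filter_upwards [eventually_gt_atTop 0] with m hm
      have : (0 : ℝ) < m := by exact_mod_cast hm
      field_simp
    have h4 := Real.tendsto_harmonic_sub_log.sub h2
    rw [sub_zero] at h4
    refine h4.congr' ?_
    filter_upwards [eventually_gt_atTop 0] with m hm
    have : (0 : ℝ) < m := by exact_mod_cast hm
    rw [Real.log_div (by positivity) (by positivity)]
    ring
  exact le_of_tendsto hlim (eventually_atTop.2 ⟨n, hmono⟩)

theorem eulerMascheroniConstant_gt : 0.57721 < Real.eulerMascheroniConstant := by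
  refine lt_of_lt_of_le ?_ (harmonic_sub_log_le_eulerMascheroniConstant 128 (by norm_num))
  have h1 : (5.433147 : ℚ) < harmonic 128 := by decide +kernel
  have h2 : ((5.433147 : ℚ) : ℝ) < (harmonic 128 : ℝ) := by exact_mod_cast h1
  have h3 : Real.log ((128 : ℕ) : ℝ) = 7 * Real.log 2 := by
    rw [show ((128 : ℕ) : ℝ) = 2 ^ 7 by norm_num, Real.log_pow]; norm_num
  rw [h3]
  have := Real.log_two_lt_d9
  push_cast at h2
  norm_num at h2 ⊢
  linarith

theorem eulerMascheroniConstant_lt : Real.eulerMascheroniConstant < 0.57722 := by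
  refine lt_of_le_of_lt (eulerMascheroniConstant_le_harmonic_sub_log 128) ?_
  have h1 : harmonic 128 < (5.433148 : ℚ) := by decide +kernel
  have h2 : (harmonic 128 : ℝ) < ((5.433148 : ℚ) : ℝ) := by exact_mod_cast h1
  have h3 : Real.log (((128 : ℕ) : ℝ) + 1 / 2) = 7 * Real.log 2 + Real.log (1 + 1 / 256) := by
    rw [show (((128 : ℕ) : ℝ) + 1 / 2) = 2 ^ 7 * (1 + 1 / 256) by norm_num,
      Real.log_mul (by norm_num) (by norm_num), Real.log_pow]; norm_num
  rw [h3]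
  have := Real.log_two_gt_d9
  have h4 := Real.le_log_one_add_of_nonneg (x := 1 / 256) (by norm_num)
  push_cast at h2
  norm_num at h2 h4 ⊢
  linarith

theorem log_four_pi_gt : 2.53102 < Real.log (4 * Real.pi) := by
  have h := Real.pi_gt_d6
  have h1 : Real.log (16 / 1.2732405) ≤ Real.log (4 * Real.pi) := by
    refine Real.log_le_log (by norm_num) ?_
    norm_num at h ⊢
    linarith
  refine lt_of_lt_of_le ?_ h1
  rw [show (16 : ℝ) = 2 ^ 4 by norm_num, Real.log_div (by norm_num) (by norm_num), Real.log_pow]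
  have h2 := log_le_sum_artanh (y := 2732405 / 22732405) (by norm_num) (by norm_num) 3
  rw [show (1 + 2732405 / 22732405 : ℝ) / (1 - 2732405 / 22732405) = 1.2732405 by norm_num] at h2
  have := Real.log_two_gt_d9
  norm_num [Finset.sum_range_succ] at h2 ⊢
  linarith

end

section

open Complex Filter Topology Metric

/-- Dividing an entire function by the linear factors of finitely many of its zeros. -/
theorem exists_factor_out_zeros {f : ℂ → ℂ} (hf : Differentiable ℂ f) (h0 : f 0 ≠ 0)
    (S : Finset ℂ) :
    ∃ g : ℂ → ℂ, Differentiable ℂ g ∧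
      (∀ s, f s = (∏ ρ ∈ S, (s - ρ) ^ analyticOrderNatAt f ρ) * g s) ∧ ∀ ρ ∈ S, g ρ ≠ 0 := by
  classical
  induction S using Finset.induction_on with
  | empty => exact ⟨f, hf, by simp, by simp⟩
  | insert a S ha ih =>
    obtain ⟨g, hg, hfg, hgS⟩ := ih
    have hg0 : g 0 ≠ 0 := fun h => h0 (by rw [hfg 0, h, mul_zero])
    have hga : AnalyticAt ℂ g a := hg.analyticAt a
    have hgtop : analyticOrderAt g a ≠ ⊤ := by
      intro h
      have hz := (AnalyticOnNhd.analyticOrderAt_eq_top_iff_eq_zero (f := g) a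
        (fun z => hg.analyticAt z)).1 h
      exact hg0 (by rw [hz]; rfl)
    set P : ℂ → ℂ := fun s => ∏ ρ ∈ S, (s - ρ) ^ analyticOrderNatAt f ρ with hP
    have hPd : Differentiable ℂ P := by
      rw [hP]; fun_prop
    have hPa : P a ≠ 0 := by
      rw [hP]
      refine Finset.prod_ne_zero_iff.2 fun ρ hρ => pow_ne_zero _ ?_
      rw [sub_ne_zero]
      rintro rfl
      exact ha hρ
    have hfP : f = P * g := funext hfg
    have hord : analyticOrderNatAt f a = analyticOrderNatAt g a := by
      have h1 : analyticOrderAt P a = 0 :=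
        ((hPd.analyticAt a).analyticOrderAt_eq_zero).2 hPa
      have : analyticOrderAt f a = analyticOrderAt g a := by
        conv_lhs => rw [hfP]
        rw [analyticOrderAt_mul (hPd.analyticAt a) hga, h1, zero_add]
      unfold analyticOrderNatAt
      rw [this]
    obtain ⟨k, hk, hka, hkg⟩ := (hga.analyticOrderNatAt_eq_iff hgtop).1 hord.symm
    set m := analyticOrderNatAt f a with hm
    have hsub : ∀ s, s ≠ a → (s - a) ^ m ≠ 0 := fun s hs => pow_ne_zero _ (sub_ne_zero.2 hs)
    set q : ℂ → ℂ := fun s => if s = a then k a else g s / (s - a) ^ m with hq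
    have hqk : q =ᶠ[𝓝 a] k := by
      filter_upwards [hkg] with s hs
      by_cases h : s = a
      · simp [hq, h]
      · simp only [hq, h, if_false, hs, smul_eq_mul]
        exact mul_div_cancel_left₀ _ (hsub s h)
    have hqd : Differentiable ℂ q := by
      intro s
      by_cases h : s = a
      · rw [h]; exact hqk.symm.differentiableAt_iff.1 hk.differentiableAt
      · have : (fun s => g s / (s - a) ^ m) =ᶠ[𝓝 s] q := by
          filter_upwards [isOpen_ne.mem_nhds h] with t ht
          simp only [hq]
          rw [if_neg ht]
        refine this.differentiableAt_iff.1 ?_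
        exact (hg s).div (by fun_prop) (hsub s h)
    have hgq : ∀ s, g s = (s - a) ^ m * q s := by
      intro s
      by_cases h : s = a
      · rw [h]
        have := hkg.self_of_nhds
        simpa [hq] using this
      · simp only [hq, h, if_false]
        rw [mul_div_cancel₀ _ (hsub s h)]
    refine ⟨q, hqd, fun s => ?_, fun ρ hρ => ?_⟩
    · rw [Finset.prod_insert ha, hfg s, hgq s, ← hm]
      ring
    · rcases Finset.mem_insert.1 hρ with rfl | h
      · simpa [hq] using hka
      · intro h'
        exact hgS ρ h (by rw [hgq, h', mul_zero])

theorem norm_logDeriv_sub_logDeriv_zero_le {g : ℂ → ℂ} (hg : Differentiable ℂ g) {R M : ℝ}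
    (hR : 0 < R) (hM : 0 < M) (h0 : ∀ z ∈ ball (0 : ℂ) (2 * R), g z ≠ 0)
    (hbd : ∀ z ∈ ball (0 : ℂ) (2 * R), ‖g z‖ ≤ Real.exp M * ‖g 0‖) {s : ℂ} (hs : ‖s‖ < R / 4) :
    ‖logDeriv g s - logDeriv g 0‖ ≤ 16 * M / R ^ 2 * ‖s‖ := by
  have hmem0 : (0 : ℂ) ∈ ball (0 : ℂ) (2 * R) := mem_ball_self (by positivity)
  have hLd : DifferentiableOn ℂ (logDeriv g) (ball 0 (2 * R)) := by
    intro z hz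
    refine DifferentiableAt.differentiableWithinAt ?_
    exact (hg.analyticAt z).deriv.differentiableAt.div (hg z) (h0 z hz)
  obtain ⟨h, hh0, hh⟩ := (hLd.isExactOn_ball).with_val_at 0 0
  have hhd : DifferentiableOn ℂ h (ball 0 (2 * R)) := fun z hz =>
    (hh z hz).differentiableAt.differentiableWithinAt
  have hexp : ∀ z ∈ ball (0 : ℂ) (2 * R), g z = g 0 * exp (h z) := by
    have hconst : ∀ z ∈ ball (0 : ℂ) (2 * R), HasDerivAt (fun z => g z * exp (-h z)) 0 z := by
      intro z hz
      have := (hg z).hasDerivAt.mul (hh z hz).neg.cexp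
      have e : deriv g z * exp (-h z) + g z * (exp (-h z) * -logDeriv g z) = 0 := by
        rw [logDeriv_apply]
        field_simp [h0 z hz]
        ring
      rw [← e]
      exact (hg z).hasDerivAt.mul (hh z hz).neg.cexp
    intro z hz
    have := (convex_ball (0 : ℂ) (2 * R)).is_const_of_fderivWithin_eq_zero (𝕜 := ℂ)
      (f := fun z => g z * exp (-h z))
      (fun x hx => (hconst x hx).differentiableAt.differentiableWithinAt)
      (fun x hx => by
        have h1 := (hconst x hx).hasFDerivAt.hasFDerivWithinAt (s := ball (0 : ℂ) (2 * R))
        rw [h1.fderivWithin (isOpen_ball.uniqueDiffWithinAt hx)]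
        ext; simp) hz hmem0
    simp only [hh0, neg_zero, exp_zero, mul_one] at this
    rw [← this, mul_assoc, ← exp_add]
    simp
  have hre : Set.MapsTo h (ball 0 (2 * R)) {z | z.re ≤ M} := by
    intro z hz
    have h1 := hbd z hz
    rw [hexp z hz, norm_mul, norm_exp, mul_comm] at h1
    have h2 := le_of_mul_le_mul_right h1 (norm_pos_iff.2 (h0 0 hmem0))
    exact Real.exp_le_exp.1 h2
  have hhb : ∀ z : ℂ, ‖z‖ ≤ R → ‖h z‖ ≤ 2 * M := by
    intro z hz
    have hzb : z ∈ ball (0 : ℂ) (2 * R) := by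
      rw [mem_ball_zero_iff]; linarith
    refine (borelCaratheodory_zero hM hhd hre (by positivity) hzb hh0).trans ?_
    rw [div_le_iff₀ (by linarith)]
    nlinarith
  have hder : ∀ z ∈ ball (0 : ℂ) (2 * R), deriv h z = logDeriv g z := fun z hz => (hh z hz).deriv
  have hLb : ∀ z : ℂ, ‖z‖ ≤ R / 2 → ‖logDeriv g z‖ ≤ 4 * M / R := by
    intro z hz
    have hzb : z ∈ ball (0 : ℂ) (2 * R) := by
      rw [mem_ball_zero_iff]; linarith
    rw [← hder z hzb]
    have hsub : closedBall z (R / 2) ⊆ ball 0 (2 * R) := by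
      refine closedBall_subset_ball' ?_
      rw [dist_zero_right]; linarith
    have := norm_deriv_le_of_forall_mem_sphere_norm_le (c := z) (R := R / 2) (C := 2 * M) (f := h)
      (by positivity) ((hhd.mono hsub).diffContOnCl_ball subset_rfl) (fun w hw => by
        refine hhb w ?_
        rw [mem_sphere, dist_eq] at hw
        calc ‖w‖ = ‖(w - z) + z‖ := by ring_nf
          _ ≤ ‖w - z‖ + ‖z‖ := norm_add_le _ _
          _ ≤ R := by linarith)
    refine this.trans (le_of_eq ?_)
    field_simp; ring
  have hL2 : ∀ z ∈ ball (0 : ℂ) (R / 4), ‖deriv (logDeriv g) z‖ ≤ 16 * M / R ^ 2 := by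
    intro z hz
    rw [mem_ball_zero_iff] at hz
    have hsub : closedBall z (R / 4) ⊆ ball 0 (2 * R) := by
      refine closedBall_subset_ball' ?_
      rw [dist_zero_right]; linarith
    have := norm_deriv_le_of_forall_mem_sphere_norm_le (c := z) (R := R / 4) (C := 4 * M / R)
      (f := logDeriv g)
      (by positivity) ((hLd.mono hsub).diffContOnCl_ball subset_rfl) (fun w hw => by
        refine hLb w ?_
        rw [mem_sphere, dist_eq] at hw
        calc ‖w‖ = ‖(w - z) + z‖ := by ring_nf
          _ ≤ ‖w - z‖ + ‖z‖ := norm_add_le _ _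
          _ ≤ R / 2 := by linarith)
    refine this.trans (le_of_eq ?_)
    field_simp; ring
  have := (convex_ball (0 : ℂ) (R / 4)).norm_image_sub_le_of_norm_deriv_le (f := logDeriv g)
    (x := 0) (y := s) (C := 16 * M / R ^ 2)
    (fun x hx => (hLd.differentiableAt (isOpen_ball.mem_nhds
      (ball_subset_ball (by linarith) hx)))) hL2 (mem_ball_self (by positivity))
    (by rwa [mem_ball_zero_iff])
  simpa using this

/-- Partial-fraction approximation of the logarithmic derivative of an entire function by the
zeros in a large disc. -/
theorem norm_logDeriv_sub_sum_zeros_le {f : ℂ → ℂ} (hf : Differentiable ℂ f) (h0 : f 0 ≠ 0)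
    {R M : ℝ} (hR : 0 < R) (hM : 0 < M) {S : Finset ℂ}
    (hS : ∀ ρ, ρ ∈ S ↔ f ρ = 0 ∧ ‖ρ‖ ≤ 2 * R)
    (hbd : ∀ z : ℂ, ‖z‖ = 4 * R → ‖f z‖ ≤ Real.exp M * ‖f 0‖) {s : ℂ} (hs : ‖s‖ < R / 4)
    (hfs : f s ≠ 0) :
    ‖logDeriv f s - logDeriv f 0 -
      ∑ ρ ∈ S, (analyticOrderNatAt f ρ : ℂ) * (1 / (s - ρ) + 1 / ρ)‖ ≤
      16 * M / R ^ 2 * ‖s‖ := by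
  obtain ⟨g, hg, hfg, hgS⟩ := exists_factor_out_zeros hf h0 S
  set P : ℂ → ℂ := fun s => ∏ ρ ∈ S, (s - ρ) ^ analyticOrderNatAt f ρ with hP
  have hgz : ∀ z : ℂ, ‖z‖ ≤ 2 * R → g z ≠ 0 := by
    intro z hz hgz
    have : f z = 0 := by rw [hfg, hgz, mul_zero]
    exact hgS z ((hS z).2 ⟨this, hz⟩) hgz
  have hld : ∀ z, f z ≠ 0 → logDeriv f z =
      ∑ ρ ∈ S, (analyticOrderNatAt f ρ : ℂ) * (1 / (z - ρ)) + logDeriv g z := by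
    intro z hz
    have hPz : P z ≠ 0 := fun h => hz (by rw [hfg]; simp only [hP] at h; rw [h, zero_mul])
    have hgz' : g z ≠ 0 := fun h => hz (by rw [hfg, h, mul_zero])
    have hfe : f = fun z => P z * g z := funext hfg
    conv_lhs => rw [hfe]
    have hne : ∀ ρ ∈ S, z - ρ ≠ 0 := by
      intro ρ hρ h
      rw [sub_eq_zero] at h
      exact hz (h ▸ ((hS ρ).1 hρ).1)
    rw [logDeriv_mul z hPz hgz' (by rw [hP]; fun_prop) (hg z), hP,
      logDeriv_prod (f := fun ρ z => (z - ρ) ^ analyticOrderNatAt f ρ)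
        (fun ρ hρ => pow_ne_zero _ (hne ρ hρ)) (fun ρ _ => by fun_prop)]
    congr 1
    refine Finset.sum_congr rfl fun ρ hρ => ?_
    rw [logDeriv_fun_pow (f := fun z => z - ρ) (by fun_prop)]
    congr 1
    rw [logDeriv_apply]
    simp
  have key : logDeriv f s - logDeriv f 0 -
      ∑ ρ ∈ S, (analyticOrderNatAt f ρ : ℂ) * (1 / (s - ρ) + 1 / ρ) =
      logDeriv g s - logDeriv g 0 := by
    rw [hld s hfs, hld 0 h0]
    have : ∀ ρ : ℂ, (1 : ℂ) / (0 - ρ) = -(1 / ρ) := fun ρ => by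
      rw [zero_sub, div_neg]
    simp only [this, mul_add, Finset.sum_add_distrib, mul_neg, Finset.sum_neg_distrib]
    ring
  rw [key]
  refine norm_logDeriv_sub_logDeriv_zero_le hg hR hM
    (fun z hz => hgz z (by rw [mem_ball_zero_iff] at hz; exact hz.le)) ?_ hs
  intro z hz
  have hfr : ∀ w ∈ frontier (ball (0 : ℂ) (4 * R)), ‖g w‖ ≤ Real.exp M * ‖g 0‖ := by
    intro w hw
    rw [frontier_ball _ (by positivity), mem_sphere_zero_iff_norm] at hw
    have h1 := hbd w hw
    rw [hfg w, hfg 0, norm_mul, norm_mul] at h1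
    have hPP : ‖∏ ρ ∈ S, ((0 : ℂ) - ρ) ^ analyticOrderNatAt f ρ‖ ≤
        ‖∏ ρ ∈ S, (w - ρ) ^ analyticOrderNatAt f ρ‖ := by
      rw [norm_prod, norm_prod]
      refine Finset.prod_le_prod (fun _ _ => norm_nonneg _) fun ρ hρ => ?_
      rw [norm_pow, norm_pow]
      refine pow_le_pow_left₀ (norm_nonneg _) ?_ _
      rw [zero_sub, norm_neg]
      have := norm_sub_norm_le w ρ
      have := ((hS ρ).1 hρ).2
      linarith
    have hpos : 0 < ‖∏ ρ ∈ S, ((0 : ℂ) - ρ) ^ analyticOrderNatAt f ρ‖ := by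
      rw [norm_pos_iff]
      intro h
      exact h0 (by rw [hfg 0, h, zero_mul])
    refine le_of_mul_le_mul_left ?_ hpos
    calc _ ≤ ‖∏ ρ ∈ S, (w - ρ) ^ analyticOrderNatAt f ρ‖ * ‖g w‖ := by gcongr
      _ ≤ _ := h1
      _ = _ := by ring
  refine norm_le_of_forall_mem_frontier_norm_le isBounded_ball hg.diffContOnCl hfr ?_
  refine subset_closure (ball_subset_ball (by linarith) hz)

theorem finite_zeros_closedBall {f : ℂ → ℂ} (hf : Differentiable ℂ f) (h0 : f 0 ≠ 0) (R : ℝ) :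
    {ρ : ℂ | f ρ = 0 ∧ ‖ρ‖ ≤ R}.Finite := by
  have hcod : f ⁻¹' {0}ᶜ ∈ codiscrete ℂ :=
    AnalyticOnNhd.preimage_zero_mem_codiscrete (fun z _ => hf.analyticAt z) h0
  have hcomp := mem_codiscrete'.1 hcod
  have hc : IsClosed (f ⁻¹' {0}) := isClosed_singleton.preimage hf.continuous
  have hd : IsDiscrete (f ⁻¹' {0}) := by simpa using hcomp.2
  have : {ρ : ℂ | f ρ = 0 ∧ ‖ρ‖ ≤ R} = closedBall 0 R ∩ f ⁻¹' {0} := by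
    ext ρ; simp [and_comm]
  rw [this]
  exact ((isCompact_closedBall 0 R).inter_right hc).finite (hd.mono Set.inter_subset_right)

/-- Hadamard's partial-fraction expansion of `f'/f` for an entire function of order less than `2`,
as a limit over discs. -/
theorem tendsto_sum_zeros_logDeriv {f : ℂ → ℂ} (hf : Differentiable ℂ f) (h0 : f 0 = 1) {C : ℝ}
    (hC : ∀ z : ℂ, ‖f z‖ ≤ Real.exp (C * (1 + ‖z‖) ^ (3 / 2 : ℝ))) {Z : ℕ → Finset ℂ}
    (hZ : ∀ n ρ, ρ ∈ Z n ↔ f ρ = 0 ∧ ‖ρ‖ ≤ n) {s : ℂ} (hs : f s ≠ 0) :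
    Tendsto (fun n => ∑ ρ ∈ Z n, (analyticOrderNatAt f ρ : ℂ) * (1 / (s - ρ) + 1 / ρ)) atTop
      (𝓝 (logDeriv f s - logDeriv f 0)) := by
  set D := |C| + 1 with hD
  have hDpos : 0 < D := by positivity
  have hbound : ∀ᶠ n : ℕ in atTop, ‖(logDeriv f s - logDeriv f 0) -
      ∑ ρ ∈ Z n, (analyticOrderNatAt f ρ : ℂ) * (1 / (s - ρ) + 1 / ρ)‖ ≤
      64 * D * ‖s‖ * 3 ^ (3 / 2 : ℝ) * (n : ℝ) ^ (-(1 / 2) : ℝ) := by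
    filter_upwards [eventually_gt_atTop 0, eventually_gt_atTop ⌈8 * ‖s‖⌉₊] with n hn hn2
    have hn' : (1 : ℝ) ≤ n := by exact_mod_cast hn
    have hns : 8 * ‖s‖ < n := (Nat.le_ceil _).trans_lt (by exact_mod_cast hn2)
    have := norm_logDeriv_sub_sum_zeros_le hf (by rw [h0]; exact one_ne_zero) (R := n / 2)
      (M := D * (1 + 2 * n) ^ (3 / 2 : ℝ)) (S := Z n) (s := s) (by positivity) (by positivity)
      (fun ρ => by rw [hZ]; simp [mul_div_cancel₀]) (fun z hz => by
        rw [h0, norm_one, mul_one]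
        refine (hC z).trans (Real.exp_le_exp.2 ?_)
        have : ‖z‖ = 2 * n := by rw [hz]; ring
        rw [this]
        gcongr
        rw [hD]
        linarith [le_abs_self C]) (by linarith) hs
    refine this.trans ?_
    have h3 : (1 + 2 * (n : ℝ)) ^ (3 / 2 : ℝ) ≤ 3 ^ (3 / 2 : ℝ) * (n : ℝ) ^ (3 / 2 : ℝ) := by
      rw [← Real.mul_rpow (by norm_num) (by positivity)]
      gcongr
      linarith
    have h4 : (n : ℝ) ^ (3 / 2 : ℝ) / (n : ℝ) ^ 2 = (n : ℝ) ^ (-(1 / 2) : ℝ) := by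
      rw [← Real.rpow_natCast, ← Real.rpow_sub (by positivity)]
      norm_num
    calc 16 * (D * (1 + 2 * (n : ℝ)) ^ (3 / 2 : ℝ)) / ((n : ℝ) / 2) ^ 2 * ‖s‖
        = 64 * D * ‖s‖ * ((1 + 2 * (n : ℝ)) ^ (3 / 2 : ℝ) / (n : ℝ) ^ 2) := by
          field_simp; ring
      _ ≤ 64 * D * ‖s‖ * (3 ^ (3 / 2 : ℝ) * (n : ℝ) ^ (3 / 2 : ℝ) / (n : ℝ) ^ 2) := by gcongr
      _ = _ := by rw [mul_div_assoc, h4]; ring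
  have hlim : Tendsto (fun n : ℕ => 64 * D * ‖s‖ * 3 ^ (3 / 2 : ℝ) * (n : ℝ) ^ (-(1 / 2) : ℝ))
      atTop (𝓝 0) := by
    have := ((tendsto_rpow_neg_atTop (y := 1 / 2) (by norm_num)).comp
      tendsto_natCast_atTop_atTop).const_mul (64 * D * ‖s‖ * 3 ^ (3 / 2 : ℝ))
    simpa using this
  have := squeeze_zero_norm' hbound hlim
  have h2 := (tendsto_const_nhds (x := logDeriv f s - logDeriv f 0)).sub this
  simpa using h2

/-- The entire function `s (s - 1) Λ(s)`, where `Λ` is the completed zeta function. -/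
noncomputable def xiFun (s : ℂ) : ℂ := s * (s - 1) * completedRiemannZeta₀ s + 1

theorem differentiable_xiFun : Differentiable ℂ xiFun := by
  have := differentiable_completedZeta₀
  unfold xiFun
  fun_prop

theorem xiFun_zero : xiFun 0 = 1 := by simp [xiFun]

theorem xiFun_one : xiFun 1 = 1 := by simp [xiFun]

theorem xiFun_one_sub (s : ℂ) : xiFun (1 - s) = xiFun s := by
  simp only [xiFun, completedRiemannZeta₀_one_sub]
  ring

theorem xiFun_eq {s : ℂ} (h0 : s ≠ 0) (h1 : s ≠ 1) :
    xiFun s = s * (s - 1) * completedRiemannZeta s := by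
  have h2 : s - 1 ≠ 0 := sub_ne_zero.2 h1
  have h3 : 1 - s ≠ 0 := sub_ne_zero.2 h1.symm
  rw [completedRiemannZeta_eq, xiFun]
  field_simp
  ring

theorem xiFun_eq_zeta {s : ℂ} (h0 : 0 < s.re) (h1 : s ≠ 1) :
    xiFun s = s * (s - 1) * (Gammaℝ s * riemannZeta s) := by
  have hs : s ≠ 0 := by rintro rfl; simp at h0
  rw [xiFun_eq hs h1, riemannZeta_def_of_ne_zero hs,
    mul_div_cancel₀ _ (Gammaℝ_ne_zero_of_re_pos h0)]

theorem xiFun_ne_zero_of_one_le_re {s : ℂ} (hs : 1 ≤ s.re) : xiFun s ≠ 0 := by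
  by_cases h1 : s = 1
  · rw [h1, xiFun_one]; exact one_ne_zero
  have h0 : 0 < s.re := by linarith
  have hs0 : s ≠ 0 := by rintro rfl; simp at h0
  rw [xiFun_eq_zeta h0 h1]
  exact mul_ne_zero (mul_ne_zero hs0 (sub_ne_zero.2 h1))
    (mul_ne_zero (Gammaℝ_ne_zero_of_re_pos h0) (riemannZeta_ne_zero_of_one_le_re hs))

theorem re_mem_Ioo_of_xiFun_eq_zero {s : ℂ} (hs : xiFun s = 0) : 0 < s.re ∧ s.re < 1 := by
  constructor
  · by_contra h
    refine xiFun_ne_zero_of_one_le_re (s := 1 - s) ?_ (by rw [xiFun_one_sub, hs])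
    simp; linarith
  · by_contra h
    exact xiFun_ne_zero_of_one_le_re (by linarith) hs

theorem hasDerivAt_xiFun_zero : HasDerivAt xiFun (-completedRiemannZeta₀ 0) 0 := by
  have h := (((hasDerivAt_id (0 : ℂ)).mul ((hasDerivAt_id (0 : ℂ)).sub_const 1)).mul
    (differentiable_completedZeta₀ 0).hasDerivAt).add_const 1
  have e : ((1 : ℂ) * (id 0 - 1) + id 0 * 1) * completedRiemannZeta₀ 0 +
      id 0 * (id 0 - 1) * deriv completedRiemannZeta₀ 0 = -completedRiemannZeta₀ 0 := by simp
  rw [← e]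
  exact h

theorem logDeriv_xiFun_zero :
    logDeriv xiFun 0 =
      -((1 + (Real.eulerMascheroniConstant - Real.log (4 * Real.pi)) / 2 : ℝ) : ℂ) := by
  rw [logDeriv_apply, xiFun_zero, hasDerivAt_xiFun_zero.deriv, completedRiemannZeta₀_zero]
  push_cast [Complex.ofReal_log (show (0 : ℝ) ≤ 4 * Real.pi by positivity)]
  ring

theorem logDeriv_xiFun_one_sub (s : ℂ) : logDeriv xiFun (1 - s) = -logDeriv xiFun s := by
  have h : deriv xiFun s = -deriv xiFun (1 - s) := by
    have h1 : HasDerivAt (fun s => xiFun (1 - s)) (deriv xiFun (1 - s) * (-1)) s := by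
      exact ((differentiable_xiFun (1 - s)).hasDerivAt).comp s ((hasDerivAt_id s).const_sub 1)
    rw [funext xiFun_one_sub] at h1
    rw [h1.deriv]; ring
  rw [logDeriv_apply, logDeriv_apply, xiFun_one_sub, h]
  ring

theorem analyticOrderNatAt_xiFun_one_sub (ρ : ℂ) :
    analyticOrderNatAt xiFun (1 - ρ) = analyticOrderNatAt xiFun ρ := by
  have h1 : HasDerivAt (fun s : ℂ => 1 - s) (-1) ρ := by
    simpa using (hasDerivAt_id ρ).const_sub 1
  have h := analyticOrderAt_comp_of_deriv_ne_zero (f := xiFun) (g := fun s : ℂ => 1 - s) (z₀ := ρ)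
    (by fun_prop) (by rw [h1.deriv]; norm_num)
  have e : xiFun ∘ (fun s : ℂ => 1 - s) = xiFun := funext xiFun_one_sub
  rw [e] at h
  unfold analyticOrderNatAt
  rw [h]

theorem norm_Gamma_le_Gamma_re {s : ℂ} (hs : 0 < s.re) : ‖Gamma s‖ ≤ Real.Gamma s.re := by
  rw [Gamma_eq_integral hs, Real.Gamma_eq_integral hs, GammaIntegral]
  refine (MeasureTheory.norm_integral_le_integral_norm _).trans (le_of_eq ?_)
  refine MeasureTheory.setIntegral_congr_fun measurableSet_Ioi fun x hx => ?_
  simp only [norm_mul, norm_real, Real.norm_eq_abs, Real.abs_exp]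
  rw [norm_cpow_eq_rpow_re_of_pos hx]
  simp

theorem Gamma_le_exp_rpow {x : ℝ} (hx : 2 ≤ x) :
    Real.Gamma x ≤ Real.exp (2 * (x + 1) ^ (3 / 2 : ℝ)) := by
  set n := ⌈x⌉₊ with hn
  have hxn : x ≤ n := Nat.le_ceil x
  have hnx : (n : ℝ) ≤ x + 1 := (Nat.ceil_lt_add_one (by linarith)).le
  have hn2 : (2 : ℝ) ≤ n := by linarith
  have h1 : Real.Gamma x ≤ Real.Gamma (n + 1) :=
    Real.Gamma_strictMonoOn_Ici.monotoneOn hx (by simp; linarith) (by linarith)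
  rw [Real.Gamma_nat_eq_factorial] at h1
  refine h1.trans ?_
  have h2 : ((n.factorial : ℕ) : ℝ) ≤ (n : ℝ) ^ n := by exact_mod_cast Nat.factorial_le_pow n
  refine h2.trans ?_
  have hpos : (0 : ℝ) < n := by linarith
  rw [← Real.rpow_natCast, Real.rpow_def_of_pos hpos, Real.exp_le_exp]
  have h3 : Real.log n ≤ (n : ℝ) ^ (1 / 2 : ℝ) / (1 / 2) :=
    Real.log_le_rpow_div hpos.le (by norm_num)
  calc Real.log n * n ≤ ((n : ℝ) ^ (1 / 2 : ℝ) / (1 / 2)) * n := by gcongr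
    _ = 2 * (n : ℝ) ^ (3 / 2 : ℝ) := by
      rw [show (3 / 2 : ℝ) = 1 / 2 + 1 by norm_num, Real.rpow_add_one hpos.ne']
      ring
    _ ≤ _ := by gcongr

theorem exists_norm_completedRiemannZeta₀_le_of_strip (a b : ℝ) :
    ∃ K : ℝ, ∀ s : ℂ, a ≤ s.re → s.re ≤ b → ‖completedRiemannZeta₀ s‖ ≤ K := by
  set f := (HurwitzZeta.hurwitzEvenFEPair 0).f_modif with hf
  have hconv : ∀ s : ℂ, MellinConvergent f s := fun s =>
    ((HurwitzZeta.hurwitzEvenFEPair 0).isStrongFEPair_toStrongFEPair.hasMellin s).1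
  have hint : ∀ r : ℝ, MeasureTheory.IntegrableOn (fun t : ℝ => t ^ (r / 2 - 1) * ‖f t‖)
      (Set.Ioi 0) := by
    intro r
    have h1 : MeasureTheory.IntegrableOn _ _ _ := (hconv ((r : ℂ) / 2)).norm
    refine h1.congr_fun (fun t ht => ?_) measurableSet_Ioi
    simp only [norm_smul]
    rw [norm_cpow_eq_rpow_re_of_pos ht]
    simp
  refine ⟨((∫ t in Set.Ioi (0 : ℝ), t ^ (a / 2 - 1) * ‖f t‖) +
    ∫ t in Set.Ioi (0 : ℝ), t ^ (b / 2 - 1) * ‖f t‖) / 2, fun s ha hb => ?_⟩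
  have hdef : completedRiemannZeta₀ s = mellin f (s / 2) / 2 := rfl
  rw [hdef, norm_div, Complex.norm_ofNat]
  gcongr
  rw [← MeasureTheory.integral_add (hint a) (hint b), mellin]
  refine (MeasureTheory.norm_integral_le_integral_norm _).trans ?_
  refine MeasureTheory.setIntegral_mono_on (hconv _).norm ((hint a).add (hint b))
    measurableSet_Ioi fun t ht => ?_
  rw [norm_smul, norm_cpow_eq_rpow_re_of_pos ht, ← add_mul]
  refine mul_le_mul_of_nonneg_right ?_ (norm_nonneg _)
  have hre : (s / 2 - 1).re = s.re / 2 - 1 := by simp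
  rw [hre]
  have ht' : (0 : ℝ) < t := ht
  rcases le_total t 1 with h | h
  · have := Real.rpow_le_rpow_of_exponent_ge ht' h (show a / 2 - 1 ≤ s.re / 2 - 1 by linarith)
    have := Real.rpow_nonneg ht'.le (b / 2 - 1)
    linarith
  · have := Real.rpow_le_rpow_of_exponent_le h (show s.re / 2 - 1 ≤ b / 2 - 1 by linarith)
    have := Real.rpow_nonneg ht'.le (a / 2 - 1)
    linarith

theorem exists_norm_xiFun_le :
    ∃ C : ℝ, ∀ z : ℂ, ‖xiFun z‖ ≤ Real.exp (C * (1 + ‖z‖) ^ (3 / 2 : ℝ)) := by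
  obtain ⟨K₀, hK₀⟩ := exists_norm_completedRiemannZeta₀_le_of_strip (-3) 4
  set W : ℝ := ∑' n : ℕ, 1 / (n : ℝ) ^ (4 : ℝ) with hW
  set K := max (max |K₀| W) 1 with hK
  have hK1 : 1 ≤ K := le_max_right _ _
  have hpoly : ∀ x : ℝ, 1 ≤ x → x ^ 2 * (2 * K) ≤ Real.exp ((2 + 2 * K) * x ^ (3 / 2 : ℝ)) := by
    intro x hx
    have h1 : x ≤ x ^ (3 / 2 : ℝ) := by
      conv_lhs => rw [← Real.rpow_one x]
      exact Real.rpow_le_rpow_of_exponent_le hx (by norm_num)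
    have h2 : x ≤ Real.exp x := (Real.add_one_le_exp x).trans' (by linarith)
    have h3 : 2 * K ≤ Real.exp (2 * K) := (Real.add_one_le_exp _).trans' (by linarith)
    calc x ^ 2 * (2 * K) ≤ Real.exp x ^ 2 * Real.exp (2 * K) := by gcongr
      _ = Real.exp (2 * x + 2 * K) := by rw [← Real.exp_nat_mul, ← Real.exp_add]; norm_num
      _ ≤ _ := by
        refine Real.exp_le_exp.2 ?_
        nlinarith
  have hright : ∀ z : ℂ, 1 / 2 ≤ z.re → ‖xiFun z‖ ≤
      Real.exp ((2 + 2 * K + 2) * (1 + ‖z‖) ^ (3 / 2 : ℝ)) := by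
    intro z hz
    have hz1 : ‖z - 1‖ ≤ 1 + ‖z‖ := by
      refine (norm_sub_le _ _).trans ?_
      rw [norm_one, add_comm]
    have hx1 : 1 ≤ 1 + ‖z‖ := by linarith [norm_nonneg z]
    have hzz : ‖z * (z - 1)‖ ≤ (1 + ‖z‖) ^ 2 := by
      rw [norm_mul, pow_two]
      gcongr
      linarith
    rcases le_total z.re 4 with h4 | h4
    · have h1 := hK₀ z (by linarith) h4
      have h2 : ‖completedRiemannZeta₀ z‖ ≤ K :=
        h1.trans ((le_abs_self _).trans ((le_max_left _ _).trans (le_max_left _ _)))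
      calc ‖xiFun z‖ ≤ ‖z * (z - 1) * completedRiemannZeta₀ z‖ + ‖(1 : ℂ)‖ := norm_add_le _ _
        _ ≤ (1 + ‖z‖) ^ 2 * K + 1 := by
          rw [norm_mul, norm_one]; gcongr
        _ ≤ (1 + ‖z‖) ^ 2 * (2 * K) := by nlinarith
        _ ≤ _ := hpoly _ hx1
        _ ≤ _ := by
          refine Real.exp_le_exp.2 (mul_le_mul_of_nonneg_right ?_ (by positivity))
          linarith
    · have h0 : z ≠ 0 := by rintro rfl; norm_num at hz
      have h1 : z ≠ 1 := by rintro rfl; norm_num at h4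
      have hre : (z / 2).re = z.re / 2 := by simp
      have hG : ‖Gamma (z / 2)‖ ≤ Real.exp (2 * (1 + ‖z‖) ^ (3 / 2 : ℝ)) := by
        refine (norm_Gamma_le_Gamma_re (by rw [hre]; linarith)).trans ?_
        rw [hre]
        refine (Gamma_le_exp_rpow (by linarith)).trans (Real.exp_le_exp.2 ?_)
        have := re_le_norm z
        gcongr ?_ * ?_ ^ _
        linarith
      have hp : ‖(Real.pi : ℂ) ^ (-z / 2)‖ ≤ 1 := by
        rw [norm_cpow_eq_rpow_re_of_pos Real.pi_pos]
        refine Real.rpow_le_one_of_one_le_of_nonpos (by linarith [Real.pi_gt_three]) ?_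
        simp; linarith
      have hζ : ‖∑' n : ℕ, 1 / (n : ℂ) ^ z‖ ≤ K := by
        have hs : Summable fun n : ℕ => 1 / (n : ℝ) ^ (4 : ℝ) :=
          Real.summable_one_div_nat_rpow.2 (by norm_num)
        have hle : ∀ n : ℕ, ‖1 / (n : ℂ) ^ z‖ ≤ 1 / (n : ℝ) ^ (4 : ℝ) := by
          intro n
          rcases Nat.eq_zero_or_pos n with rfl | hn
          · simp [zero_cpow h0]
          · rw [norm_div, norm_one, norm_natCast_cpow_of_pos hn]
            have hn1 : (1 : ℝ) ≤ n := by exact_mod_cast hn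
            gcongr
        exact (tsum_of_norm_bounded hs.hasSum hle).trans
          ((le_max_right _ _).trans (le_max_left _ _))
      rw [xiFun_eq h0 h1, completedZeta_eq_tsum_of_one_lt_re (by linarith), norm_mul (z * (z - 1)),
        norm_mul _ (∑' n : ℕ, 1 / (n : ℂ) ^ z), norm_mul _ (Gamma (z / 2))]
      calc ‖z * (z - 1)‖ * (‖(Real.pi : ℂ) ^ (-z / 2)‖ * ‖Gamma (z / 2)‖ *
            ‖∑' n : ℕ, 1 / (n : ℂ) ^ z‖)
          ≤ (1 + ‖z‖) ^ 2 * (1 * Real.exp (2 * (1 + ‖z‖) ^ (3 / 2 : ℝ)) * K) := by gcongr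
        _ ≤ ((1 + ‖z‖) ^ 2 * (2 * K)) * Real.exp (2 * (1 + ‖z‖) ^ (3 / 2 : ℝ)) := by
          have : 0 ≤ (1 + ‖z‖) ^ 2 * K * Real.exp (2 * (1 + ‖z‖) ^ (3 / 2 : ℝ)) := by positivity
          linarith
        _ ≤ Real.exp ((2 + 2 * K) * (1 + ‖z‖) ^ (3 / 2 : ℝ)) *
            Real.exp (2 * (1 + ‖z‖) ^ (3 / 2 : ℝ)) := by
          gcongr
          exact hpoly _ hx1
        _ = _ := by rw [← Real.exp_add, ← add_mul]
  refine ⟨(2 + 2 * K + 2) * 2 ^ (3 / 2 : ℝ), fun z => ?_⟩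
  have hmul : (2 + 2 * K + 2) * 2 ^ (3 / 2 : ℝ) * (1 + ‖z‖) ^ (3 / 2 : ℝ) =
      (2 + 2 * K + 2) * (2 * (1 + ‖z‖)) ^ (3 / 2 : ℝ) := by
    rw [Real.mul_rpow (by norm_num) (by positivity)]; ring
  rw [hmul]
  have hn := norm_nonneg z
  rcases le_total (1 / 2) z.re with h | h
  · refine (hright z h).trans (Real.exp_le_exp.2 ?_)
    gcongr
    linarith
  · rw [← xiFun_one_sub]
    refine (hright (1 - z) (by simp; linarith)).trans (Real.exp_le_exp.2 ?_)
    have : ‖1 - z‖ ≤ 1 + ‖z‖ := (norm_sub_le _ _).trans (by rw [norm_one])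
    gcongr
    linarith

/-- The zeros of `xiFun`, i.e. the nontrivial zeros of the Riemann zeta function. -/
abbrev XiZero := {ρ : ℂ // xiFun ρ = 0}

namespace XiZero

/-- The multiplicity of a zero. -/
noncomputable def mult (ρ : XiZero) : ℝ := analyticOrderNatAt xiFun ρ.1

/-- The symmetry `ρ ↦ 1 - ρ` of the zeros. -/
def reflect : XiZero ≃ XiZero where
  toFun ρ := ⟨1 - ρ.1, by rw [xiFun_one_sub, ρ.2]⟩
  invFun ρ := ⟨1 - ρ.1, by rw [xiFun_one_sub, ρ.2]⟩
  left_inv ρ := by ext; simp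
  right_inv ρ := by ext; simp

@[simp] theorem reflect_coe (ρ : XiZero) : ((reflect ρ : XiZero) : ℂ) = 1 - ρ := rfl

@[simp] theorem mult_reflect (ρ : XiZero) : (reflect ρ).mult = ρ.mult := by
  simp [mult, analyticOrderNatAt_xiFun_one_sub]

theorem one_le_mult (ρ : XiZero) : 1 ≤ ρ.mult := by
  have ha : AnalyticAt ℂ xiFun ρ.1 := differentiable_xiFun.analyticAt _
  have h1 : analyticOrderAt xiFun ρ.1 ≠ 0 := (ha.analyticOrderAt_ne_zero).2 ρ.2
  have h2 : analyticOrderAt xiFun ρ.1 ≠ ⊤ := by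
    intro h
    have := (AnalyticOnNhd.analyticOrderAt_eq_top_iff_eq_zero (f := xiFun) ρ.1
      (fun z => differentiable_xiFun.analyticAt z)).1 h
    have h0 := xiFun_zero
    rw [this] at h0
    simp at h0
  have h3 : analyticOrderNatAt xiFun ρ.1 ≠ 0 := by
    intro h
    rw [← Nat.cast_analyticOrderNatAt h2, h] at h1
    simp at h1
  rw [mult]
  exact_mod_cast Nat.one_le_iff_ne_zero.2 h3

theorem mult_nonneg (ρ : XiZero) : 0 ≤ ρ.mult := zero_le_one.trans ρ.one_le_mult

theorem re_pos (ρ : XiZero) : 0 < ρ.1.re := (re_mem_Ioo_of_xiFun_eq_zero ρ.2).1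

theorem re_lt_one (ρ : XiZero) : ρ.1.re < 1 := (re_mem_Ioo_of_xiFun_eq_zero ρ.2).2

theorem ne_zero (ρ : XiZero) : (ρ : ℂ) ≠ 0 := by
  intro h
  have := ρ.re_pos
  rw [h] at this
  simp at this

theorem one_sub_ne_zero (ρ : XiZero) : 1 - (ρ : ℂ) ≠ 0 := (reflect ρ).ne_zero

theorem re_inv_pos (ρ : XiZero) : 0 < (1 / (ρ : ℂ)).re := by
  rw [one_div, inv_re]
  exact div_pos ρ.re_pos (normSq_pos.2 ρ.ne_zero)

theorem re_mul_one_sub (ρ : XiZero) :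
    ((ρ : ℂ) * (1 - ρ)).re = ρ.1.re * (1 - ρ.1.re) + ρ.1.im ^ 2 := by
  simp; ring

theorem im_mul_one_sub (ρ : XiZero) :
    ((ρ : ℂ) * (1 - ρ)).im = ρ.1.im * (1 - 2 * ρ.1.re) := by
  simp; ring

theorem inv_mul_one_sub (ρ : XiZero) :
    1 / ((ρ : ℂ) * (1 - ρ)) = 1 / (ρ : ℂ) + 1 / (1 - ρ) := by
  have := ρ.ne_zero
  have := ρ.one_sub_ne_zero
  field_simp
  ring

theorem re_inv_mul_one_sub_pos (ρ : XiZero) : 0 < (1 / ((ρ : ℂ) * (1 - ρ))).re := by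
  rw [inv_mul_one_sub, add_re]
  exact add_pos ρ.re_inv_pos (reflect ρ).re_inv_pos

/-- The zeros of modulus at most `n`. -/
noncomputable def upTo (n : ℕ) : Finset XiZero :=
  ((finite_zeros_closedBall differentiable_xiFun (by simp [xiFun_zero]) n).preimage
    (f := ((↑) : XiZero → ℂ)) Subtype.val_injective.injOn).toFinset

theorem mem_upTo {n : ℕ} {ρ : XiZero} : ρ ∈ upTo n ↔ ‖(ρ : ℂ)‖ ≤ n := by
  simp [upTo, ρ.2]

theorem tendsto_upTo : Tendsto upTo atTop atTop := by
  refine tendsto_atTop_finset_of_monotone ?_ ?_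
  · intro a b hab ρ hρ
    rw [mem_upTo] at *
    exact hρ.trans (by exact_mod_cast hab)
  · intro ρ
    obtain ⟨n, hn⟩ := exists_nat_ge ‖(ρ : ℂ)‖
    exact ⟨n, mem_upTo.2 hn⟩

theorem tendsto_sum_logDeriv {s : ℂ} (hs : xiFun s ≠ 0) :
    Tendsto (fun n => ∑ ρ ∈ upTo n, (ρ.mult : ℂ) * (1 / (s - ρ) + 1 / (ρ : ℂ))) atTop
      (𝓝 (logDeriv xiFun s - logDeriv xiFun 0)) := by
  obtain ⟨C, hC⟩ := exists_norm_xiFun_le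
  have := tendsto_sum_zeros_logDeriv differentiable_xiFun xiFun_zero hC
    (Z := fun n => (upTo n).map ⟨_, Subtype.val_injective⟩) (fun n ρ => by
      simp only [Finset.mem_map, mem_upTo, Function.Embedding.coeFn_mk, Subtype.exists,
        exists_and_left, exists_prop, exists_eq_right_right]
      tauto) hs
  simpa [mult] using this

end XiZero

/-- The constant `-ξ'(0)/ξ(0)`. -/
noncomputable def xiConst : ℝ :=
  1 + (Real.eulerMascheroniConstant - Real.log (4 * Real.pi)) / 2

theorem logDeriv_xiFun_zero' : logDeriv xiFun 0 = -(xiConst : ℂ) := logDeriv_xiFun_zero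

theorem logDeriv_xiFun_one : logDeriv xiFun 1 = xiConst := by
  have := logDeriv_xiFun_one_sub 0
  rw [sub_zero, logDeriv_xiFun_zero', neg_neg] at this
  exact this

namespace XiZero

theorem hasSum_re_inv_mul_one_sub :
    HasSum (fun ρ : XiZero => ρ.mult * (1 / ((ρ : ℂ) * (1 - ρ))).re) (2 * xiConst) := by
  have h := tendsto_sum_logDeriv (s := 1) (by simp [xiFun_one])
  rw [logDeriv_xiFun_one, logDeriv_xiFun_zero'] at h
  have hre := (continuous_re.tendsto _).comp h
  have hlim : Tendsto (fun n => ∑ ρ ∈ upTo n, ρ.mult * (1 / ((ρ : ℂ) * (1 - ρ))).re) atTop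
      (𝓝 (2 * xiConst)) := by
    convert hre using 1
    · ext n
      simp only [Function.comp_apply, re_sum]
      refine Finset.sum_congr rfl fun ρ _ => ?_
      rw [inv_mul_one_sub, add_comm (1 / (ρ : ℂ)), re_ofReal_mul]
    · congr 1
      simp; ring
  have hnn : ∀ ρ : XiZero, 0 ≤ ρ.mult * (1 / ((ρ : ℂ) * (1 - ρ))).re := fun ρ =>
    mul_nonneg ρ.mult_nonneg ρ.re_inv_mul_one_sub_pos.le
  have hmono : Monotone fun u : Finset XiZero => ∑ ρ ∈ u, ρ.mult * (1 / ((ρ : ℂ) * (1 - ρ))).re :=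
    fun u v huv => Finset.sum_le_sum_of_subset_of_nonneg huv fun ρ _ _ => hnn ρ
  have hmono2 : Monotone upTo := fun a b hab ρ hρ => by
    rw [mem_upTo] at *
    exact hρ.trans (by exact_mod_cast hab)
  have hsum : Summable fun ρ : XiZero => ρ.mult * (1 / ((ρ : ℂ) * (1 - ρ))).re := by
    refine summable_of_sum_le hnn (c := 2 * xiConst) fun u => ?_
    obtain ⟨n, hn⟩ := (tendsto_upTo.eventually (eventually_ge_atTop u)).exists
    exact (hmono hn).trans ((hmono.comp hmono2).ge_of_tendsto hlim n)
  exact tendsto_nhds_unique (hsum.hasSum.comp tendsto_upTo) hlim ▸ hsum.hasSum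

end XiZero

theorem two_mul_xiConst_lt : 2 * xiConst < 0.0462 := by
  have h1 := eulerMascheroniConstant_lt
  have h2 := log_four_pi_gt
  rw [xiConst]
  linarith

namespace XiZero

theorem re_inv_eq (ρ : XiZero) : (1 / ((ρ : ℂ) * (1 - ρ))).re =
    (ρ.1.re * (1 - ρ.1.re) + ρ.1.im ^ 2) / normSq ((ρ : ℂ) * (1 - ρ)) := by
  rw [one_div, inv_re, re_mul_one_sub]

theorem normSq_mul_one_sub (ρ : XiZero) : normSq ((ρ : ℂ) * (1 - ρ)) =
    (ρ.1.re * (1 - ρ.1.re) + ρ.1.im ^ 2) ^ 2 + (ρ.1.im * (1 - 2 * ρ.1.re)) ^ 2 := by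
  rw [normSq_apply, re_mul_one_sub, im_mul_one_sub]; ring

theorem normSq_mul_one_sub_le (ρ : XiZero) : normSq ((ρ : ℂ) * (1 - ρ)) ≤
    (ρ.1.re * (1 - ρ.1.re) + ρ.1.im ^ 2) ^ 2 + (ρ.1.re * (1 - ρ.1.re) + ρ.1.im ^ 2) := by
  rw [normSq_mul_one_sub]
  have h : 0 ≤ ρ.1.re * (1 - ρ.1.re) := mul_nonneg ρ.re_pos.le (by linarith [ρ.re_lt_one])
  nlinarith [mul_nonneg (sq_nonneg ρ.1.im) h]

theorem re_mul_one_sub_pos (ρ : XiZero) : 0 < ρ.1.re * (1 - ρ.1.re) + ρ.1.im ^ 2 := by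
  have h : 0 < ρ.1.re * (1 - ρ.1.re) := mul_pos ρ.re_pos (by linarith [ρ.re_lt_one])
  positivity

theorem inv_le_re_inv (ρ : XiZero) : 1 / (ρ.1.re * (1 - ρ.1.re) + ρ.1.im ^ 2 + 1) ≤
    (1 / ((ρ : ℂ) * (1 - ρ))).re := by
  rw [re_inv_eq]
  have h := ρ.re_mul_one_sub_pos
  have h2 := ρ.normSq_mul_one_sub_le
  have h3 : 0 < normSq ((ρ : ℂ) * (1 - ρ)) :=
    normSq_pos.2 (mul_ne_zero ρ.ne_zero ρ.one_sub_ne_zero)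
  rw [div_le_div_iff₀ (by linarith) h3]
  nlinarith

theorem term_nonneg (ρ : XiZero) : 0 ≤ ρ.mult * (1 / ((ρ : ℂ) * (1 - ρ))).re :=
  mul_nonneg ρ.mult_nonneg ρ.re_inv_mul_one_sub_pos.le

theorem re_inv_le_term (ρ : XiZero) :
    (1 / ((ρ : ℂ) * (1 - ρ))).re ≤ ρ.mult * (1 / ((ρ : ℂ) * (1 - ρ))).re :=
  le_mul_of_one_le_left ρ.re_inv_mul_one_sub_pos.le ρ.one_le_mult

theorem im_ne_zero (ρ : XiZero) : ρ.1.im ≠ 0 := by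
  intro h0
  have h1 := le_hasSum hasSum_re_inv_mul_one_sub ρ fun σ _ => σ.term_nonneg
  have h2 := ρ.inv_le_re_inv
  have h3 := ρ.re_inv_le_term
  have h4 := two_mul_xiConst_lt
  have h5 : ρ.1.re * (1 - ρ.1.re) ≤ 1 / 4 := by nlinarith [sq_nonneg (ρ.1.re - 1 / 2)]
  have h6 : 1 / (5 / 4 : ℝ) ≤ 1 / (ρ.1.re * (1 - ρ.1.re) + ρ.1.im ^ 2 + 1) := by
    apply one_div_le_one_div_of_le
    · linarith [ρ.re_mul_one_sub_pos]
    · rw [h0]; linarith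
  linarith [h6.trans (h2.trans h3)]

theorem reflect_ne (ρ : XiZero) : reflect ρ ≠ ρ := by
  intro h
  have h1 : (1 - (ρ : ℂ)).im = ρ.1.im := by rw [← reflect_coe, h]
  simp at h1
  exact ρ.im_ne_zero (by linarith)

theorem lt_im_sq (ρ : XiZero) : 42 < ρ.1.im ^ 2 := by
  classical
  have h1 := sum_le_hasSum {ρ, reflect ρ} (fun σ _ => σ.term_nonneg) hasSum_re_inv_mul_one_sub
  rw [Finset.sum_pair ρ.reflect_ne.symm, mult_reflect, reflect_coe, sub_sub_cancel,
    mul_comm (1 - (ρ : ℂ))] at h1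
  have h2 := ρ.inv_le_re_inv
  have h3 := ρ.re_inv_le_term
  have h4 := two_mul_xiConst_lt
  have h5 : ρ.1.re * (1 - ρ.1.re) ≤ 1 / 4 := by nlinarith [sq_nonneg (ρ.1.re - 1 / 2)]
  by_contra! h
  have h6 : 1 / (43.25 : ℝ) ≤ 1 / (ρ.1.re * (1 - ρ.1.re) + ρ.1.im ^ 2 + 1) := by
    apply one_div_le_one_div_of_le
    · linarith [ρ.re_mul_one_sub_pos]
    · linarith
  linarith [h6.trans (h2.trans h3)]

theorem lt_abs_im (ρ : XiZero) : 6.48 < |ρ.1.im| :=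
  lt_of_pow_lt_pow_left₀ 2 (abs_nonneg _) (by rw [sq_abs]; have := ρ.lt_im_sq; linarith)

theorem inv_norm_le (ρ : XiZero) : 1 / ‖(ρ : ℂ) * (1 - ρ)‖ ≤
    1.012 * (1 / ((ρ : ℂ) * (1 - ρ))).re := by
  rw [re_inv_eq, ← Complex.sq_norm]
  have h := ρ.normSq_mul_one_sub_le
  rw [← Complex.sq_norm] at h
  have h0 : 0 < ‖(ρ : ℂ) * (1 - ρ)‖ := norm_pos_iff.2 (mul_ne_zero ρ.ne_zero ρ.one_sub_ne_zero)
  have h1 : 42 < ρ.1.re * (1 - ρ.1.re) + ρ.1.im ^ 2 := by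
    have h : 0 < ρ.1.re * (1 - ρ.1.re) := mul_pos ρ.re_pos (by linarith [ρ.re_lt_one])
    linarith [ρ.lt_im_sq]
  set a := ρ.1.re * (1 - ρ.1.re) + ρ.1.im ^ 2
  have h2 : ‖(ρ : ℂ) * (1 - ρ)‖ ≤ 1.012 * a :=
    le_of_sq_le_sq (by nlinarith) (by positivity)
  rw [mul_div_assoc', div_le_div_iff₀ h0 (by positivity)]
  nlinarith

theorem summable_mult_div_norm :
    Summable fun ρ : XiZero => ρ.mult * (1 / ‖(ρ : ℂ) * (1 - ρ)‖) := by
  refine Summable.of_nonneg_of_le (fun ρ => mul_nonneg ρ.mult_nonneg (by positivity)) (fun ρ => ?_)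
    (hasSum_re_inv_mul_one_sub.summable.mul_left 1.012)
  have := mul_le_mul_of_nonneg_left ρ.inv_norm_le ρ.mult_nonneg
  linarith

theorem tsum_mult_div_norm_lt : ∑' ρ : XiZero, ρ.mult * (1 / ‖(ρ : ℂ) * (1 - ρ)‖) < 0.0468 := by
  have h : ∑' ρ : XiZero, ρ.mult * (1 / ‖(ρ : ℂ) * (1 - ρ)‖) ≤ 1.012 * (2 * xiConst) := by
    refine hasSum_le (fun ρ => ?_) summable_mult_div_norm.hasSum
      (hasSum_re_inv_mul_one_sub.mul_left 1.012)
    have := mul_le_mul_of_nonneg_left ρ.inv_norm_le ρ.mult_nonneg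
    linarith
  linarith [two_mul_xiConst_lt]

theorem abs_im_le_norm_one_sub (ρ : XiZero) : |ρ.1.im| ≤ ‖1 - (ρ : ℂ)‖ := by
  have := abs_im_le_norm (1 - (ρ : ℂ))
  simpa using this

theorem norm_one_sub_lt (ρ : XiZero) : ‖(ρ : ℂ)‖ ≤ 2 * ‖1 - (ρ : ℂ)‖ := by
  have h1 := ρ.abs_im_le_norm_one_sub
  have h2 := ρ.lt_abs_im
  have h3 : ‖(ρ : ℂ)‖ ≤ 1 + ‖1 - (ρ : ℂ)‖ := by
    have := norm_sub_le (1 : ℂ) (1 - ρ)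
    simpa using this
  linarith

theorem re_sub_one_lt_norm (ρ : XiZero) (z : ℂ) : z.re < ‖1 + z - ρ‖ := by
  have h := re_le_norm (1 + z - ρ)
  have := ρ.re_lt_one
  simp at h
  linarith

theorem norm_term_le (ρ : XiZero) {z : ℂ} (hz : 0 < z.re) :
    ‖(ρ.mult : ℂ) * (1 / ((1 - ρ) * (1 + z - ρ)))‖ ≤
      ρ.mult * (1 / ‖(ρ : ℂ) * (1 - ρ)‖) * (2 * (1 + ‖z‖ / z.re)) := by
  have h1 := ρ.re_sub_one_lt_norm z
  have h0 : 0 < ‖1 + z - ρ‖ := hz.trans h1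
  have h2 : ‖1 - (ρ : ℂ)‖ ≤ ‖1 + z - ρ‖ + ‖z‖ := by
    have := norm_sub_le (1 + z - (ρ : ℂ)) z
    rwa [show 1 + z - (ρ : ℂ) - z = 1 - ρ by ring] at this
  have h3 : ‖z‖ ≤ ‖1 + z - ρ‖ * (‖z‖ / z.re) := by
    rw [mul_div_assoc', le_div_iff₀ hz]
    nlinarith [norm_nonneg z]
  have h4 := ρ.norm_one_sub_lt
  have h5 : 0 < ‖(ρ : ℂ)‖ := norm_pos_iff.2 ρ.ne_zero
  have h6 : 0 < ‖1 - (ρ : ℂ)‖ := norm_pos_iff.2 ρ.one_sub_ne_zero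
  have h7 : ‖(ρ : ℂ)‖ ≤ ‖1 + z - ρ‖ * (2 * (1 + ‖z‖ / z.re)) := by nlinarith
  rw [norm_mul, norm_real, Real.norm_of_nonneg ρ.mult_nonneg, mul_assoc]
  refine mul_le_mul_of_nonneg_left ?_ ρ.mult_nonneg
  rw [norm_div, norm_one, norm_mul, norm_mul, one_div_mul_eq_div, div_le_div_iff₀ (by positivity) (by positivity)]
  nlinarith

theorem summable_term {z : ℂ} (hz : 0 < z.re) :
    Summable fun ρ : XiZero => (ρ.mult : ℂ) * (1 / ((1 - ρ) * (1 + z - ρ))) :=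
  Summable.of_norm_bounded (summable_mult_div_norm.mul_right _) fun ρ => ρ.norm_term_le hz

theorem tsum_term {z : ℂ} (hz : 0 < z.re) :
    z * ∑' ρ : XiZero, (ρ.mult : ℂ) * (1 / ((1 - ρ) * (1 + z - ρ))) =
      xiConst - logDeriv xiFun (1 + z) := by
  have h1 := tendsto_sum_logDeriv (s := 1) (by simp [xiFun_one])
  have h2 := tendsto_sum_logDeriv (s := 1 + z)
    (xiFun_ne_zero_of_one_le_re (by simp; exact hz.le))
  have h3 := h1.sub h2
  have h4 := ((summable_term hz).hasSum.comp tendsto_upTo).const_mul z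
  rw [logDeriv_xiFun_one, sub_sub_sub_cancel_right] at h3
  refine tendsto_nhds_unique h4 (h3.congr fun n => ?_)
  simp only [Function.comp_apply]
  rw [← Finset.sum_sub_distrib, Finset.mul_sum]
  refine Finset.sum_congr rfl fun ρ _ => ?_
  have e1 := ρ.one_sub_ne_zero
  have e2 : 1 + z - (ρ : ℂ) ≠ 0 := norm_pos_iff.1 (hz.trans (ρ.re_sub_one_lt_norm z))
  field_simp
  ring

theorem hasSum_re_inv : HasSum (fun ρ : XiZero => ρ.mult * (1 / (ρ : ℂ)).re) xiConst := by
  have hs : Summable fun ρ : XiZero => ρ.mult * (1 / (ρ : ℂ)).re := by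
    refine Summable.of_nonneg_of_le (fun ρ => mul_nonneg ρ.mult_nonneg ρ.re_inv_pos.le)
      (fun ρ => mul_le_mul_of_nonneg_left ?_ ρ.mult_nonneg) hasSum_re_inv_mul_one_sub.summable
    have := (reflect ρ).re_inv_pos
    rw [reflect_coe] at this
    rw [inv_mul_one_sub, add_re]
    linarith
  have h1 : HasSum (fun ρ : XiZero => ρ.mult * (1 / (1 - (ρ : ℂ))).re)
      (∑' ρ : XiZero, ρ.mult * (1 / (ρ : ℂ)).re) := by
    have := (Equiv.hasSum_iff reflect).2 hs.hasSum
    refine this.congr_fun ?_ |> id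
    intro ρ
    simp
  have h2 := hs.hasSum.add h1
  have h3 := hasSum_re_inv_mul_one_sub.unique (h2.congr_fun fun ρ => by
    rw [inv_mul_one_sub, add_re]; ring)
  have : ∑' ρ : XiZero, ρ.mult * (1 / (ρ : ℂ)).re = xiConst := by linarith
  rw [← this]
  exact hs.hasSum

theorem re_inv_sub_nonneg (ρ : XiZero) {s : ℂ} (hs : 1 ≤ s.re) : 0 ≤ (1 / (s - ρ)).re := by
  rw [one_div, inv_re]
  refine div_nonneg ?_ (normSq_nonneg _)
  have := ρ.re_lt_one
  rw [sub_re]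
  linarith

theorem sum_re_inv_sub_le {s : ℂ} (hs : 1 ≤ s.re) (T : Finset XiZero) :
    ∑ ρ ∈ T, (1 / (s - ρ)).re ≤ (logDeriv xiFun s).re := by
  have h1 := (continuous_re.tendsto _).comp (tendsto_sum_logDeriv (xiFun_ne_zero_of_one_le_re hs))
  have h2 := hasSum_re_inv.comp tendsto_upTo
  have h3 := h1.sub h2
  rw [logDeriv_xiFun_zero', sub_neg_eq_add, add_re, ofReal_re, add_sub_cancel_right] at h3
  refine ge_of_tendsto h3 ?_
  filter_upwards [tendsto_upTo.eventually (eventually_ge_atTop T)] with n hn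
  simp only [Function.comp_apply]
  rw [re_sum, ← Finset.sum_sub_distrib]
  calc _ ≤ ∑ ρ ∈ T, ρ.mult * (1 / (s - ρ)).re := Finset.sum_le_sum fun ρ _ =>
        le_mul_of_one_le_left (ρ.re_inv_sub_nonneg hs) ρ.one_le_mult
    _ ≤ ∑ ρ ∈ upTo n, ρ.mult * (1 / (s - ρ)).re :=
        Finset.sum_le_sum_of_subset_of_nonneg hn fun ρ _ _ =>
          mul_nonneg ρ.mult_nonneg (ρ.re_inv_sub_nonneg hs)
    _ = _ := Finset.sum_congr rfl fun ρ _ => by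
        rw [re_ofReal_mul, add_re]; ring

end XiZero

theorem ne_neg_nat_of_re_pos {s : ℂ} (hs : 0 < s.re) (m : ℕ) : s ≠ -m := by
  rintro rfl
  simp at hs
  linarith [Nat.cast_nonneg (α := ℝ) m]

theorem digamma_add_nat {s : ℂ} (hs : 0 < s.re) (n : ℕ) :
    digamma (s + n) = digamma s + ∑ k ∈ Finset.range n, 1 / ((k : ℂ) + s) := by
  induction n with
  | zero => simp
  | succ n ih =>
    have h : 0 < (s + n).re := by
      simp; positivity
    rw [Finset.sum_range_succ, Nat.cast_succ, ← add_assoc,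
      digamma_apply_add_one _ (ne_neg_nat_of_re_pos h), ih, add_comm (n : ℂ) s]
    simp [add_assoc]

theorem hasDerivAt_log_Gamma {x : ℝ} (hx : 0 < x) :
    HasDerivAt (fun x => Real.log (Real.Gamma x)) (digamma x).re x ∧ (digamma x).im = 0 := by
  have h0 := ne_neg_nat_of_re_pos (s := x) (by simpa using hx)
  have hd : DifferentiableAt ℝ Real.Gamma x :=
    Real.differentiableAt_Gamma fun m => by have := h0 m; exact_mod_cast this
  have h1 := (differentiableAt_Gamma x h0).hasDerivAt.comp_ofReal
  have h2 := hd.hasDerivAt.ofReal_comp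
  have e : (fun y : ℝ => Gamma (y : ℂ)) = fun y : ℝ => ((Real.Gamma y : ℝ) : ℂ) := by
    ext y; exact Gamma_ofReal y
  rw [e] at h1
  have h3 := h1.unique h2
  have h4 : digamma x = ((deriv Real.Gamma x / Real.Gamma x : ℝ) : ℂ) := by
    rw [digamma_def, logDeriv_apply, h3, Gamma_ofReal]
    push_cast
    rfl
  rw [h4, ofReal_re, ofReal_im]
  exact ⟨hd.hasDerivAt.log (Real.Gamma_pos_of_pos hx).ne', rfl⟩

theorem monotoneOn_re_digamma : MonotoneOn (fun x : ℝ => (digamma x).re) (Set.Ioi 0) := by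
  have h := Real.convexOn_log_Gamma.monotoneOn_deriv fun x hx =>
    (hasDerivAt_log_Gamma hx).1.differentiableAt
  intro x hx y hy hxy
  have h2 := h hx hy hxy
  change deriv (fun x => Real.log (Real.Gamma x)) x ≤
    deriv (fun x => Real.log (Real.Gamma x)) y at h2
  rwa [(hasDerivAt_log_Gamma hx).1.deriv, (hasDerivAt_log_Gamma hy).1.deriv] at h2

theorem tendsto_re_digamma_sub {x y : ℝ} (hx : 0 < x) (hxy : x ≤ y) :
    Tendsto (fun n : ℕ => (digamma (y + n)).re - (digamma (x + n)).re) atTop (𝓝 0) := by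
  obtain ⟨M, hM⟩ := exists_nat_ge (y - x)
  have hcast : ∀ (a : ℝ) (n : ℕ), digamma ((a : ℂ) + n) = digamma ((a + n : ℝ) : ℂ) := by
    intro a n; push_cast; rfl
  have hlim : Tendsto (fun n : ℕ => ∑ k ∈ Finset.range M, 1 / ((k : ℝ) + (x + n))) atTop (𝓝 0) := by
    rw [← Finset.sum_const_zero (s := Finset.range M)]
    refine tendsto_finsetSum _ fun k _ => ?_
    refine Tendsto.const_div_atTop ?_ _
    exact tendsto_atTop_add_const_left _ _
      (tendsto_atTop_add_const_left _ _ tendsto_natCast_atTop_atTop)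
  refine squeeze_zero (fun n => ?_) (fun n => ?_) hlim
  · rw [hcast, hcast, sub_nonneg]
    exact monotoneOn_re_digamma (by simp; positivity)
      (Set.mem_Ioi.2 (by have := hx.trans_le hxy; positivity)) (by linarith)
  · have h1 := digamma_add_nat (s := ((x + n : ℝ) : ℂ)) (by simp; positivity) M
    have h2 : (digamma (((x + n : ℝ) : ℂ) + M)).re =
        (digamma ((x + n : ℝ) : ℂ)).re + ∑ k ∈ Finset.range M, 1 / ((k : ℝ) + (x + n)) := by
      rw [h1, add_re, re_sum]
      congr 1
      refine Finset.sum_congr rfl fun k _ => ?_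
      rw [← ofReal_natCast, ← ofReal_add, ← ofReal_one, ← ofReal_div, ofReal_re]
    rw [hcast, hcast, tsub_le_iff_left, ← h2, hcast]
    exact monotoneOn_re_digamma (Set.mem_Ioi.2 (by have := hx.trans_le hxy; positivity))
      (Set.mem_Ioi.2 (by positivity)) (by linarith)

theorem norm_digamma_term_le {s : ℂ} {a : ℝ} (ha : 0 < a) (hs : a ≤ s.re) (k : ℕ) :
    ‖1 / (((k : ℂ) + 1 / 2) * (k + s))‖ ≤ (1 / ((k : ℝ) + 1 / 2) * (1 / (k + a))) := by
  have h1 : (k : ℝ) + a ≤ ‖(k : ℂ) + s‖ := by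
    have := re_le_norm ((k : ℂ) + s)
    simp at this
    linarith
  have h2 : ‖(k : ℂ) + 1 / 2‖ = k + 1 / 2 := by
    have : ((k : ℂ) + 1 / 2) = ((k + 1 / 2 : ℝ) : ℂ) := by push_cast; rfl
    rw [this, norm_real, Real.norm_of_nonneg (by positivity)]
  rw [norm_div, norm_one, norm_mul, h2, one_div_mul_one_div]
  gcongr

theorem summable_inv_mul_inv {a b : ℝ} (ha : 0 < a) (hb : 0 < b) :
    Summable fun k : ℕ => 1 / ((k : ℝ) + a) * (1 / (k + b)) := by
  have h : ∀ c : ℝ, 0 < c → Summable fun k : ℕ => (1 / ((k : ℝ) + c)) ^ 2 := fun c hc => by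
    have := (Real.summable_one_div_nat_add_rpow c 2).2 (by norm_num)
    refine this.congr fun k => ?_
    rw [abs_of_pos (by positivity), Real.rpow_two, one_div_pow]
  refine Summable.of_nonneg_of_le (fun k => by positivity) (fun k => ?_)
    (((h a ha).add (h b hb)))
  have := two_mul_le_add_sq (1 / ((k : ℝ) + a)) (1 / (k + b))
  have h2 : 0 ≤ 1 / ((k : ℝ) + a) * (1 / (k + b)) := by positivity
  linarith

theorem digamma_sub_digamma_one_half_real {x : ℝ} (hx : 1 / 2 ≤ x) :
    digamma x - digamma (1 / 2) = (x - 1 / 2) * ∑' k : ℕ, 1 / (((k : ℂ) + 1 / 2) * (k + x)) := by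
  have hs : Summable fun k : ℕ => 1 / (((k : ℂ) + 1 / 2) * (k + x)) :=
    Summable.of_norm_bounded (summable_inv_mul_inv (by norm_num) (show (0 : ℝ) < x by linarith))
      fun k => norm_digamma_term_le (show (0 : ℝ) < x by linarith) (by simp) k
  have h1 := (hs.hasSum.tendsto_sum_nat).const_mul ((x : ℂ) - 1 / 2)
  have h2 := tendsto_re_digamma_sub (x := 1 / 2) (by norm_num) hx
  have h3 := (continuous_ofReal.tendsto _).comp h2
  have h4 : ∀ a : ℝ, 0 < a → ∀ n : ℕ, (((digamma ((a : ℂ) + n)).re : ℝ) : ℂ) =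
      digamma a + ∑ k ∈ Finset.range n, 1 / ((k : ℂ) + a) := by
    intro a ha n
    rw [← digamma_add_nat (by simpa using ha)]
    have : (0 : ℝ) < a + n := by positivity
    have h5 := (hasDerivAt_log_Gamma this).2
    push_cast at h5
    exact Complex.ext (by simp) (by simp [h5])
  have h6 := h3.add h1
  have h7 : Tendsto (fun n : ℕ => digamma x - digamma ((1 / 2 : ℝ) : ℂ)) atTop
      (𝓝 (((0 : ℝ) : ℂ) + ((x : ℂ) - 1 / 2) * ∑' k : ℕ, 1 / (((k : ℂ) + 1 / 2) * (k + x)))) := by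
    refine h6.congr fun n => ?_
    simp only [Function.comp_apply]
    rw [ofReal_sub, h4 x (by linarith), h4 _ (by norm_num), add_sub_add_comm,
      ← Finset.sum_sub_distrib, Finset.mul_sum, add_assoc, ← Finset.sum_add_distrib,
      Finset.sum_eq_zero, add_zero]
    intro k _
    have e1 : (k : ℂ) + x ≠ 0 := by
      have : (k : ℝ) + x ≠ 0 := by positivity
      exact_mod_cast this
    have e2 : (k : ℂ) + 1 / 2 ≠ 0 := by
      intro h
      have := congrArg re h
      simp at this
      linarith [Nat.cast_nonneg (α := ℝ) k]
    have e3 : (k : ℂ) * 2 + 1 ≠ 0 := by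
      intro h
      exact e2 (by linear_combination h / 2)
    push_cast
    field_simp
    ring
  have h8 := tendsto_nhds_unique tendsto_const_nhds h7
  rw [ofReal_zero, zero_add] at h8
  rw [← h8]
  norm_num

theorem digamma_sub_digamma_one_half {s : ℂ} (hs : 0 < s.re) :
    digamma s - digamma (1 / 2) = (s - 1 / 2) * ∑' k : ℕ, 1 / (((k : ℂ) + 1 / 2) * (k + s)) := by
  have hU : IsOpen {s : ℂ | 0 < s.re} := isOpen_lt continuous_const continuous_re
  have hpre : IsPreconnected {s : ℂ | 0 < s.re} := (convex_halfSpace_re_gt 0).isPreconnected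
  have hdig : DifferentiableOn ℂ (fun s => digamma s - digamma (1 / 2)) {s : ℂ | 0 < s.re} := by
    refine DifferentiableOn.sub_const ?_ _
    have hG : DifferentiableOn ℂ Gamma {s : ℂ | 0 < s.re} := fun s hs =>
      (differentiableAt_Gamma s (ne_neg_nat_of_re_pos hs)).differentiableWithinAt
    exact (hG.deriv hU).div hG fun s hs => Gamma_ne_zero_of_re_pos hs
  have hser : DifferentiableOn ℂ (fun s => (s - 1 / 2) * ∑' k : ℕ, 1 / (((k : ℂ) + 1 / 2) * (k + s)))
      {s : ℂ | 0 < s.re} := by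
    refine DifferentiableOn.mul (by fun_prop) fun s hs => ?_
    have hs' : 0 < s.re := hs
    have hV : IsOpen {w : ℂ | s.re / 2 < w.re} := isOpen_lt continuous_const continuous_re
    refine DifferentiableAt.differentiableWithinAt ?_
    refine DifferentiableOn.differentiableAt (s := {w : ℂ | s.re / 2 < w.re}) ?_
      (hV.mem_nhds (by simp; linarith))
    refine differentiableOn_tsum_of_summable_norm
      (summable_inv_mul_inv (by norm_num : (0 : ℝ) < 1 / 2) (half_pos hs')) (fun k => ?_) hV
      (fun k w hw => norm_digamma_term_le (half_pos hs') hw.le k)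
    intro w hw
    have hw' : s.re / 2 < w.re := hw
    have e1 : (k : ℂ) + w ≠ 0 := by
      intro h
      have := congrArg re h
      simp at this
      linarith [Nat.cast_nonneg (α := ℝ) k]
    have e2 : (k : ℂ) + 1 / 2 ≠ 0 := by
      intro h
      have := congrArg re h
      simp at this
      linarith [Nat.cast_nonneg (α := ℝ) k]
    refine DifferentiableAt.differentiableWithinAt ?_
    have e3 := mul_ne_zero e2 e1
    fun_prop (disch := assumption)
  refine AnalyticOnNhd.eqOn_of_preconnected_of_frequently_eq (hdig.analyticOnNhd hU)
    (hser.analyticOnNhd hU) hpre (z₀ := 1) (by simp) ?_ hs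
  have hseq : Tendsto (fun n : ℕ => ((1 + 1 / ((n : ℝ) + 1) : ℝ) : ℂ)) atTop (𝓝[≠] 1) := by
    refine tendsto_nhdsWithin_iff.2 ⟨?_, Eventually.of_forall fun n => ?_⟩
    · have := (tendsto_one_div_add_atTop_nhds_zero_nat (𝕜 := ℝ)).const_add 1
      have := (continuous_ofReal.tendsto _).comp this
      simpa [Function.comp_def] using this
    · have : (1 + 1 / ((n : ℝ) + 1) : ℝ) ≠ 1 := by
        have : 0 < 1 / ((n : ℝ) + 1) := by positivity
        linarith
      rw [Set.mem_compl_singleton_iff]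
      exact_mod_cast this
  refine hseq.frequently (Frequently.of_forall fun n => ?_)
  refine digamma_sub_digamma_one_half_real ?_
  have : 0 < 1 / ((n : ℝ) + 1) := by positivity
  linarith

theorem logDeriv_Gammaℝ {s : ℂ} (hs : 0 < s.re) :
    logDeriv Gammaℝ s = -Real.log Real.pi / 2 + digamma (s / 2) / 2 := by
  have hs2 : 0 < (s / 2).re := by simpa using hs
  have hG := differentiableAt_Gamma (s / 2) (ne_neg_nat_of_re_pos hs2)
  have h1 : HasDerivAt (fun s : ℂ => Gamma (s / 2)) (deriv Gamma (s / 2) * (1 / 2)) s :=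
    hG.hasDerivAt.comp s ((hasDerivAt_id s).div_const 2)
  have hpi : (Real.pi : ℂ) ≠ 0 := by exact_mod_cast Real.pi_ne_zero
  have h2 : HasDerivAt (fun s : ℂ => (Real.pi : ℂ) ^ (-s / 2))
      ((Real.pi : ℂ) ^ (-s / 2) * Complex.log Real.pi * (-1 / 2)) s :=
    (((hasDerivAt_id s).neg).div_const 2).const_cpow (Or.inl hpi)
  have h3 : HasDerivAt Gammaℝ _ s := h2.mul h1
  have e1 : (Real.pi : ℂ) ^ (-s / 2) ≠ 0 := by
    rw [Ne, cpow_eq_zero_iff]; tauto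
  have e2 : Gamma (s / 2) ≠ 0 := Gamma_ne_zero_of_re_pos hs2
  rw [logDeriv_apply, h3.deriv, Gammaℝ_def, digamma_def, logDeriv_apply,
    ← ofReal_log Real.pi_pos.le]
  field_simp
  try ring

theorem neg_logDeriv_riemannZeta {s : ℂ} (hs : 1 < s.re) :
    -logDeriv riemannZeta s = 1 / (s - 1) + 1 / s - Real.log Real.pi / 2 + digamma (s / 2) / 2
      - logDeriv xiFun s := by
  have hs0 : s ≠ 0 := by rintro rfl; simp at hs; linarith
  have hs1 : s ≠ 1 := by rintro rfl; simp at hs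
  have hs1' := sub_ne_zero.2 hs1
  have hspos : 0 < s.re := by linarith
  have hev : xiFun =ᶠ[𝓝 s] fun s => s * (s - 1) * (Gammaℝ s * riemannZeta s) := by
    filter_upwards [(isOpen_lt continuous_const continuous_re).mem_nhds hs] with w hw
    have hw' : 1 < w.re := hw
    exact xiFun_eq_zeta (by linarith) (by rintro rfl; simp at hw')
  have hz := riemannZeta_ne_zero_of_one_lt_re hs
  have hG := Gammaℝ_ne_zero_of_re_pos hspos
  have hdz := differentiableAt_riemannZeta hs1
  have hdG : DifferentiableAt ℂ Gammaℝ s := by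
    have hG2 := differentiableAt_Gamma (s / 2) (ne_neg_nat_of_re_pos (by simpa using hspos))
    have h1 : DifferentiableAt ℂ (fun s : ℂ => Gamma (s / 2)) s :=
      DifferentiableAt.comp s hG2 (by fun_prop)
    have h2 : DifferentiableAt ℂ (fun s : ℂ => (Real.pi : ℂ) ^ (-s / 2)) s := by
      refine DifferentiableAt.const_cpow (by fun_prop) (Or.inl ?_)
      exact_mod_cast Real.pi_ne_zero
    exact h2.mul h1
  have e : logDeriv xiFun s = 1 / s + 1 / (s - 1) + (logDeriv Gammaℝ s + logDeriv riemannZeta s) := by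
    rw [(show logDeriv xiFun s = logDeriv (fun s => s * (s - 1) * (Gammaℝ s * riemannZeta s)) s by
      rw [logDeriv_apply, logDeriv_apply, hev.deriv_eq, hev.eq_of_nhds])]
    rw [logDeriv_mul (f := fun s => s * (s - 1)) (g := fun s => Gammaℝ s * riemannZeta s) s
        (mul_ne_zero hs0 hs1') (mul_ne_zero hG hz) (by fun_prop) (hdG.mul hdz),
      logDeriv_mul (f := Gammaℝ) (g := riemannZeta) s hG hz hdG hdz,
      logDeriv_mul (f := fun s => s) (g := fun s => s - 1) s hs0 hs1' (by fun_prop) (by fun_prop)]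
    congr 2
    · rw [logDeriv_apply]; simp
    · rw [logDeriv_apply]; simp
  rw [e, logDeriv_Gammaℝ hspos]
  ring

theorem norm_odd_term_le {z : ℂ} (hz : 0 < z.re) (k : ℕ) :
    ‖1 / ((2 * (k : ℂ) + 1) * (2 * k + 1 + z))‖ ≤ 1 / (2 * (k : ℝ) + 1) ^ 2 := by
  have h2 : ‖2 * (k : ℂ) + 1‖ = 2 * k + 1 := by
    have : (2 * (k : ℂ) + 1) = ((2 * k + 1 : ℝ) : ℂ) := by push_cast; rfl
    rw [this, norm_real, Real.norm_of_nonneg (by positivity)]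
  have h1 : 2 * (k : ℝ) + 1 ≤ ‖2 * (k : ℂ) + 1 + z‖ := by
    have := re_le_norm (2 * (k : ℂ) + 1 + z)
    simp at this
    linarith
  rw [norm_div, norm_one, norm_mul, h2, sq]
  gcongr

theorem summable_inv_odd_sq : Summable fun k : ℕ => 1 / (2 * (k : ℝ) + 1) ^ 2 := by
  have := (summable_inv_mul_inv (a := 1 / 2) (b := 1 / 2) (by norm_num) (by norm_num)).mul_left
    (1 / 4)
  refine this.congr fun k => ?_
  have : (k : ℝ) + 1 / 2 ≠ 0 := by positivity
  field_simp
  ring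

theorem neg_logDeriv_riemannZeta_one_add {z : ℂ} (hz : 0 < z.re) :
    -logDeriv riemannZeta (1 + z) = 1 / z + 1 / (1 + z) - (1 + Real.eulerMascheroniConstant) +
      z * ((∑' k : ℕ, 1 / ((2 * (k : ℂ) + 1) * (2 * k + 1 + z))) +
        ∑' ρ : XiZero, (ρ.mult : ℂ) * (1 / ((1 - ρ) * (1 + z - ρ)))) := by
  rw [neg_logDeriv_riemannZeta (by simpa using hz), mul_add z, XiZero.tsum_term hz]
  have h1 := digamma_sub_digamma_one_half (s := (1 + z) / 2) (by simp; linarith)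
  have h2 : ∑' k : ℕ, 1 / (((k : ℂ) + 1 / 2) * (k + (1 + z) / 2)) =
      4 * ∑' k : ℕ, 1 / ((2 * (k : ℂ) + 1) * (2 * k + 1 + z)) := by
    rw [← tsum_mul_left]
    refine tsum_congr fun k => ?_
    rw [show ((k : ℂ) + 1 / 2) * (k + (1 + z) / 2) =
      ((2 * (k : ℂ) + 1) * (2 * k + 1 + z)) / 4 by ring, one_div_div]
    ring
  rw [h2] at h1
  have h3 : digamma ((1 + z) / 2) = digamma (1 / 2) + z * 2 *
      ∑' k : ℕ, 1 / ((2 * (k : ℂ) + 1) * (2 * k + 1 + z)) := by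
    linear_combination h1
  rw [h3, digamma_one_half, xiConst, add_sub_cancel_left]
  have h4 : Real.log (4 * Real.pi) = 2 * Real.log 2 + Real.log Real.pi := by
    rw [Real.log_mul (by norm_num) Real.pi_ne_zero, show (4 : ℝ) = 2 ^ 2 by norm_num,
      Real.log_pow]
    push_cast; ring
  rw [h4]
  have h5 : Complex.log 2 = (Real.log 2 : ℝ) := by
    rw [ofReal_log (by norm_num)]; norm_num
  rw [h5]
  push_cast
  ring

end

section

open Complex Filter Topology Metric
open MeasureTheory Set
open ArithmeticFunction (vonMangoldt)

open MeasureTheory Set in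
/-- `f` has an absolutely convergent Laplace transform at `z`, with value `L`. -/
structure HasLaplace (f : ℝ → ℂ) (z L : ℂ) : Prop where
  integrableOn : IntegrableOn (fun u : ℝ => cexp (-z * u) * f u) (Ioi 0)
  integral_eq : ∫ u in Ioi (0 : ℝ), cexp (-z * u) * f u = L

namespace HasLaplace

theorem congr_fun {f g : ℝ → ℂ} {z L : ℂ} (h : HasLaplace f z L) (hfg : ∀ u, 0 < u → g u = f u) :
    HasLaplace g z L := by
  refine ⟨h.integrableOn.congr_fun (fun u hu => ?_) measurableSet_Ioi, ?_⟩
  · simp only [hfg u hu]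
  · rw [← h.integral_eq]
    refine setIntegral_congr_fun measurableSet_Ioi fun u hu => ?_
    simp only [hfg u hu]

theorem add {f g : ℝ → ℂ} {z L M : ℂ} (hf : HasLaplace f z L) (hg : HasLaplace g z M) :
    HasLaplace (fun u => f u + g u) z (L + M) := by
  have e : (fun u : ℝ => cexp (-z * u) * (f u + g u)) =
      fun u : ℝ => cexp (-z * u) * f u + cexp (-z * u) * g u := by
    ext u; ring
  refine ⟨?_, ?_⟩
  · rw [e]; exact hf.integrableOn.add hg.integrableOn
  · rw [e, integral_add hf.integrableOn hg.integrableOn, hf.integral_eq, hg.integral_eq]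

theorem const_mul {f : ℝ → ℂ} {z L : ℂ} (c : ℂ) (hf : HasLaplace f z L) :
    HasLaplace (fun u => c * f u) z (c * L) := by
  have e : (fun u : ℝ => cexp (-z * u) * (c * f u)) = fun u : ℝ => c * (cexp (-z * u) * f u) := by
    ext u; ring
  refine ⟨?_, ?_⟩
  · rw [e]; exact hf.integrableOn.const_mul c
  · rw [e, integral_const_mul, hf.integral_eq]

theorem sub {f g : ℝ → ℂ} {z L M : ℂ} (hf : HasLaplace f z L) (hg : HasLaplace g z M) :
    HasLaplace (fun u => f u - g u) z (L - M) := by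
  have h := hf.add (hg.const_mul (-1))
  rw [neg_one_mul, ← sub_eq_add_neg] at h
  exact h.congr_fun fun u _ => by ring

theorem exp_mul {a z : ℂ} (h : 0 < (z + a).re) :
    HasLaplace (fun u => cexp (-a * u)) z (1 / (z + a)) := by
  have h' : (-(z + a)).re < 0 := by rw [neg_re]; linarith
  have e : (fun u : ℝ => cexp (-z * u) * cexp (-a * u)) = fun u : ℝ => cexp (-(z + a) * u) := by
    ext u; rw [← Complex.exp_add]; ring_nf
  refine ⟨?_, ?_⟩
  · rw [e]; exact integrableOn_exp_mul_complex_Ioi h' 0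
  · rw [e, integral_exp_mul_complex_Ioi h' 0]
    rw [ofReal_zero, mul_zero, Complex.exp_zero, neg_div_neg_eq]

theorem one {z : ℂ} (h : 0 < z.re) : HasLaplace (fun _ => 1) z (1 / z) := by
  have := exp_mul (a := 0) (z := z) (by simpa using h)
  simpa using this

theorem integrableOn_of_bound {f : ℝ → ℂ} {z : ℂ} (hz : z.re = 2) (hf : ContinuousOn f (Ioi 0))
    {C : ℝ} (hC : ∀ u, 0 < u → ‖f u‖ ≤ C * Real.exp u) :
    IntegrableOn (fun u : ℝ => cexp (-z * u) * f u) (Ioi 0) := by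
  have h1 : IntegrableOn (fun u : ℝ => C * Real.exp (-u)) (Ioi 0) :=
    (integrableOn_exp_neg_Ioi 0).const_mul C
  refine Integrable.mono' h1 ?_ ?_
  · refine ContinuousOn.aestronglyMeasurable ?_ measurableSet_Ioi
    exact ContinuousOn.mul (by fun_prop) hf
  · refine (ae_restrict_mem measurableSet_Ioi).mono fun u hu => ?_
    rw [norm_mul, Complex.norm_exp]
    have h2 : (-z * (u : ℂ)).re = -(2 * u) := by simp [hz]
    rw [h2]
    calc Real.exp (-(2 * u)) * ‖f u‖ ≤ Real.exp (-(2 * u)) * (C * Real.exp u) :=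
          mul_le_mul_of_nonneg_left (hC u hu) (Real.exp_pos _).le
      _ = C * (Real.exp (-(2 * u)) * Real.exp u) := by ring
      _ = C * Real.exp (-u) := by rw [← Real.exp_add]; ring_nf

theorem id {z : ℂ} (hz : z.re = 2) : HasLaplace (fun u => (u : ℂ)) z (1 / z ^ 2) := by
  have hint := integrableOn_of_bound (f := fun u => (u : ℂ)) hz (by fun_prop) (C := 1)
    (fun u hu => by
      rw [norm_real, Real.norm_of_nonneg hu.le, one_mul]
      linarith [Real.add_one_le_exp u])
  refine ⟨hint, ?_⟩
  have hz0 : z ≠ 0 := by rintro rfl; simp at hz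
  have h1 : ∀ u ∈ Ici (0 : ℝ), HasDerivAt (fun u : ℝ => -((u : ℂ) / z + 1 / z ^ 2) * cexp (-z * u))
      (cexp (-z * u) * u) u := by
    intro u _
    have ha : HasDerivAt (fun u : ℝ => (u : ℂ)) 1 u := Complex.ofRealCLM.hasDerivAt
    have hb := ((ha.div_const z).add_const (1 / z ^ 2)).neg
    have hc := (ha.const_mul (-z)).cexp
    refine (hb.mul hc).congr_deriv ?_
    simp only [mul_one, Pi.neg_apply]
    field_simp
    ring
  have hlim : Tendsto (fun u : ℝ => -((u : ℂ) / z + 1 / z ^ 2) * cexp (-z * u)) atTop (𝓝 0) := by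
    rw [tendsto_zero_iff_norm_tendsto_zero]
    have t1 := Real.tendsto_pow_mul_exp_neg_atTop_nhds_zero 1
    have t2 := Real.tendsto_pow_mul_exp_neg_atTop_nhds_zero 0
    have t3 := (t1.mul_const (1 / ‖z‖)).add (t2.mul_const (1 / ‖z‖ ^ 2))
    simp only [zero_mul, add_zero] at t3
    refine squeeze_zero' (Eventually.of_forall fun u => norm_nonneg _) ?_ t3
    filter_upwards [eventually_ge_atTop (0 : ℝ)] with u hu
    rw [norm_mul, norm_neg, Complex.norm_exp]
    have h2 : (-z * (u : ℂ)).re = -(2 * u) := by simp [hz]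
    rw [h2]
    have h3 : Real.exp (-(2 * u)) ≤ Real.exp (-u) := Real.exp_le_exp.2 (by linarith)
    have h4 : ‖(u : ℂ) / z + 1 / z ^ 2‖ ≤ u / ‖z‖ + 1 / ‖z‖ ^ 2 := by
      refine (norm_add_le _ _).trans ?_
      rw [norm_div, norm_div, norm_real, Real.norm_of_nonneg hu, norm_one, norm_pow]
    calc _ ≤ (u / ‖z‖ + 1 / ‖z‖ ^ 2) * Real.exp (-u) := by gcongr
      _ = _ := by ring
  rw [integral_Ioi_of_hasDerivAt_of_tendsto' h1 hint hlim]
  simp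

theorem tsum {ι : Type*} [Countable ι] {f : ι → ℝ → ℂ} {z : ℂ} {L : ι → ℂ}
    (h : ∀ i, HasLaplace (f i) z (L i))
    (hs : Summable fun i => ∫ u in Ioi (0 : ℝ), ‖cexp (-z * u) * f i u‖)
    (hint : IntegrableOn (fun u : ℝ => cexp (-z * u) * ∑' i, f i u) (Ioi 0)) :
    HasLaplace (fun u => ∑' i, f i u) z (∑' i, L i) := by
  refine ⟨hint, ?_⟩
  have := integral_tsum_of_summable_integral_norm (fun i => (h i).integrableOn) hs
  simp only [tsum_mul_left] at this
  rw [← this]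
  exact tsum_congr fun i => (h i).integral_eq

theorem tsum_of_bound {ι : Type*} [Countable ι] {f : ι → ℝ → ℂ} {z : ℂ} {L : ι → ℂ} {b : ι → ℝ}
    (hz : z.re = 2) (h : ∀ i, HasLaplace (f i) z (L i)) (hb : Summable b)
    (hfb : ∀ i u, 0 < u → ‖f i u‖ ≤ b i) (hc : ∀ i, ContinuousOn (f i) (Ioi 0)) :
    HasLaplace (fun u => ∑' i, f i u) z (∑' i, L i) := by
  have hb0 : ∀ i, 0 ≤ b i := fun i => (norm_nonneg _).trans (hfb i 1 one_pos)
  refine tsum h ?_ ?_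
  · refine Summable.of_nonneg_of_le (fun i => integral_nonneg fun _ => norm_nonneg _) (fun i => ?_) hb
    have h1 : IntegrableOn (fun u : ℝ => b i * Real.exp (-u)) (Ioi 0) :=
      (integrableOn_exp_neg_Ioi 0).const_mul (b i)
    have h2 : ∫ u in Ioi (0 : ℝ), b i * Real.exp (-u) = b i := by
      rw [integral_const_mul, integral_exp_neg_Ioi_zero, mul_one]
    have h3 : b i = ∫ u in Ioi (0 : ℝ), b i * Real.exp (-u) := h2.symm
    rw [h3]
    refine setIntegral_mono_on (h i).integrableOn.norm h1 measurableSet_Ioi fun u hu => ?_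
    have hu' : 0 < u := hu
    rw [norm_mul, Complex.norm_exp]
    have h2 : (-z * (u : ℂ)).re = -(2 * u) := by simp [hz]
    rw [h2, mul_comm]
    have h3 : Real.exp (-(2 * u)) ≤ Real.exp (-u) := Real.exp_le_exp.2 (by linarith)
    exact mul_le_mul (hfb i u hu) h3 (Real.exp_pos _).le (hb0 i)
  · refine integrableOn_of_bound hz ?_ (C := ∑' i, b i) fun u hu => ?_
    · exact continuousOn_tsum hc hb fun i u hu => hfb i u hu
    · have h1 := tsum_of_norm_bounded hb.hasSum fun i => hfb i u hu
      have h2 : 1 ≤ Real.exp u := Real.one_le_exp hu.le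
      have h3 : 0 ≤ ∑' i, b i := tsum_nonneg hb0
      nlinarith

end HasLaplace

/-- A function vanishing at `0`, continuous on `[0, ∞)`, of at most exponential growth and with
vanishing Laplace transform on the line `re z = 2` is zero. -/
theorem eq_zero_of_hasLaplace_zero {f : ℝ → ℂ} (hf : ContinuousOn f (Ici 0)) (h0 : f 0 = 0)
    (hL : ∀ z : ℂ, z.re = 2 → HasLaplace f z 0) {u : ℝ} (hu : 0 ≤ u) : f u = 0 := by
  set g : ℝ → ℂ := fun u => cexp (-2 * u) * f (max u 0) with hg
  have hcont : Continuous g := by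
    have h1 : Continuous fun u : ℝ => f (max u 0) := by
      refine hf.comp_continuous (by fun_prop) fun x => ?_
      exact le_max_right x 0
    exact Continuous.mul (by fun_prop) h1
  have hsupp : Function.support g ⊆ Ioi 0 := by
    intro x hx
    by_contra hx0
    refine hx ?_
    simp only [hg]
    rw [max_eq_right (not_lt.1 hx0), h0, mul_zero]
  have hint : Integrable g := by
    rw [← integrableOn_iff_integrable_of_support_subset hsupp]
    refine (hL 2 (by simp)).integrableOn.congr_fun (fun x hx => ?_) measurableSet_Ioi
    simp only [hg]
    rw [max_eq_left (le_of_lt hx)]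
  have hF : FourierTransform.fourier g = 0 := by
    ext w
    rw [Real.fourier_real_eq_integral_exp_smul]
    rw [← setIntegral_eq_integral_of_forall_compl_eq_zero (s := Ioi 0)]
    · have h2 := (hL (2 + 2 * Real.pi * w * I) (by simp)).integral_eq
      rw [Pi.zero_apply, ← h2]
      refine setIntegral_congr_fun measurableSet_Ioi fun x hx => ?_
      simp only [hg]
      rw [max_eq_left (le_of_lt hx), smul_eq_mul, ← mul_assoc, ← Complex.exp_add]
      congr 2
      push_cast
      ring
    · intro x hx
      have : g x = 0 := by
        by_contra h
        exact hx (hsupp h)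
      rw [this, smul_zero]
  have hinv := hcont.fourierInv_fourier_eq hint (by rw [hF]; exact integrable_zero _ _ _)
  have hg0 : g u = 0 := by
    rw [← hinv, hF]
    simp [Real.fourierInv_eq]
  simp only [hg] at hg0
  rw [max_eq_left hu] at hg0
  exact (mul_eq_zero.1 hg0).resolve_left (Complex.exp_ne_zero _)

/-- The sum of `Λ(m) (1 / m - exp (-u))` over `m ≤ exp u`. -/
noncomputable def mangoldtSum (u : ℝ) : ℝ :=
  ∑ m ∈ Finset.Icc 1 ⌊Real.exp u⌋₊, vonMangoldt m * (1 / m - Real.exp (-u))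

theorem le_exp_iff_inv {m : ℕ} (hm : m ≠ 0) (u : ℝ) :
    (m : ℝ) ≤ Real.exp u ↔ 0 ≤ 1 / (m : ℝ) - Real.exp (-u) := by
  have : (0 : ℝ) < m := by positivity
  rw [sub_nonneg, Real.exp_neg, ← one_div, one_div_le_one_div (Real.exp_pos u) this]

theorem mangoldtSum_eq {u : ℝ} {N : ℕ} (hN : Real.exp u ≤ N) :
    mangoldtSum u = ∑ m ∈ Finset.Icc 1 N, vonMangoldt m * max (1 / (m : ℝ) - Real.exp (-u)) 0 := by
  have hsub : Finset.Icc 1 ⌊Real.exp u⌋₊ ⊆ Finset.Icc 1 N :=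
    Finset.Icc_subset_Icc le_rfl (Nat.floor_le_of_le hN)
  rw [mangoldtSum, ← Finset.sum_subset hsub]
  · refine Finset.sum_congr rfl fun m hm => ?_
    rw [Finset.mem_Icc, Nat.le_floor_iff (Real.exp_pos u).le] at hm
    rw [max_eq_left ((le_exp_iff_inv (by omega) u).1 hm.2)]
  · intro m h1 h2
    rw [Finset.mem_Icc] at h1
    have h3 : ¬ ((m : ℝ) ≤ Real.exp u) := fun h =>
      h2 (Finset.mem_Icc.2 ⟨h1.1, Nat.le_floor h⟩)
    rw [le_exp_iff_inv (by omega)] at h3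
    rw [max_eq_right (le_of_not_ge h3), mul_zero]

theorem hasSum_mangoldtSum (u : ℝ) :
    HasSum (fun m : ℕ => vonMangoldt m * max (1 / (m : ℝ) - Real.exp (-u)) 0) (mangoldtSum u) := by
  obtain ⟨N, hN⟩ := exists_nat_ge (Real.exp u)
  rw [mangoldtSum_eq hN]
  refine hasSum_sum_of_ne_finset_zero fun m hm => ?_
  rcases Nat.eq_zero_or_pos m with rfl | hm0
  · simp
  · have h3 : ¬ ((m : ℝ) ≤ Real.exp u) := fun h =>
      hm (Finset.mem_Icc.2 ⟨hm0, by exact_mod_cast h.trans hN⟩)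
    rw [le_exp_iff_inv (by omega)] at h3
    rw [max_eq_right (le_of_not_ge h3), mul_zero]

theorem mangoldtSum_zero : mangoldtSum 0 = 0 := by simp [mangoldtSum]

theorem continuous_mangoldtSum : Continuous mangoldtSum := by
  rw [continuous_iff_continuousAt]
  intro u
  obtain ⟨N, hN⟩ := exists_nat_ge (Real.exp (u + 1))
  have h : (fun u => ∑ m ∈ Finset.Icc 1 N, vonMangoldt m * max (1 / (m : ℝ) - Real.exp (-u)) 0)
      =ᶠ[𝓝 u] mangoldtSum := by
    filter_upwards [gt_mem_nhds (show u < u + 1 by linarith)] with v hv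
    exact (mangoldtSum_eq ((Real.exp_le_exp.2 hv.le).trans hN)).symm
  refine ContinuousAt.congr ?_ h
  fun_prop

theorem mangoldtSum_nonneg (u : ℝ) : 0 ≤ mangoldtSum u :=
  (hasSum_mangoldtSum u).nonneg fun _ =>
    mul_nonneg ArithmeticFunction.vonMangoldt_nonneg (le_max_right _ _)

theorem mangoldtSum_le_exp (u : ℝ) : mangoldtSum u ≤ Real.exp u := by
  calc mangoldtSum u ≤ ∑ m ∈ Finset.Icc 1 ⌊Real.exp u⌋₊, (1 : ℝ) := by
        refine Finset.sum_le_sum fun m hm => ?_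
        rw [Finset.mem_Icc] at hm
        have hm0 : (0 : ℝ) < m := by exact_mod_cast hm.1
        have h1 : vonMangoldt m ≤ m := ArithmeticFunction.vonMangoldt_le_log.trans
          (Real.log_le_self hm0.le)
        calc vonMangoldt m * (1 / m - Real.exp (-u)) ≤ vonMangoldt m * (1 / m) :=
              mul_le_mul_of_nonneg_left (by linarith [Real.exp_pos (-u)])
                ArithmeticFunction.vonMangoldt_nonneg
          _ ≤ m * (1 / m) := by gcongr
          _ = 1 := by field_simp
    _ = ⌊Real.exp u⌋₊ := by simp
    _ ≤ Real.exp u := Nat.floor_le (Real.exp_pos u).le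

theorem hasLaplace_mangoldt_term {z : ℂ} (hz : 0 < z.re) (m : ℕ) :
    HasLaplace (fun u => ((vonMangoldt m * max (1 / (m : ℝ) - Real.exp (-u)) 0 : ℝ) : ℂ)) z
      (LSeries.term (fun n => (vonMangoldt n : ℂ)) (1 + z) m / (z * (1 + z))) := by
  rcases Nat.eq_zero_or_pos m with rfl | hm0
  · constructor <;> simp
  have hm : (0 : ℝ) < m := by exact_mod_cast hm0
  have hz0 : z ≠ 0 := by rintro rfl; simp at hz
  have hz1 : 1 + z ≠ 0 := by
    intro h
    have := congrArg re h
    simp at this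
    linarith
  have hlog : 0 ≤ Real.log m := Real.log_natCast_nonneg m
  set G : ℝ → ℂ := fun u => (1 / m : ℂ) * cexp (-z * u) - cexp (-(1 + z) * u) with hG
  have hr1 : (-z).re < 0 := by simpa using hz
  have hr2 : (-(1 + z)).re < 0 := by simp; linarith
  have i1 := (integrableOn_exp_mul_complex_Ioi hr1 (Real.log m)).const_mul (1 / m : ℂ)
  have i2 := integrableOn_exp_mul_complex_Ioi hr2 (Real.log m)
  have hGint : IntegrableOn G (Ioi (Real.log m)) := i1.sub i2
  have hGval : ∫ u in Ioi (Real.log m), G u = 1 / (m : ℂ) ^ (1 + z) / (z * (1 + z)) := by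
    simp only [hG]
    rw [integral_sub i1 i2, integral_const_mul, integral_exp_mul_complex_Ioi hr1,
      integral_exp_mul_complex_Ioi hr2]
    have e1 : ∀ w : ℂ, cexp (-w * Real.log m) = 1 / (m : ℂ) ^ w := by
      intro w
      have : (m : ℂ) ≠ 0 := by exact_mod_cast hm.ne'
      rw [cpow_def_of_ne_zero this, one_div, ← Complex.exp_neg, ← natCast_log]
      ring_nf
    rw [e1, e1, cpow_add _ _ (by exact_mod_cast hm.ne'), cpow_one]
    have : (m : ℂ) ≠ 0 := by exact_mod_cast hm.ne'
    have : (m : ℂ) ^ z ≠ 0 := by rw [Ne, cpow_eq_zero_iff]; tauto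
    have : -(1 + z) ≠ 0 := neg_ne_zero.2 hz1
    field_simp
    ring
  set F : ℝ → ℂ := fun u => cexp (-z * u) *
    ((vonMangoldt m * max (1 / (m : ℝ) - Real.exp (-u)) 0 : ℝ) : ℂ) with hF
  have hFG : ∀ u ∈ Ioi (Real.log m), F u = (vonMangoldt m : ℂ) * G u := by
    intro u hu
    have h1 : (m : ℝ) ≤ Real.exp u := (Real.log_le_iff_le_exp hm).1 (le_of_lt hu)
    rw [le_exp_iff_inv (by omega)] at h1
    simp only [hF, hG]
    rw [max_eq_left h1, show -(1 + z) * (u : ℂ) = -u + -z * u by ring, Complex.exp_add]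
    push_cast
    ring
  have hF0 : ∀ u ∈ Ioi (0 : ℝ) \ Ioi (Real.log m), F u = 0 := by
    intro u hu
    have h1 : 1 / (m : ℝ) - Real.exp (-u) ≤ 0 := by
      have h2 : u ≤ Real.log m := not_lt.1 hu.2
      rw [sub_nonpos, Real.exp_neg, ← one_div]
      exact one_div_le_one_div_of_le (Real.exp_pos u) ((Real.le_log_iff_exp_le hm).1 h2)
    simp only [hF]
    rw [max_eq_right h1]
    simp
  have hsub : Ioi (Real.log m) ⊆ Ioi 0 := Ioi_subset_Ioi hlog
  constructor
  · have h0 : IntegrableOn (fun u => (vonMangoldt m : ℂ) * G u) (Ioi (Real.log m)) :=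
      hGint.const_mul _
    have h1 : IntegrableOn F (Ioi (Real.log m)) :=
      h0.congr_fun (fun u hu => (hFG u hu).symm)
        measurableSet_Ioi
    exact h1.of_forall_sdiff_eq_zero measurableSet_Ioi hF0
  · change ∫ u in Ioi (0 : ℝ), F u = _
    rw [setIntegral_eq_of_subset_of_forall_sdiff_eq_zero measurableSet_Ioi hsub hF0,
      setIntegral_congr_fun measurableSet_Ioi hFG, integral_const_mul, hGval,
      LSeries.term_of_ne_zero (by omega)]
    ring

theorem hasLaplace_mangoldtSum {z : ℂ} (hz : z.re = 2) :
    HasLaplace (fun u => (mangoldtSum u : ℂ)) z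
      (-logDeriv riemannZeta (1 + z) / (z * (1 + z))) := by
  have hint : IntegrableOn (fun u : ℝ => cexp (-z * u) * (mangoldtSum u : ℂ)) (Ioi 0) := by
    refine HasLaplace.integrableOn_of_bound (f := fun u => (mangoldtSum u : ℂ)) hz (C := 1)
      (continuous_ofReal.comp continuous_mangoldtSum).continuousOn fun u _ => ?_
    rw [norm_real, Real.norm_of_nonneg (mangoldtSum_nonneg u), one_mul]
    exact mangoldtSum_le_exp u
  have ht : ∀ u : ℝ, ∑' m : ℕ, ((vonMangoldt m * max (1 / (m : ℝ) - Real.exp (-u)) 0 : ℝ) : ℂ) =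
      mangoldtSum u := fun u => (hasSum_ofReal.2 (hasSum_mangoldtSum u)).tsum_eq
  have h1 := HasLaplace.tsum (hasLaplace_mangoldt_term (z := z) (by linarith)) ?_ ?_
  · simp only [ht] at h1
    have h2 : 1 < (1 + z).re := by simp [hz]
    rw [tsum_div_const] at h1
    have h3 := ArithmeticFunction.LSeries_vonMangoldt_eq_deriv_riemannZeta_div h2
    rw [LSeries] at h3
    rw [h3, neg_div (riemannZeta _), ← logDeriv_apply] at h1
    exact h1
  · have hs := (ArithmeticFunction.LSeriesSummable_vonMangoldt (s := 1 + 2) (by simp)).norm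
    refine (hs.mul_right (‖(1 : ℂ) / (2 * (1 + 2))‖)).congr fun m => ?_
    have h4 := (hasLaplace_mangoldt_term (z := 2) (by simp) m).integral_eq
    rw [← norm_mul, ← div_eq_mul_one_div, ← h4]
    have h5 : ∀ u : ℝ, cexp (-2 * (u : ℂ)) *
        ((vonMangoldt m * max (1 / (m : ℝ) - Real.exp (-u)) 0 : ℝ) : ℂ) =
        ((Real.exp (-2 * u) * (vonMangoldt m * max (1 / (m : ℝ) - Real.exp (-u)) 0) : ℝ) : ℂ) := by
      intro u; push_cast; ring
    have h6 : ∀ u : ℝ, 0 ≤ vonMangoldt m * max (1 / (m : ℝ) - Real.exp (-u)) 0 := fun u =>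
      mul_nonneg ArithmeticFunction.vonMangoldt_nonneg (le_max_right _ _)
    simp only [h5]
    rw [integral_complex_ofReal, norm_real, Real.norm_of_nonneg
      (integral_nonneg fun u => mul_nonneg (Real.exp_pos _).le (h6 u))]
    refine integral_congr_ae (Eventually.of_forall fun u => ?_)
    simp only
    rw [norm_mul, norm_real, Real.norm_of_nonneg (h6 u), Complex.norm_exp]
    simp [hz]
  · simp only [ht]; exact hint

namespace XiZero

instance : Countable XiZero := by
  have h : (⋃ n, ((upTo n : Finset XiZero) : Set XiZero)) = Set.univ := by
    refine Set.eq_univ_of_forall fun ρ => ?_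
    obtain ⟨n, hn⟩ := exists_nat_ge ‖(ρ : ℂ)‖
    exact Set.mem_iUnion.2 ⟨n, mem_upTo.2 hn⟩
  have h2 : (Set.univ : Set XiZero).Countable := by
    rw [← h]
    exact Set.countable_iUnion fun n => (upTo n).countable_toSet
  exact Set.countable_univ_iff.1 h2

/-- The contribution of a zero to the explicit formula. -/
noncomputable def explicitTerm (ρ : XiZero) (u : ℝ) : ℂ :=
  (ρ.mult : ℂ) * (1 / (ρ * (1 - ρ))) * (cexp (-(1 - ρ) * u) - cexp (-1 * u))

theorem norm_mult_mul (ρ : XiZero) : ‖(ρ.mult : ℂ) * (1 / ((ρ : ℂ) * (1 - ρ)))‖ =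
    ρ.mult * (1 / ‖(ρ : ℂ) * (1 - ρ)‖) := by
  rw [norm_mul, norm_real, Real.norm_of_nonneg ρ.mult_nonneg, norm_div, norm_one]

theorem norm_explicitTerm_le (ρ : XiZero) {u : ℝ} (hu : 0 ≤ u) :
    ‖ρ.explicitTerm u‖ ≤ ρ.mult * (1 / ‖(ρ : ℂ) * (1 - ρ)‖) * 2 := by
  rw [explicitTerm, norm_mul, norm_mult_mul]
  refine mul_le_mul_of_nonneg_left ?_ (mul_nonneg ρ.mult_nonneg (by positivity))
  refine (norm_sub_le _ _).trans ?_
  rw [Complex.norm_exp, Complex.norm_exp]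
  have h1 : Real.exp (-(1 - (ρ : ℂ)) * u).re ≤ 1 := by
    rw [Real.exp_le_one_iff]
    have := ρ.re_lt_one
    simp
    nlinarith
  have h2 : Real.exp (-1 * (u : ℂ)).re ≤ 1 := by
    rw [Real.exp_le_one_iff]
    simpa using hu
  linarith

theorem continuous_explicitTerm (ρ : XiZero) : Continuous ρ.explicitTerm := by
  unfold explicitTerm
  fun_prop

theorem hasLaplace_explicitTerm (ρ : XiZero) {z : ℂ} (hz : z.re = 2) :
    HasLaplace ρ.explicitTerm z
      ((ρ.mult : ℂ) * (1 / ((1 - ρ) * (1 + z - ρ))) * (1 / (1 + z))) := by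
  have hz' : 0 < (z + (1 - (ρ : ℂ))).re := by
    have := ρ.re_lt_one
    simp [hz]
    linarith
  have h := ((HasLaplace.exp_mul hz').sub (HasLaplace.exp_mul (a := 1) (z := z) (by
    simp [hz]; norm_num))).const_mul ((ρ.mult : ℂ) * (1 / (ρ * (1 - ρ))))
  have e : (ρ.mult : ℂ) * (1 / (ρ * (1 - ρ))) * (1 / (z + (1 - ρ)) - 1 / (z + 1)) =
      (ρ.mult : ℂ) * (1 / ((1 - ρ) * (1 + z - ρ))) * (1 / (1 + z)) := by
    have e1 := ρ.one_sub_ne_zero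
    have e2 := ρ.ne_zero
    have e3 : z + (1 - (ρ : ℂ)) ≠ 0 := by rintro h0; rw [h0] at hz'; simp at hz'
    have e4 : 1 + z - (ρ : ℂ) ≠ 0 := by rw [show 1 + z - (ρ : ℂ) = z + (1 - ρ) by ring]; exact e3
    have e5 : z + 1 ≠ 0 := by
      intro h0
      have := congrArg re h0
      simp [hz] at this
      norm_num at this
    have e6 : 1 + z ≠ 0 := by rwa [add_comm]
    field_simp
    ring
  rw [e] at h
  exact h

end XiZero

/-- The contribution of the trivial zeros to the explicit formula. -/
noncomputable def trivialTerm (k : ℕ) (u : ℝ) : ℂ :=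
  1 / ((2 * k + 3) * (2 * k + 2)) * (cexp (-1 * u) - cexp (-(2 * k + 3) * u))

theorem norm_trivialTerm_le (k : ℕ) {u : ℝ} (hu : 0 ≤ u) :
    ‖trivialTerm k u‖ ≤ 1 / (2 * (k : ℝ) + 1) ^ 2 * 2 := by
  rw [trivialTerm, norm_mul]
  have h0 : ‖(1 : ℂ) / ((2 * k + 3) * (2 * k + 2))‖ ≤ 1 / (2 * (k : ℝ) + 1) ^ 2 := by
    have : (1 : ℂ) / ((2 * k + 3) * (2 * k + 2)) =
        ((1 / ((2 * k + 3) * (2 * k + 2)) : ℝ) : ℂ) := by push_cast; rfl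
    rw [this, norm_real, Real.norm_of_nonneg (by positivity)]
    refine one_div_le_one_div_of_le (by positivity) ?_
    nlinarith [Nat.cast_nonneg (α := ℝ) k]
  refine mul_le_mul h0 ?_ (norm_nonneg _) (by positivity)
  refine (norm_sub_le _ _).trans ?_
  rw [Complex.norm_exp, Complex.norm_exp]
  have h1 : Real.exp (-(2 * (k : ℂ) + 3) * u).re ≤ 1 := by
    rw [Real.exp_le_one_iff]
    simp
    nlinarith [Nat.cast_nonneg (α := ℝ) k, mul_nonneg (Nat.cast_nonneg (α := ℝ) k) hu]
  have h2 : Real.exp (-1 * (u : ℂ)).re ≤ 1 := by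
    rw [Real.exp_le_one_iff]
    simpa using hu
  linarith

theorem continuous_trivialTerm (k : ℕ) : Continuous (trivialTerm k) := by
  unfold trivialTerm
  fun_prop

theorem hasLaplace_trivialTerm (k : ℕ) {z : ℂ} (hz : z.re = 2) :
    HasLaplace (trivialTerm k) z
      (1 / ((2 * ((k + 1 : ℕ) : ℂ) + 1) * (2 * ((k + 1 : ℕ) : ℂ) + 1 + z)) * (1 / (1 + z))) := by
  have h0 : ∀ x : ℝ, 0 ≤ x → z + x ≠ 0 := by
    intro x hx h
    have := congrArg re h
    simp [hz] at this
    linarith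
  have h := ((HasLaplace.exp_mul (a := 1) (z := z) (by
    simp [hz]; norm_num)).sub (HasLaplace.exp_mul (a := 2 * k + 3) (z := z) (by
    simp [hz]; positivity))).const_mul (1 / ((2 * k + 3) * (2 * k + 2)) : ℂ)
  have e : (1 / ((2 * k + 3) * (2 * k + 2)) : ℂ) * (1 / (z + 1) - 1 / (z + (2 * k + 3))) =
      1 / ((2 * ((k + 1 : ℕ) : ℂ) + 1) * (2 * ((k + 1 : ℕ) : ℂ) + 1 + z)) * (1 / (1 + z)) := by
    have e1 := h0 1 zero_le_one
    have e2 := h0 (2 * k + 3) (by positivity)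
    have e3 : (2 * (k : ℂ) + 3) ≠ 0 := by
      have : (2 * (k : ℝ) + 3) ≠ 0 := by positivity
      exact_mod_cast this
    have e4 : (2 * (k : ℂ) + 2) ≠ 0 := by
      have : (2 * (k : ℝ) + 2) ≠ 0 := by positivity
      exact_mod_cast this
    push_cast at *
    have e5 : 1 + z ≠ 0 := by rwa [add_comm]
    have e6 : 2 * ((k : ℂ) + 1) + 1 ≠ 0 := by
      rw [show 2 * ((k : ℂ) + 1) + 1 = 2 * k + 3 by ring]; exact e3
    have e7 : 2 * ((k : ℂ) + 1) + 1 + z ≠ 0 := by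
      rw [show 2 * ((k : ℂ) + 1) + 1 + z = z + (2 * k + 3) by ring]; exact e2
    rw [div_sub_div _ _ e1 e2, div_mul_div_comm, div_mul_div_comm, div_eq_div_iff]
    · ring
    · exact mul_ne_zero (mul_ne_zero e3 e4) (mul_ne_zero e1 e2)
    · exact mul_ne_zero (mul_ne_zero e6 e7) e5
  rw [e] at h
  exact h

theorem one_add_sub_add_mangoldtSum {u : ℝ} (hu : 0 ≤ u) :
    ((1 + Real.eulerMascheroniConstant - u + mangoldtSum u : ℝ) : ℂ) =
      (1 + Real.eulerMascheroniConstant) * cexp (-1 * u) + ∑' k, trivialTerm k u +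
        ∑' ρ : XiZero, ρ.explicitTerm u := by
  have hs1 : Summable fun k : ℕ => 1 / (2 * (k : ℝ) + 1) ^ 2 * 2 := summable_inv_odd_sq.mul_right 2
  have hs2 := XiZero.summable_mult_div_norm.mul_right 2
  rw [← sub_eq_zero]
  refine eq_zero_of_hasLaplace_zero (f := fun u =>
    ((1 + Real.eulerMascheroniConstant - u + mangoldtSum u : ℝ) : ℂ) -
      ((1 + Real.eulerMascheroniConstant) * cexp (-1 * u) + ∑' k, trivialTerm k u +
        ∑' ρ : XiZero, ρ.explicitTerm u)) ?_ ?_ ?_ hu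
  · refine ContinuousOn.sub ?_ (ContinuousOn.add (ContinuousOn.add (by fun_prop) ?_) ?_)
    · have := continuous_mangoldtSum
      exact (continuous_ofReal.comp (by fun_prop)).continuousOn
    · exact continuousOn_tsum (fun k => (continuous_trivialTerm k).continuousOn) hs1
        fun k u hu => norm_trivialTerm_le k hu
    · exact continuousOn_tsum (fun ρ => ρ.continuous_explicitTerm.continuousOn) hs2
        fun ρ u hu => ρ.norm_explicitTerm_le hu
  · simp [mangoldtSum_zero, trivialTerm, XiZero.explicitTerm]
  · intro z hz
    have hz0 : z ≠ 0 := by rintro rfl; simp at hz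
    have hz1 : 1 + z ≠ 0 := by
      intro h
      have := congrArg re h
      simp [hz] at this
      norm_num at this
    have hzpos : 0 < z.re := by linarith
    have l1 := (((HasLaplace.one hzpos).const_mul (1 + Real.eulerMascheroniConstant : ℂ)).sub
      (HasLaplace.id hz)).add (hasLaplace_mangoldtSum hz)
    have l2 := (HasLaplace.exp_mul (a := 1) (z := z) (by simp [hz]; norm_num)).const_mul
      (1 + Real.eulerMascheroniConstant : ℂ)
    have l3 := HasLaplace.tsum_of_bound hz (fun k => hasLaplace_trivialTerm k hz) hs1
      (fun k u hu => norm_trivialTerm_le k hu.le) fun k => (continuous_trivialTerm k).continuousOn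
    have l4 := HasLaplace.tsum_of_bound hz (fun ρ : XiZero => ρ.hasLaplace_explicitTerm hz) hs2
      (fun ρ u hu => ρ.norm_explicitTerm_le hu.le) fun ρ => ρ.continuous_explicitTerm.continuousOn
    have l5 := l1.sub ((l2.add l3).add l4)
    rw [neg_logDeriv_riemannZeta_one_add hzpos, tsum_mul_right, tsum_mul_right,
      (Summable.of_norm_bounded summable_inv_odd_sq
        fun k => norm_odd_term_le hzpos k).tsum_eq_zero_add] at l5
    have e : ∀ T Z L : ℂ, L = (1 + (Real.eulerMascheroniConstant : ℂ)) * (1 / z) - 1 / z ^ 2 +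
        (1 / z + 1 / (1 + z) - (1 + (Real.eulerMascheroniConstant : ℂ)) +
          z * ((1 / ((2 * ((0 : ℕ) : ℂ) + 1) * (2 * ((0 : ℕ) : ℂ) + 1 + z)) + T) + Z)) /
            (z * (1 + z)) -
        ((1 + (Real.eulerMascheroniConstant : ℂ)) * (1 / (z + 1)) + T * (1 / (1 + z)) +
          Z * (1 / (1 + z))) → L = 0 := by
      intro T Z L hL
      rw [hL, add_comm z 1]
      have e0 : 2 * ((0 : ℕ) : ℂ) + 1 = 1 := by simp
      rw [e0]
      field_simp
      ring
    rw [e _ _ _ rfl] at l5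
    refine l5.congr_fun fun u _ => ?_
    push_cast
    ring

/-- The oscillating part of the smoothed Mertens sum `mangoldtSum`. -/
noncomputable def mangoldtError (u : ℝ) : ℝ :=
  1 + Real.eulerMascheroniConstant - u + mangoldtSum u

theorem hasDerivAt_cexp_mul (c : ℂ) (v : ℝ) :
    HasDerivAt (fun t : ℝ => cexp (c * t)) (c * cexp (c * v)) v := by
  have h : HasDerivAt (fun t : ℝ => c * (t : ℂ)) c v := by
    simpa using (hasDerivAt_id v).ofReal_comp.const_mul c
  exact h.cexp.congr_deriv (mul_comm _ _)

namespace XiZero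

/-- The tail integral of `explicitTerm`. -/
noncomputable def explicitTail (ρ : XiZero) (v : ℝ) : ℂ :=
  (ρ.mult : ℂ) * (1 / (ρ * (1 - ρ))) * (cexp (-(1 - ρ) * v) / (1 - ρ) - cexp (-1 * v))

theorem hasDerivAt_explicitTail (ρ : XiZero) (v : ℝ) :
    HasDerivAt ρ.explicitTail (-ρ.explicitTerm v) v := by
  have h := (((hasDerivAt_cexp_mul (-(1 - ρ)) v).div_const (1 - (ρ : ℂ))).sub
    (hasDerivAt_cexp_mul (-1) v)).const_mul ((ρ.mult : ℂ) * (1 / (ρ * (1 - ρ))))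
  refine h.congr_deriv ?_
  have := ρ.one_sub_ne_zero
  rw [explicitTerm]
  field_simp
  ring

theorem norm_explicitTail_le (ρ : XiZero) (v : ℝ) :
    ‖ρ.explicitTail v‖ ≤ ρ.mult * (1 / ‖(ρ : ℂ) * (1 - ρ)‖) *
      (Real.exp (-(1 - ρ.1.re) * v) / |ρ.1.im| + Real.exp (-v)) := by
  rw [explicitTail, norm_mul, norm_mult_mul]
  refine mul_le_mul_of_nonneg_left ?_ (mul_nonneg ρ.mult_nonneg (by positivity))
  refine (norm_sub_le _ _).trans ?_
  rw [norm_div, Complex.norm_exp, Complex.norm_exp]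
  have e1 : (-(1 - (ρ : ℂ)) * v).re = -(1 - ρ.1.re) * v := by simp
  have e2 : (-1 * (v : ℂ)).re = -v := by simp
  rw [e1, e2]
  gcongr
  · exact abs_pos.2 ρ.im_ne_zero
  · exact ρ.abs_im_le_norm_one_sub

theorem norm_explicitTail_le_two {ρ : XiZero} {v : ℝ} (hv : 0 ≤ v) :
    ‖ρ.explicitTail v‖ ≤ ρ.mult * (1 / ‖(ρ : ℂ) * (1 - ρ)‖) * 2 := by
  refine (ρ.norm_explicitTail_le v).trans ?_
  refine mul_le_mul_of_nonneg_left ?_ (mul_nonneg ρ.mult_nonneg (by positivity))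
  have h1 : Real.exp (-(1 - ρ.1.re) * v) ≤ 1 := by
    rw [Real.exp_le_one_iff]
    have := ρ.re_lt_one
    nlinarith
  have h2 : Real.exp (-v) ≤ 1 := by rw [Real.exp_le_one_iff]; linarith
  have h3 : Real.exp (-(1 - ρ.1.re) * v) / |ρ.1.im| ≤ 1 := by
    have := ρ.lt_abs_im
    rw [div_le_one (by linarith)]
    linarith
  linarith

end XiZero

/-- The tail integral of `trivialTerm`. -/
noncomputable def trivialTail (k : ℕ) (v : ℝ) : ℂ :=
  1 / ((2 * k + 3) * (2 * k + 2)) * (cexp (-1 * v) - cexp (-(2 * k + 3) * v) / (2 * k + 3))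

theorem hasDerivAt_trivialTail (k : ℕ) (v : ℝ) :
    HasDerivAt (trivialTail k) (-trivialTerm k v) v := by
  have h := ((hasDerivAt_cexp_mul (-1) v).sub
    ((hasDerivAt_cexp_mul (-(2 * k + 3)) v).div_const (2 * (k : ℂ) + 3))).const_mul
    (1 / ((2 * k + 3) * (2 * k + 2)) : ℂ)
  refine h.congr_deriv ?_
  have : (2 * (k : ℂ) + 3) ≠ 0 := by
    have : (2 * (k : ℝ) + 3) ≠ 0 := by positivity
    exact_mod_cast this
  rw [trivialTerm]
  field_simp
  ring

theorem norm_trivialTail_le (k : ℕ) {v : ℝ} (hv : 0 ≤ v) :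
    ‖trivialTail k v‖ ≤ 1 / 2 * (1 / (2 * k + 3 / 2) - 1 / (2 * (k + 1 : ℕ) + 3 / 2)) *
      Real.exp (-v) := by
  have e : trivialTail k v = ((1 / ((2 * k + 3) * (2 * k + 2)) *
      (Real.exp (-v) - Real.exp (-(2 * k + 3) * v) / (2 * k + 3)) : ℝ) : ℂ) := by
    rw [trivialTail]; push_cast; simp
  have hk := Nat.cast_nonneg (α := ℝ) k
  have h1 : Real.exp (-(2 * k + 3) * v) / (2 * k + 3) ≤ Real.exp (-v) := by
    rw [div_le_iff₀ (by positivity)]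
    have : Real.exp (-(2 * k + 3) * v) ≤ Real.exp (-v) := by
      apply Real.exp_le_exp.2
      nlinarith [mul_nonneg hk hv]
    nlinarith [Real.exp_pos (-v)]
  have h2 : 0 ≤ Real.exp (-(2 * k + 3) * v) / (2 * k + 3) := by positivity
  rw [e, norm_real, Real.norm_of_nonneg (mul_nonneg (by positivity) (sub_nonneg.2 h1))]
  refine mul_le_mul ?_ (by linarith) (sub_nonneg.2 h1) ?_
  · rw [div_sub_div _ _ (by positivity) (by positivity), div_mul_div_comm,
      div_le_div_iff₀ (by positivity) (by positivity)]
    push_cast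
    nlinarith
  · push_cast
    rw [div_sub_div _ _ (by positivity) (by positivity)]
    refine mul_nonneg (by norm_num) (div_nonneg (by linarith) (by positivity))

theorem hasSum_telescope : HasSum (fun k : ℕ =>
    (1 / 2 * (1 / (2 * k + 3 / 2) - 1 / (2 * (k + 1 : ℕ) + 3 / 2)) : ℝ)) (1 / 3) := by
  rw [hasSum_iff_tendsto_nat_of_nonneg]
  · simp_rw [← Finset.mul_sum]
    have h : ∀ n : ℕ, ∑ k ∈ Finset.range n, (1 / (2 * (k : ℝ) + 3 / 2) -
        1 / (2 * (k + 1 : ℕ) + 3 / 2)) = 2 / 3 - 1 / (2 * n + 3 / 2) := by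
      intro n
      rw [Finset.sum_range_sub' (fun k : ℕ => 1 / (2 * (k : ℝ) + 3 / 2))]
      norm_num
    simp_rw [h]
    have h2 : Tendsto (fun n : ℕ => 1 / (2 * (n : ℝ) + 3 / 2)) atTop (𝓝 0) := by
      refine Tendsto.div_atTop tendsto_const_nhds ?_
      exact tendsto_atTop_add_const_right _ _
        (tendsto_natCast_atTop_atTop.const_mul_atTop (by norm_num))
    have := (h2.const_sub (2 / 3)).const_mul (1 / 2)
    norm_num at this ⊢
    exact this
  · intro k
    push_cast
    rw [div_sub_div _ _ (by positivity) (by positivity)]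
    refine mul_nonneg (by norm_num) (div_nonneg (by linarith) (by positivity))

/-- The tail integral of `mangoldtError`. -/
noncomputable def mangoldtErrorTail (v : ℝ) : ℝ :=
  ((1 + Real.eulerMascheroniConstant) * cexp (-1 * v) + ∑' k, trivialTail k v +
    ∑' ρ : XiZero, ρ.explicitTail v).re

theorem summable_trivialTail {v : ℝ} (hv : 0 ≤ v) : Summable fun k => trivialTail k v :=
  Summable.of_norm_bounded (hasSum_telescope.summable.mul_right _) fun k => norm_trivialTail_le k hv

theorem summable_explicitTail {v : ℝ} (hv : 0 ≤ v) :
    Summable fun ρ : XiZero => ρ.explicitTail v :=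
  Summable.of_norm_bounded (XiZero.summable_mult_div_norm.mul_right 2)
    fun ρ => ρ.norm_explicitTail_le_two hv

theorem hasDerivAt_mangoldtErrorTail {v : ℝ} (hv : 0 < v) :
    HasDerivAt mangoldtErrorTail (-mangoldtError v) v := by
  have h1 := (hasDerivAt_cexp_mul (-1) v).const_mul (1 + Real.eulerMascheroniConstant : ℂ)
  have h2 := hasDerivAt_tsum_of_isPreconnected (g := trivialTail)
    (g' := fun k v => -trivialTerm k v) (summable_inv_odd_sq.mul_right 2)
    isOpen_Ioi isPreconnected_Ioi (fun k y _ => hasDerivAt_trivialTail k y)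
    (fun k y hy => by rw [norm_neg]; exact norm_trivialTerm_le k (le_of_lt hy))
    (y₀ := v) (t := Ioi 0) hv (summable_trivialTail hv.le) hv
  have h3 := hasDerivAt_tsum_of_isPreconnected (g := XiZero.explicitTail)
    (g' := fun ρ v => -ρ.explicitTerm v) (XiZero.summable_mult_div_norm.mul_right 2)
    isOpen_Ioi isPreconnected_Ioi (fun ρ y _ => ρ.hasDerivAt_explicitTail y)
    (fun ρ y hy => by rw [norm_neg]; exact ρ.norm_explicitTerm_le (le_of_lt hy))
    (y₀ := v) (t := Ioi 0) hv (summable_explicitTail hv.le) hv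
  have h4 := (h1.add h2).add h3
  have h5 : HasDerivAt (fun v : ℝ => (reCLM : ℂ → ℝ) ((1 + Real.eulerMascheroniConstant) *
      cexp (-1 * v) + ∑' k, trivialTail k v + ∑' ρ : XiZero, ρ.explicitTail v)) _ v :=
    reCLM.hasFDerivAt.comp_hasDerivAt v h4
  refine h5.congr_deriv ?_
  have h6 := one_add_sub_add_mangoldtSum hv.le
  rw [tsum_neg, tsum_neg]
  have e : mangoldtError v = ((1 + Real.eulerMascheroniConstant - v + mangoldtSum v : ℝ) : ℂ).re :=
    rfl
  rw [e, h6, reCLM_apply, ← neg_re]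
  congr 1
  ring

set_option maxHeartbeats 1000000 in
theorem abs_mangoldtErrorTail_le {v B : ℝ} (hv : 0 ≤ v) (hB0 : 0 ≤ B)
    (hB : ∀ ρ : XiZero,
      (Real.exp (-(1 - ρ.1.re) * v) + Real.exp (-ρ.1.re * v)) / |ρ.1.im| ≤ B) :
    |mangoldtErrorTail v| ≤ 2 * Real.exp (-v) + 0.0234 * B := by
  set W : XiZero → ℝ := fun ρ => ρ.mult * (1 / ‖(ρ : ℂ) * (1 - ρ)‖) with hW
  have hW0 : ∀ ρ, 0 ≤ W ρ := fun ρ => mul_nonneg ρ.mult_nonneg (by positivity)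
  have hWs : Summable W := XiZero.summable_mult_div_norm
  have hWt : ∑' ρ, W ρ ≤ 0.0468 := XiZero.tsum_mult_div_norm_lt.le
  set F : XiZero → ℝ := fun ρ => W ρ * (Real.exp (-(1 - ρ.1.re) * v) / |ρ.1.im|) with hF
  have hFs : Summable F := by
    refine Summable.of_nonneg_of_le (fun ρ => mul_nonneg (hW0 ρ) (by positivity)) (fun ρ => ?_) hWs
    refine mul_le_of_le_one_right (hW0 ρ) ?_
    have := ρ.lt_abs_im
    have h2 := ρ.re_lt_one
    rw [div_le_one (by linarith)]
    have h1 : Real.exp (-(1 - ρ.1.re) * v) ≤ 1 := by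
      rw [Real.exp_le_one_iff]
      nlinarith
    linarith
  have hFr : ∑' ρ, F ρ ≤ 0.0234 * B := by
    have hF2 : Summable fun ρ => F (XiZero.reflect ρ) := (Equiv.summable_iff _).2 hFs
    have e : ∑' ρ, F ρ + ∑' ρ, F ρ = ∑' ρ, (F ρ + F (XiZero.reflect ρ)) := by
      rw [hFs.tsum_add hF2, XiZero.reflect.tsum_eq F]
    have h : ∑' ρ, (F ρ + F (XiZero.reflect ρ)) ≤ ∑' ρ, W ρ * B := by
      refine Summable.tsum_le_tsum (fun ρ => ?_) (hFs.add hF2) (hWs.mul_right _)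
      have e2 : F (XiZero.reflect ρ) = W ρ * (Real.exp (-ρ.1.re * v) / |ρ.1.im|) := by
        simp only [hF, hW, XiZero.mult_reflect, XiZero.reflect_coe, sub_sub_cancel, sub_re, one_re,
          sub_im, one_im, zero_sub, abs_neg]
        rw [mul_comm (1 - (ρ : ℂ))]
      rw [e2, hF]
      simp only
      rw [← mul_add, ← add_div]
      exact mul_le_mul_of_nonneg_left (hB ρ) (hW0 ρ)
    rw [tsum_mul_right] at h
    nlinarith
  have h1 : ‖(1 + Real.eulerMascheroniConstant : ℂ) * cexp (-1 * v)‖ ≤ 1.57722 * Real.exp (-v) := by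
    have e : (1 + Real.eulerMascheroniConstant : ℂ) * cexp (-1 * v) =
        (((1 + Real.eulerMascheroniConstant) * Real.exp (-v) : ℝ) : ℂ) := by push_cast; simp
    have g1 := eulerMascheroniConstant_lt
    have g2 := eulerMascheroniConstant_gt
    rw [e, norm_real, Real.norm_of_nonneg (by positivity)]
    gcongr
    linarith
  have h2 : ‖∑' k, trivialTail k v‖ ≤ 1 / 3 * Real.exp (-v) :=
    tsum_of_norm_bounded (hasSum_telescope.mul_right _) fun k => norm_trivialTail_le k hv
  have h3 : ‖∑' ρ : XiZero, ρ.explicitTail v‖ ≤ 0.0234 * B + 0.0468 * Real.exp (-v) := by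
    have h : ‖∑' ρ : XiZero, ρ.explicitTail v‖ ≤ ∑' ρ, F ρ + (∑' ρ, W ρ) * Real.exp (-v) := by
      refine tsum_of_norm_bounded (hFs.hasSum.add (hWs.hasSum.mul_right _)) fun ρ => ?_
      have := ρ.norm_explicitTail_le v
      rw [mul_add] at this
      exact this
    have := mul_le_mul_of_nonneg_right hWt (Real.exp_pos (-v)).le
    linarith
  have h4 : |mangoldtErrorTail v| ≤ _ := (abs_re_le_norm _).trans (norm_add₃_le)
  have := Real.exp_pos (-v)
  linarith

theorem exists_abs_mangoldtError_le : ∃ M, ∀ u : ℝ, 0 ≤ u → |mangoldtError u| ≤ M := by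
  refine ⟨‖(1 + Real.eulerMascheroniConstant : ℂ)‖ + ∑' k : ℕ, 1 / (2 * (k : ℝ) + 1) ^ 2 * 2 +
    ∑' ρ : XiZero, ρ.mult * (1 / ‖(ρ : ℂ) * (1 - ρ)‖) * 2, fun u hu => ?_⟩
  have e : |mangoldtError u| =
      ‖((1 + Real.eulerMascheroniConstant - u + mangoldtSum u : ℝ) : ℂ)‖ := by
    rw [norm_real]; rfl
  rw [e, one_add_sub_add_mangoldtSum hu]
  refine norm_add₃_le.trans ?_
  gcongr
  · rw [norm_mul]
    refine mul_le_of_le_one_right (norm_nonneg _) ?_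
    rw [Complex.norm_exp, Real.exp_le_one_iff]
    simpa using hu
  · exact tsum_of_norm_bounded (summable_inv_odd_sq.mul_right 2).hasSum
      fun k => norm_trivialTerm_le k hu
  · exact tsum_of_norm_bounded (XiZero.summable_mult_div_norm.mul_right 2).hasSum
      fun ρ => ρ.norm_explicitTerm_le hu

theorem hasSum_digamma {w : ℂ} (hw : 0 < w.re) :
    HasSum (fun k : ℕ => 1 / ((k : ℂ) + 1) - 1 / (k + w))
      (digamma w + Real.eulerMascheroniConstant) := by
  have key : ∀ s : ℂ, 0 < s.re → HasSum (fun k : ℕ => 1 / ((k : ℂ) + 1 / 2) - 1 / (k + s))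
      (digamma s - digamma (1 / 2)) := by
    intro s hs
    rw [digamma_sub_digamma_one_half hs]
    have h : Summable fun k : ℕ => 1 / (((k : ℂ) + 1 / 2) * (k + s)) :=
      Summable.of_norm_bounded (summable_inv_mul_inv (by norm_num) hs)
        fun k => norm_digamma_term_le hs le_rfl k
    refine (h.hasSum.mul_left (s - 1 / 2)).congr_fun fun k => ?_
    have h1 : (k : ℂ) + s ≠ 0 := by
      have := ne_neg_nat_of_re_pos hs k
      intro h0
      exact this (by linear_combination h0)
    have h2 : (k : ℂ) + 1 / 2 ≠ 0 := by
      intro h0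
      have := congrArg re h0
      simp at this
      linarith [Nat.cast_nonneg (α := ℝ) k]
    rw [div_sub_div _ _ h2 h1, mul_one_div]
    congr 1
    ring
  have h := (key w hw).sub (key 1 (by simp))
  rw [digamma_one] at h
  have e : digamma w + Real.eulerMascheroniConstant = digamma w - digamma (1 / 2) -
      (-Real.eulerMascheroniConstant - digamma (1 / 2)) := by ring
  rw [e]
  refine h.congr_fun fun k => ?_
  ring

theorem sub_div_le_arctan_sub {a b : ℝ} (ha : 0 ≤ a) (hab : a ≤ b) :
    (b - a) / (1 + b ^ 2) ≤ Real.arctan b - Real.arctan a := by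
  have := (convex_Icc a b).mul_sub_le_image_sub_of_le_deriv (f := Real.arctan) (C := 1 / (1 + b ^ 2))
    Real.continuous_arctan.continuousOn Real.differentiable_arctan.differentiableOn
    (fun x hx => by
      rw [interior_Icc] at hx
      rw [Real.deriv_arctan]
      apply one_div_le_one_div_of_le (by positivity)
      have := hx.1.le
      have := hx.2.le
      gcongr
      linarith) a (left_mem_Icc.2 hab) b (right_mem_Icc.2 hab) hab
  rwa [one_div_mul_eq_div] at this

theorem sum_one_div_sq_add_sq_le {y : ℝ} (hy : 0 < y) (N : ℕ) :
    ∑ k ∈ Finset.range N, 1 / (((k : ℝ) + 1) ^ 2 + y ^ 2) ≤ Real.pi / (2 * y) := by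
  have h : ∀ k : ℕ, 1 / (((k : ℝ) + 1) ^ 2 + y ^ 2) ≤
      1 / y * (Real.arctan ((k + 1 : ℕ) / y) - Real.arctan (k / y)) := by
    intro k
    have := sub_div_le_arctan_sub (a := k / y) (b := (k + 1 : ℕ) / y) (by positivity)
      (by push_cast; gcongr; linarith)
    refine le_trans (le_of_eq ?_) (mul_le_mul_of_nonneg_left this (by positivity))
    push_cast
    field_simp
    ring
  refine (Finset.sum_le_sum fun k _ => h k).trans ?_
  rw [← Finset.mul_sum, Finset.sum_range_sub (fun k : ℕ => Real.arctan (k / y))]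
  have := (Real.arctan_lt_pi_div_two (N / y)).le
  simp only [CharP.cast_eq_zero, zero_div, Real.arctan_zero, sub_zero]
  rw [show Real.pi / (2 * y) = 1 / y * (Real.pi / 2) by field_simp]
  gcongr

theorem log_sq_add_le {a y : ℝ} (ha : 0 ≤ a) (hy : 0 < y) :
    Real.log ((a + 1) ^ 2 + y ^ 2) / 2 - Real.log (a ^ 2 + y ^ 2) / 2 ≤
      a / (a ^ 2 + y ^ 2) + 1 / (a ^ 2 + y ^ 2) / 2 := by
  have h0 : 0 < a ^ 2 + y ^ 2 := by positivity
  have h1 := Real.log_le_sub_one_of_pos (x := ((a + 1) ^ 2 + y ^ 2) / (a ^ 2 + y ^ 2))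
    (by positivity)
  rw [Real.log_div (by positivity) h0.ne'] at h1
  have e : ((a + 1) ^ 2 + y ^ 2) / (a ^ 2 + y ^ 2) - 1 =
      2 * (a / (a ^ 2 + y ^ 2) + 1 / (a ^ 2 + y ^ 2) / 2) := by
    field_simp
    ring
  linarith

theorem re_digamma_le {w : ℂ} (hx : 0 < w.re) (hx1 : w.re ≤ 1) (hy : w.im ≠ 0) :
    (digamma w).re ≤ Real.log |w.im| + 1 / w.im ^ 2 + Real.pi / (4 * |w.im|) := by
  set x := w.re with hxd
  set y := |w.im| with hyd
  have hy0 : 0 < y := abs_pos.2 hy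
  have hy2 : w.im ^ 2 = y ^ 2 := (sq_abs _).symm
  have hre : ∀ k : ℕ, (1 / ((k : ℂ) + 1) - 1 / (k + w)).re =
      1 / ((k : ℝ) + 1) - ((k : ℝ) + x) / ((k + x) ^ 2 + y ^ 2) := by
    intro k
    rw [sub_re, one_div, one_div, inv_re, inv_re, normSq_apply, normSq_apply]
    simp only [add_re, natCast_re, one_re, add_im, natCast_im, one_im, ← hxd]
    rw [show (0 + w.im) * (0 + w.im) = y ^ 2 by rw [← hy2]; ring]
    congr 1
    · field_simp; ring
    · ring
  have h := ((hasSum_re (hasSum_digamma hx)).tendsto_sum_nat)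
  simp only [hre, add_re, ofReal_re] at h
  have hH := Real.tendsto_harmonic_sub_log
  have hb := hH.add_const (Real.log (x ^ 2 + y ^ 2) / 2 + 1 / (x ^ 2 + y ^ 2) / 2 +
    Real.pi / (4 * y))
  have hle : (digamma w).re + Real.eulerMascheroniConstant ≤
      Real.eulerMascheroniConstant + (Real.log (x ^ 2 + y ^ 2) / 2 + 1 / (x ^ 2 + y ^ 2) / 2 +
        Real.pi / (4 * y)) := by
    refine le_of_tendsto_of_tendsto h hb ?_
    filter_upwards [eventually_gt_atTop 0] with N hN
    have h1 : ∑ k ∈ Finset.range N, 1 / ((k : ℝ) + 1) = harmonic N := by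
      simp [harmonic]
    have h2 : Real.log ((N + x) ^ 2 + y ^ 2) / 2 - Real.log (x ^ 2 + y ^ 2) / 2 ≤
        ∑ k ∈ Finset.range N, ((((k : ℝ) + x) / ((k + x) ^ 2 + y ^ 2)) +
          1 / ((k + x) ^ 2 + y ^ 2) / 2) := by
      have := Finset.sum_range_sub (fun k : ℕ => Real.log ((k + x) ^ 2 + y ^ 2) / 2) N
      simp only [CharP.cast_eq_zero, zero_add] at this
      rw [← this]
      refine Finset.sum_le_sum fun k _ => ?_
      have := log_sq_add_le (a := k + x) (by positivity) hy0
      push_cast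
      rw [show (k : ℝ) + 1 + x = k + x + 1 by ring]
      exact this
    have h3 : ∑ k ∈ Finset.range N, 1 / (((k : ℝ) + x) ^ 2 + y ^ 2) ≤
        1 / (x ^ 2 + y ^ 2) + Real.pi / (2 * y) := by
      obtain ⟨M, rfl⟩ : ∃ M, N = M + 1 := ⟨N - 1, by omega⟩
      rw [Finset.sum_range_succ', add_comm]
      simp only [CharP.cast_eq_zero, zero_add]
      gcongr
      refine le_trans (Finset.sum_le_sum fun k _ => ?_) (sum_one_div_sq_add_sq_le hy0 M)
      push_cast
      refine one_div_le_one_div_of_le (by positivity) ?_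
      nlinarith [Nat.cast_nonneg (α := ℝ) k, mul_nonneg (Nat.cast_nonneg (α := ℝ) k) hx.le]
    have h4 : Real.log N ≤ Real.log ((N + x) ^ 2 + y ^ 2) / 2 := by
      have : Real.log ((N : ℝ) ^ 2) ≤ Real.log ((N + x) ^ 2 + y ^ 2) := by
        apply Real.log_le_log (by positivity)
        nlinarith [Nat.cast_nonneg (α := ℝ) N, sq_nonneg x, sq_nonneg y,
          mul_nonneg (Nat.cast_nonneg (α := ℝ) N) hx.le]
      rw [Real.log_pow] at this
      push_cast at this
      linarith
    rw [Finset.sum_sub_distrib, h1]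
    rw [Finset.sum_add_distrib, ← Finset.sum_div] at h2
    have e : Real.pi / (2 * y) / 2 = Real.pi / (4 * y) := by field_simp; ring
    linarith
  have h5 : Real.log (x ^ 2 + y ^ 2) / 2 ≤ Real.log y + 1 / y ^ 2 / 2 := by
    have h6 := Real.log_le_sub_one_of_pos (x := (x ^ 2 + y ^ 2) / y ^ 2) (by positivity)
    rw [Real.log_div (by positivity) (by positivity), Real.log_pow] at h6
    have e : (x ^ 2 + y ^ 2) / y ^ 2 - 1 = x ^ 2 * (1 / y ^ 2) := by field_simp; ring
    have : x ^ 2 * (1 / y ^ 2) ≤ 1 / y ^ 2 := mul_le_of_le_one_left (by positivity) (by nlinarith)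
    push_cast at h6
    linarith
  have h6 : 1 / (x ^ 2 + y ^ 2) ≤ 1 / y ^ 2 :=
    one_div_le_one_div_of_le (by positivity) (by nlinarith)
  rw [hy2]
  linarith

theorem hasSum_re_neg_logDeriv_riemannZeta {σ : ℝ} (hσ : 1 < σ) (t : ℝ) :
    HasSum (fun n : ℕ => vonMangoldt n * Real.exp (-σ * Real.log n) * Real.cos (t * Real.log n))
      (-logDeriv riemannZeta (σ + t * I)).re := by
  have h2 : 1 < ((σ : ℂ) + t * I).re := by simpa using hσ
  have h3 := ArithmeticFunction.LSeries_vonMangoldt_eq_deriv_riemannZeta_div h2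
  have h4 := (ArithmeticFunction.LSeriesSummable_vonMangoldt h2).LSeriesHasSum
  rw [LSeriesHasSum, h3, neg_div] at h4
  refine (hasSum_re h4).congr_fun fun n => ?_
  rcases eq_or_ne n 0 with rfl | hn
  · simp
  rw [LSeries.term_of_ne_zero hn, div_eq_mul_inv, ← Complex.cpow_neg,
    Complex.cpow_def_of_ne_zero (by exact_mod_cast hn), re_ofReal_mul, Complex.exp_re,
    ← Complex.natCast_log]
  simp only [mul_re, mul_im, neg_re, neg_im, add_re, add_im, ofReal_re, ofReal_im, I_re, I_im]
  rw [mul_assoc, ← Real.cos_neg (t * Real.log n)]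
  congr 3 <;> ring

theorem three_four_one {σ : ℝ} (hσ : 1 < σ) (t : ℝ) :
    0 ≤ 3 * (-logDeriv riemannZeta (σ + (0 : ℝ) * I)).re +
      4 * (-logDeriv riemannZeta (σ + t * I)).re +
      (-logDeriv riemannZeta (σ + (2 * t : ℝ) * I)).re := by
  refine (((hasSum_re_neg_logDeriv_riemannZeta hσ 0).mul_left 3).add
    ((hasSum_re_neg_logDeriv_riemannZeta hσ t).mul_left 4)).add
    (hasSum_re_neg_logDeriv_riemannZeta hσ (2 * t)) |>.nonneg fun n => ?_
  have e : 2 * t * Real.log n = 2 * (t * Real.log n) := by ring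
  rw [e, Real.cos_two_mul, zero_mul, Real.cos_zero]
  have : 0 ≤ vonMangoldt n * Real.exp (-σ * Real.log n) :=
    mul_nonneg ArithmeticFunction.vonMangoldt_nonneg (Real.exp_pos _).le
  nlinarith [mul_nonneg this (sq_nonneg (Real.cos (t * Real.log n) + 1))]

theorem re_neg_logDeriv_riemannZeta_le {σ t : ℝ} (hσ : 1 < σ) (hσ2 : σ ≤ 2) (ht : t ≠ 0)
    (T : Finset XiZero) :
    (-logDeriv riemannZeta (σ + t * I)).re ≤ Real.log |t| / 2 - Real.log 2 / 2
      - Real.log Real.pi / 2 + 5 / t ^ 2 + Real.pi / (4 * |t|)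
      - ∑ ρ ∈ T, (1 / ((σ : ℂ) + t * I - ρ)).re := by
  have h1 : 1 < ((σ : ℂ) + t * I).re := by simpa using hσ
  have h2 := XiZero.sum_re_inv_sub_le h1.le T
  rw [neg_logDeriv_riemannZeta h1]
  have e : (σ + t * I) / 2 = ((σ / 2 : ℝ) : ℂ) + (t / 2 : ℝ) * I := by push_cast; ring
  have h3 := re_digamma_le (w := ((σ / 2 : ℝ) : ℂ) + (t / 2 : ℝ) * I) (by simp; linarith)
    (by simp; linarith) (by simpa using ht)
  rw [← e] at h3
  have e2 : ((σ + t * I) / 2).im = t / 2 := by rw [e]; simp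
  rw [e2] at h3
  have ht0 : 0 < |t| := abs_pos.2 ht
  have ht2 : 0 < t ^ 2 := by positivity
  have h4 : Real.log |t / 2| = Real.log |t| - Real.log 2 := by
    rw [abs_div, Nat.abs_ofNat, Real.log_div ht0.ne' (by norm_num)]
  have h5 : (1 / ((σ : ℂ) + t * I - 1)).re ≤ 1 / t ^ 2 := by
    rw [one_div, inv_re, normSq_apply]
    simp only [sub_re, add_re, ofReal_re, mul_re, I_re, mul_zero, ofReal_im, I_im, mul_one,
      sub_self, add_zero, one_re, sub_im, add_im, mul_im, zero_add, one_im, sub_zero]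
    apply div_le_div₀ <;> nlinarith
  have h6 : (1 / ((σ : ℂ) + t * I)).re ≤ 2 / t ^ 2 := by
    rw [one_div, inv_re, normSq_apply]
    simp only [add_re, ofReal_re, mul_re, I_re, mul_zero, ofReal_im, I_im, mul_one,
      sub_self, add_zero, add_im, mul_im, zero_add]
    apply div_le_div₀ <;> nlinarith
  have h7 : Real.pi / (4 * |t / 2|) = 2 * (Real.pi / (4 * |t|)) := by
    rw [abs_div, Nat.abs_ofNat]
    field_simp
  have h8 : 1 / (t / 2) ^ 2 = 2 * (2 / t ^ 2) := by field_simp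
  have h9 : 5 / t ^ 2 = 1 / t ^ 2 + 2 / t ^ 2 + 2 / t ^ 2 := by ring
  have h10 : (digamma ((σ + t * I) / 2) / 2).re = (digamma ((σ + t * I) / 2)).re / 2 := by
    rw [← ofReal_ofNat, div_ofReal_re]
  have h11 : ((Real.log Real.pi : ℂ) / 2).re = Real.log Real.pi / 2 := by
    rw [← ofReal_ofNat, div_ofReal_re, ofReal_re]
  rw [sub_re, add_re, sub_re, add_re, h10, h11]
  rw [h4, h7, h8] at h3
  linarith

theorem neg_logDeriv_riemannZeta_le {σ : ℝ} (hσ : 1 < σ) (hσ2 : σ ≤ 2) :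
    (-logDeriv riemannZeta (σ + (0 : ℝ) * I)).re ≤ 1 / (σ - 1) +
      (1 - Real.eulerMascheroniConstant) / 2 - Real.log Real.pi / 2 := by
  have h1 : 1 < ((σ : ℂ) + (0 : ℝ) * I).re := by simpa using hσ
  have h2 := XiZero.sum_re_inv_sub_le h1.le ∅
  rw [neg_logDeriv_riemannZeta h1]
  simp only [ofReal_zero, zero_mul, add_zero, Finset.sum_empty] at h2 ⊢
  have hpos : 0 < ((σ : ℂ) / 2).re := by simp; linarith
  have h3 := digamma_apply_add_one ((σ : ℂ) / 2) (ne_neg_nat_of_re_pos hpos)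
  have h4 := digamma_apply_add_one (1 : ℂ) (ne_neg_nat_of_re_pos (by simp))
  rw [digamma_one] at h4
  have h5 := monotoneOn_re_digamma (show σ / 2 + 1 ∈ Ioi (0 : ℝ) by simp; linarith)
    (show (2 : ℝ) ∈ Ioi (0 : ℝ) by simp) (show σ / 2 + 1 ≤ 2 by linarith)
  simp only at h5
  have e1 : ((σ / 2 + 1 : ℝ) : ℂ) = (σ : ℂ) / 2 + 1 := by push_cast; ring
  have e2 : ((2 : ℝ) : ℂ) = 1 + 1 := by norm_num
  rw [e1, e2, h3, h4] at h5
  have h10 : (digamma ((σ : ℂ) / 2) / 2).re = (digamma ((σ : ℂ) / 2)).re / 2 := by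
    rw [← ofReal_ofNat, div_ofReal_re]
  have h11 : ((Real.log Real.pi : ℂ) / 2).re = Real.log Real.pi / 2 := by
    rw [← ofReal_ofNat, div_ofReal_re, ofReal_re]
  have h12 : (1 / (σ : ℂ)).re = 1 / σ := by
    rw [← ofReal_one, ← ofReal_div, ofReal_re]
  have h13 : (1 / ((σ : ℂ) - 1)).re = 1 / (σ - 1) := by
    rw [← ofReal_one, ← ofReal_sub, ← ofReal_div, ofReal_re]
  have h14 : (((σ : ℂ) / 2)⁻¹).re = 2 * (1 / σ) := by
    have : ((σ : ℂ) / 2)⁻¹ = ((2 * (1 / σ) : ℝ) : ℂ) := by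
      push_cast
      rw [inv_div]
      ring
    rw [this, ofReal_re]
  rw [sub_re, add_re, sub_re, add_re, h10, h11, h12, h13]
  rw [add_re, h14, add_re] at h5
  simp at h5
  have : σ⁻¹ = 1 / σ := by ring
  rw [this] at h5
  linarith

theorem XiZero.zero_free (ρ : XiZero) :
    1 / 6 ≤ 1 - ρ.1.re ∨ 1 / (14 * (1 - ρ.1.re)) ≤ 2.5 * Real.log |ρ.1.im| - 4.2 := by
  rcases le_or_gt (1 / 6) (1 - ρ.1.re) with h | h
  · exact Or.inl h
  refine Or.inr ?_
  have h0 := ρ.re_lt_one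
  obtain ⟨η, hη⟩ : ∃ η, η = 1 - ρ.1.re := ⟨_, rfl⟩
  rw [← hη] at h ⊢
  have hη0 : 0 < η := by linarith
  set t := ρ.1.im with ht
  have ht0 : t ≠ 0 := ρ.im_ne_zero
  have h341 := three_four_one (σ := 1 + 6 * η) (by linarith) t
  have b0 := neg_logDeriv_riemannZeta_le (σ := 1 + 6 * η) (by linarith) (by linarith)
  have b1 := re_neg_logDeriv_riemannZeta_le (σ := 1 + 6 * η) (by linarith) (by linarith) ht0 {ρ}
  have b2 := re_neg_logDeriv_riemannZeta_le (σ := 1 + 6 * η) (t := 2 * t) (by linarith)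
    (by linarith) (by simpa using ht0) ∅
  have e1 : (((1 + 6 * η : ℝ) : ℂ) + t * I - ρ) = ((7 * η : ℝ) : ℂ) := by
    apply Complex.ext
    · simp; rw [show (ρ : ℂ).re = 1 - η by linarith]; ring
    · simp [ht]
  rw [Finset.sum_singleton, e1, ← ofReal_one, ← ofReal_div, ofReal_re] at b1
  have habs : 0 < |t| := abs_pos.2 ht0
  have e2 : Real.log |2 * t| = Real.log 2 + Real.log |t| := by
    rw [abs_mul, Nat.abs_ofNat, Real.log_mul (by norm_num) habs.ne']
  rw [Finset.sum_empty, e2, abs_mul, Nat.abs_ofNat] at b2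
  have ht6 := ρ.lt_abs_im
  have ht42 := ρ.lt_im_sq
  rw [← ht] at ht6 ht42
  have c1 : 5 / t ^ 2 ≤ 0.11905 := by
    rw [div_le_iff₀ (by linarith)]
    linarith
  have c2 : 5 / (2 * t) ^ 2 ≤ 0.02977 := by
    rw [div_le_iff₀ (by nlinarith)]
    nlinarith
  have hpi := Real.pi_lt_d4
  have c3 : Real.pi / (4 * |t|) ≤ 0.12121 := by
    rw [div_le_iff₀ (by linarith)]
    linarith
  have c4 : Real.pi / (4 * (2 * |t|)) ≤ 0.06061 := by
    rw [div_le_iff₀ (by linarith)]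
    linarith
  have c5 := log_four_pi_gt
  have c6 : Real.log (4 * Real.pi) = 2 * Real.log 2 + Real.log Real.pi := by
    rw [Real.log_mul (by norm_num) Real.pi_pos.ne', show (4 : ℝ) = 2 ^ 2 by norm_num, Real.log_pow]
    norm_num
  have c7 := Real.log_two_lt_d9
  have c7' := Real.log_two_gt_d9
  have c8 := eulerMascheroniConstant_gt
  have e3 : 1 / (1 + 6 * η - 1) = 1 / η * (1 / 6) := by
    rw [add_sub_cancel_left]; field_simp
  have e4 : 1 / (7 * η) = 1 / η * (1 / 7) := by field_simp
  have e5 : 1 / (14 * η) = 1 / η * (1 / 14) := by field_simp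
  rw [e3] at b0
  rw [e4] at b1
  rw [e5]
  linarith

theorem exp_neg_div_le_of_im {η v t : ℝ} (hη : 0 < η) (hv : 0 ≤ v) (ht : 6.48 < t)
    (h : 1 / 6 ≤ η ∨ 1 / (14 * η) ≤ 2.5 * Real.log t - 4.2) :
    Real.exp (-η * v) / t ≤ Real.exp (-1.68 - 0.338 * √v) := by
  have ht0 : 0 < t := by linarith
  obtain ⟨x, hx0, rfl⟩ : ∃ x : ℝ, 0 ≤ x ∧ v = x ^ 2 := ⟨√v, Real.sqrt_nonneg v, (Real.sq_sqrt hv).symm⟩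
  rw [Real.sqrt_sq hx0]
  rw [div_eq_mul_inv, ← Real.exp_log (inv_pos.2 ht0), Real.log_inv, ← Real.exp_add, Real.exp_le_exp]
  rcases h with h | h
  · have h1 : (1.86 : ℝ) ≤ Real.log t := by
      rw [Real.le_log_iff_exp_le ht0]
      have h2 : Real.exp 1.86 = Real.exp 1 ^ 2 / Real.exp 0.14 := by
        rw [← Real.exp_nat_mul, ← Real.exp_sub]; norm_num
      have h3 := Real.exp_one_lt_d9
      have h4 : 1 + 0.14 + 0.14 ^ 2 / 2 ≤ Real.exp (0.14 : ℝ) :=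
        Real.quadratic_le_exp_of_nonneg (by norm_num)
      rw [h2, div_le_iff₀ (Real.exp_pos _)]
      nlinarith [Real.exp_pos 1]
    nlinarith [sq_nonneg (x - 1.014), mul_le_mul_of_nonneg_right h (sq_nonneg x)]
  · have h1 : 0.338 * x ≤ η * x ^ 2 + 1 / (14 * η) / 2.5 := by
      have e : η * x ^ 2 + 1 / (14 * η) / 2.5 - 0.338 * x =
          ((η * x) ^ 2 * 35 - 0.338 * 35 * (η * x) + 1) / (35 * η) := by
        field_simp
        ring
      have : 0 ≤ ((η * x) ^ 2 * 35 - 0.338 * 35 * (η * x) + 1) / (35 * η) := by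
        apply div_nonneg _ (by positivity)
        nlinarith [sq_nonneg (η * x - 0.169)]
      linarith
    have h2 : 1 / (14 * η) / 2.5 ≤ Real.log t - 1.68 := by
      rw [div_le_iff₀ (by norm_num)]
      linarith
    rw [neg_mul]
    linarith

theorem XiZero.exp_add_exp_div_le (ρ : XiZero) {v : ℝ} (hv : 0 ≤ v) :
    (Real.exp (-(1 - ρ.1.re) * v) + Real.exp (-ρ.1.re * v)) / |ρ.1.im| ≤
      Real.exp (-1.68 - 0.338 * √v) + Real.exp (-v / 2) / 6.48 := by
  have key : ∀ ρ : XiZero, 1 / 2 ≤ ρ.1.re →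
      (Real.exp (-(1 - ρ.1.re) * v) + Real.exp (-ρ.1.re * v)) / |ρ.1.im| ≤
      Real.exp (-1.68 - 0.338 * √v) + Real.exp (-v / 2) / 6.48 := by
    intro ρ h
    rw [add_div]
    refine add_le_add (exp_neg_div_le_of_im (by linarith [ρ.re_lt_one]) hv ρ.lt_abs_im ρ.zero_free) ?_
    have := ρ.lt_abs_im
    gcongr
    nlinarith
  rcases le_total (1 / 2) ρ.1.re with h | h
  · exact key ρ h
  · have := key (reflect ρ) (by simp; linarith)
    simp only [reflect_coe, sub_re, one_re, sub_sub_cancel, sub_im, one_im, zero_sub, abs_neg] at this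
    rwa [add_comm (Real.exp _)] at this

/-- An upper bound for `|mangoldtErrorTail v|`. -/
noncomputable def tailBound (v : ℝ) : ℝ :=
  2 * Real.exp (-v) + 0.0234 * (Real.exp (-1.68 - 0.338 * √v) + Real.exp (-v / 2) / 6.48)

theorem abs_mangoldtErrorTail_le_tailBound {v : ℝ} (hv : 0 ≤ v) :
    |mangoldtErrorTail v| ≤ tailBound v :=
  abs_mangoldtErrorTail_le hv (by positivity) fun ρ => ρ.exp_add_exp_div_le hv

theorem tailBound_nonneg (v : ℝ) : 0 ≤ tailBound v := by
  unfold tailBound; positivity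

theorem antitone_tailBound : Antitone tailBound := by
  intro a b h
  unfold tailBound
  have := Real.sqrt_le_sqrt h
  gcongr

theorem log_geom_sum_le {x : ℝ} (hx0 : 0 ≤ x) (hx1 : x < 1) (a : ℕ) :
    Real.log ((1 - x ^ (a + 1)) / (1 - x)) ≤ ∑ k ∈ Finset.range a, x ^ (k + 1) / ((k : ℝ) + 1) := by
  have key : MonotoneOn (fun x : ℝ => ∑ k ∈ Finset.range a, x ^ (k + 1) / ((k : ℝ) + 1) -
      (Real.log (1 - x ^ (a + 1)) - Real.log (1 - x))) (Ico 0 1) := by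
    have hd : ∀ x ∈ Ico (0 : ℝ) 1, HasDerivAt (fun x : ℝ => ∑ k ∈ Finset.range a,
        x ^ (k + 1) / ((k : ℝ) + 1) - (Real.log (1 - x ^ (a + 1)) - Real.log (1 - x)))
        (∑ k ∈ Finset.range a, x ^ k - (-((a + 1 : ℕ) * x ^ a) / (1 - x ^ (a + 1)) -
          (-1) / (1 - x))) x := by
      intro x hx
      have h1 : x ^ (a + 1) < 1 := pow_lt_one₀ hx.1 hx.2 (by omega)
      refine HasDerivAt.sub ?_ (HasDerivAt.sub ?_ ?_)
      · refine HasDerivAt.fun_sum fun k _ => ?_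
        refine ((hasDerivAt_pow (k + 1) x).div_const _).congr_deriv ?_
        have : (k : ℝ) + 1 ≠ 0 := by positivity
        push_cast
        field_simp
      · exact (((hasDerivAt_pow (a + 1) x).const_sub 1).log (by linarith)).congr_deriv (by simp)
      · exact ((hasDerivAt_id x).const_sub 1).log (by simp; linarith [hx.2])
    refine monotoneOn_of_deriv_nonneg (convex_Ico 0 1)
      (fun x hx => (hd x hx).continuousAt.continuousWithinAt)
      (fun x hx => (hd x (interior_subset hx)).differentiableAt.differentiableWithinAt) ?_
    intro x hx
    have hx' := interior_subset hx
    rw [(hd x hx').deriv]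
    have h1 : x ^ (a + 1) < 1 := pow_lt_one₀ hx'.1 hx'.2 (by omega)
    have h2 : 0 < 1 - x := by linarith [hx'.2]
    have h3 : 0 < 1 - x ^ (a + 1) := by linarith
    rw [geom_sum_eq (by linarith)]
    have h4 : 1 - x ^ (a + 1) ≤ (a + 1 : ℕ) * (1 - x) := by
      have := one_add_mul_le_pow (a := x - 1) (by linarith [hx'.1]) (a + 1)
      rw [add_sub_cancel] at this
      linarith
    have e : (x ^ a - 1) / (x - 1) - (-((a + 1 : ℕ) * x ^ a) / (1 - x ^ (a + 1)) - (-1) / (1 - x)) =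
        x ^ a * (((a + 1 : ℕ) * (1 - x) - (1 - x ^ (a + 1))) / ((1 - x ^ (a + 1)) * (1 - x))) := by
      have : x - 1 ≠ 0 := by linarith
      have h5 := h2.ne'
      have h6 := h3.ne'
      field_simp
      ring
    rw [e]
    exact mul_nonneg (pow_nonneg hx'.1 _) (div_nonneg (by linarith) (by positivity))
  have := key ⟨le_rfl, one_pos⟩ ⟨hx0, hx1⟩ hx0
  have h1 : x ^ (a + 1) < 1 := pow_lt_one₀ hx0 hx1 (by omega)
  rw [Real.log_div (by linarith) (by linarith)]
  simp at this
  linarith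

theorem log_sigma_div_le (n : ℕ) : Real.log ((ArithmeticFunction.sigma 1 n : ℝ) / n) ≤
    ∑ m ∈ n.divisors, vonMangoldt m / (m * Real.log m) := by
  refine Nat.recOnPrimeCoprime ?_ ?_ ?_ n
  · simp
  · intro p k hp
    have hp1 : (1 : ℝ) < p := by exact_mod_cast hp.one_lt
    have hp0 : (p : ℝ) ≠ 0 := by positivity
    have h1 : (ArithmeticFunction.sigma 1 (p ^ k) : ℝ) / ((p ^ k : ℕ) : ℝ) =
        (1 - ((p : ℝ)⁻¹) ^ (k + 1)) / (1 - (p : ℝ)⁻¹) := by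
      rw [ArithmeticFunction.sigma_one_apply_prime_pow hp]
      push_cast
      rw [geom_sum_eq hp1.ne']
      have : (p : ℝ) - 1 ≠ 0 := by linarith
      rw [inv_pow]
      field_simp
      ring
    rw [h1]
    refine (log_geom_sum_le (by positivity) (inv_lt_one_of_one_lt₀ hp1) k).trans_eq ?_
    rw [Nat.sum_divisors_prime_pow hp, Finset.sum_range_succ']
    simp only [pow_zero, ArithmeticFunction.vonMangoldt_apply_one, zero_div, add_zero]
    refine Finset.sum_congr rfl fun i _ => ?_
    rw [ArithmeticFunction.vonMangoldt_apply_pow i.succ_ne_zero,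
      ArithmeticFunction.vonMangoldt_apply_prime hp]
    have := Real.log_pos hp1
    push_cast
    rw [Real.log_pow, inv_pow]
    push_cast
    field_simp
  · intro a b ha hb hab iha ihb
    have h0 : ∀ n : ℕ, ∑ m ∈ n.divisors, vonMangoldt m / (m * Real.log m) =
        ∑ m ∈ n.divisors with IsPrimePow m, vonMangoldt m / (m * Real.log m) := by
      intro n
      rw [Finset.sum_filter]
      refine Finset.sum_congr rfl fun m _ => ?_
      split_ifs with h
      · rfl
      · rw [ArithmeticFunction.vonMangoldt_eq_zero_iff.2 h, zero_div]
    have hs : ∀ n : ℕ, 1 < n → (ArithmeticFunction.sigma 1 n : ℝ) / n ≠ 0 := by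
      intro n hn
      have : ArithmeticFunction.sigma 1 n ≠ 0 := by
        rw [Ne, ArithmeticFunction.sigma_eq_zero]; omega
      have h2 : n ≠ 0 := by omega
      positivity
    rw [h0] at iha ihb ⊢
    rw [Nat.mul_divisors_filter_prime_pow hab, Finset.filter_union,
      Finset.sum_union (Nat.disjoint_divisors_filter_isPrimePow hab),
      ArithmeticFunction.isMultiplicative_sigma.map_mul_of_coprime hab]
    push_cast
    rw [mul_div_mul_comm, Real.log_mul (hs a ha) (hs b hb)]
    exact add_le_add iha ihb

/-- The weight `Λ m / (m log m)`. -/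
noncomputable def mangoldtWeight (m : ℕ) : ℝ := vonMangoldt m / (m * Real.log m)

theorem mangoldtWeight_nonneg (m : ℕ) : 0 ≤ mangoldtWeight m :=
  div_nonneg ArithmeticFunction.vonMangoldt_nonneg (mul_nonneg (by positivity) (Real.log_natCast_nonneg m))

/-- The sum of `Λ m (1 / (m log m) - 1 / (e ^ v v))` over `m ≤ e ^ v`. -/
noncomputable def mangoldtWeightSum (v : ℝ) : ℝ :=
  ∑ m ∈ Finset.Icc 1 ⌊Real.exp v⌋₊, (mangoldtWeight m - vonMangoldt m * (Real.exp (-v) / v))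

theorem mangoldtWeight_sub_nonneg {v : ℝ} {m : ℕ} (hv : 0 < v) (hm : m ≤ Real.exp v) :
    0 ≤ mangoldtWeight m - vonMangoldt m * (Real.exp (-v) / v) := by
  rcases lt_or_ge m 2 with h | h
  · interval_cases m <;> simp [mangoldtWeight]
  have hm1 : (1 : ℝ) < m := by exact_mod_cast h
  have hl := Real.log_pos hm1
  have hl2 : Real.log m ≤ v := by rwa [Real.log_le_iff_le_exp (by positivity)]
  rw [sub_nonneg, mangoldtWeight, div_eq_mul_inv, Real.exp_neg, div_eq_mul_inv, ← mul_inv]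
  refine mul_le_mul_of_nonneg_left ?_ ArithmeticFunction.vonMangoldt_nonneg
  gcongr

theorem mangoldtWeight_sub_nonpos {v : ℝ} {m : ℕ} (hv : 0 < v) (hm : Real.exp v ≤ m) :
    mangoldtWeight m - vonMangoldt m * (Real.exp (-v) / v) ≤ 0 := by
  have hm0 : (0 : ℝ) < m := (Real.exp_pos v).trans_le hm
  have hl2 : v ≤ Real.log m := by rwa [Real.le_log_iff_exp_le hm0]
  rw [sub_nonpos, mangoldtWeight, div_eq_mul_inv, Real.exp_neg, div_eq_mul_inv, ← mul_inv]
  refine mul_le_mul_of_nonneg_left ?_ ArithmeticFunction.vonMangoldt_nonneg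
  gcongr

/-- Each divisor's weight is split at the threshold `x`. -/
theorem log_sigma_div_le_of_sub_nonneg (n : ℕ) {x : ℕ} {s : ℝ}
    (h1 : ∀ m ≤ x, 0 ≤ mangoldtWeight m - vonMangoldt m * s)
    (h2 : ∀ m, x < m → mangoldtWeight m - vonMangoldt m * s ≤ 0) :
    Real.log ((ArithmeticFunction.sigma 1 n : ℝ) / n) ≤
      ∑ m ∈ Finset.Icc 1 x, (mangoldtWeight m - vonMangoldt m * s) + Real.log n * s := by
  refine (log_sigma_div_le n).trans ?_
  rw [← ArithmeticFunction.vonMangoldt_sum, Finset.sum_mul, ← sub_le_iff_le_add,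
    ← Finset.sum_sub_distrib, ← Finset.sum_filter_add_sum_filter_not n.divisors (· ≤ x)]
  have h3 : ∑ m ∈ n.divisors with m ≤ x,
      (vonMangoldt m / (m * Real.log m) - vonMangoldt m * s) ≤
      ∑ m ∈ Finset.Icc 1 x, (mangoldtWeight m - vonMangoldt m * s) := by
    refine Finset.sum_le_sum_of_subset_of_nonneg ?_ fun m hm _ => ?_
    · intro m hm
      rw [Finset.mem_filter] at hm
      exact Finset.mem_Icc.2 ⟨Nat.pos_of_mem_divisors hm.1, hm.2⟩
    · exact h1 m (Finset.mem_Icc.1 hm).2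
  have h4 : ∑ m ∈ n.divisors with ¬ m ≤ x,
      (vonMangoldt m / (m * Real.log m) - vonMangoldt m * s) ≤ 0 :=
    Finset.sum_nonpos fun m hm => h2 m (not_le.1 (Finset.mem_filter.1 hm).2)
  linarith

theorem log_sigma_div_le_mangoldtWeightSum (n : ℕ) {v : ℝ} (hv : 0 < v) :
    Real.log ((ArithmeticFunction.sigma 1 n : ℝ) / n) ≤
      mangoldtWeightSum v + Real.log n * (Real.exp (-v) / v) :=
  log_sigma_div_le_of_sub_nonneg n
    (fun _ hm => mangoldtWeight_sub_nonneg hv ((Nat.le_floor_iff (Real.exp_pos v).le).1 hm))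
    (fun _ hm => mangoldtWeight_sub_nonpos hv (Nat.lt_of_floor_lt hm).le)

theorem one_le_re_riemannZeta {σ : ℝ} (hσ : 1 < σ) : 1 ≤ (riemannZeta σ).re := by
  have h1 : riemannZeta σ = ((∑' n : ℕ, 1 / (n : ℝ) ^ σ : ℝ) : ℂ) := by
    rw [zeta_eq_tsum_one_div_nat_cpow (by simpa using hσ), ofReal_tsum]
    refine tsum_congr fun n => ?_
    push_cast [ofReal_cpow (Nat.cast_nonneg n)]
    rfl
  rw [h1, ofReal_re]
  have := (Real.summable_one_div_nat_rpow.2 hσ).le_tsum 1 (fun n _ => by positivity)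
  simpa using this

theorem hasDerivAt_log_riemannZeta {σ : ℝ} (hσ : 1 < σ) :
    HasDerivAt (fun x : ℝ => Real.log (riemannZeta x).re) (logDeriv riemannZeta σ).re σ := by
  have hne : (σ : ℂ) ≠ 1 := by exact_mod_cast hσ.ne'
  have h1 := (differentiableAt_riemannZeta hne).hasDerivAt.real_of_complex.log
    (by linarith [one_le_re_riemannZeta hσ])
  refine h1.congr_deriv ?_
  have hr : riemannZeta σ = ((riemannZeta σ).re : ℂ) :=
    (conj_eq_iff_re.1 (by rw [← riemannZeta_conj, conj_ofReal])).symm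
  rw [logDeriv_apply, hr, div_ofReal_re, ofReal_re]

theorem sum_mangoldtWeight_le_log_riemannZeta {s : ℝ} (hs : 0 < s) (N : ℕ) :
    ∑ m ∈ Finset.Icc 1 N, mangoldtWeight m * Real.exp (-s * Real.log m) ≤
      Real.log (riemannZeta (1 + s : ℝ)).re := by
  set G : ℝ → ℝ := fun s => Real.log (riemannZeta (1 + s : ℝ)).re -
    ∑ m ∈ Finset.Icc 1 N, mangoldtWeight m * Real.exp (-s * Real.log m) with hG
  have hd : ∀ s : ℝ, 0 < s → HasDerivAt G ((logDeriv riemannZeta (1 + s : ℝ)).re +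
      ∑ m ∈ Finset.Icc 1 N, vonMangoldt m * Real.exp (-(1 + s) * Real.log m)) s := by
    intro s hs
    have h1 := (hasDerivAt_log_riemannZeta (σ := 1 + s) (by linarith)).comp_const_add 1 s
    have h2 : HasDerivAt (fun s : ℝ => ∑ m ∈ Finset.Icc 1 N, mangoldtWeight m *
        Real.exp (-s * Real.log m)) (-∑ m ∈ Finset.Icc 1 N,
          vonMangoldt m * Real.exp (-(1 + s) * Real.log m)) s := by
      rw [← Finset.sum_neg_distrib]
      refine HasDerivAt.fun_sum fun m hm => ?_
      have h3 : HasDerivAt (fun s : ℝ => Real.exp (-s * Real.log m))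
          (Real.exp (-s * Real.log m) * (-1 * Real.log m)) s :=
        (((hasDerivAt_id s).neg).mul_const _).exp
      refine (h3.const_mul _).congr_deriv ?_
      rcases eq_or_lt_of_le (Finset.mem_Icc.1 hm).1 with rfl | h
      · simp
      have hm1 : (1 : ℝ) < m := by exact_mod_cast h
      have hl := Real.log_pos hm1
      have e : Real.exp (-(1 + s) * Real.log m) = Real.exp (-s * Real.log m) / m := by
        rw [show -(1 + s) * Real.log m = -s * Real.log m - Real.log m by ring, Real.exp_sub,
          Real.exp_log (by linarith)]
      rw [e, mangoldtWeight]
      field_simp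
    exact (h1.sub h2).congr_deriv (by ring)
  have hanti : AntitoneOn G (Ioi 0) := by
    refine antitoneOn_of_deriv_nonpos (convex_Ioi 0)
      (fun x hx => (hd x hx).continuousAt.continuousWithinAt)
      (fun x hx => (hd x (interior_subset hx)).differentiableAt.differentiableWithinAt) ?_
    intro x hx
    have hx : 0 < x := interior_subset hx
    rw [(hd x hx).deriv]
    have h := hasSum_re_neg_logDeriv_riemannZeta (σ := 1 + x) (by linarith) 0
    have h2 := sum_le_hasSum (Finset.Icc 1 N) (fun m _ => by
      simpa using mul_nonneg ArithmeticFunction.vonMangoldt_nonneg (Real.exp_pos _).le) h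
    simp only [zero_mul, Real.cos_zero, mul_one, ofReal_zero, add_zero, neg_re] at h2
    linarith
  have hlim : Tendsto (fun s : ℝ => ∑ m ∈ Finset.Icc 1 N,
      mangoldtWeight m * Real.exp (-s * Real.log m)) atTop (𝓝 0) := by
    rw [← Finset.sum_const_zero (s := Finset.Icc 1 N) (ι := ℕ)]
    refine tendsto_finsetSum _ fun m hm => ?_
    rcases eq_or_lt_of_le (Finset.mem_Icc.1 hm).1 with rfl | h
    · simp [mangoldtWeight]
    have hl : 0 < Real.log m := Real.log_pos (by exact_mod_cast h)
    rw [← mul_zero (mangoldtWeight m)]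
    refine Tendsto.const_mul _ (Real.tendsto_exp_atBot.comp ?_)
    exact tendsto_neg_atTop_atBot.atBot_mul_const hl
  have hge : ∀ᶠ s' in atTop, -∑ m ∈ Finset.Icc 1 N,
      mangoldtWeight m * Real.exp (-s' * Real.log m) ≤ G s := by
    filter_upwards [eventually_ge_atTop s] with s' hs'
    have h1 := hanti (show s ∈ Ioi 0 from hs) (show s' ∈ Ioi 0 from hs.trans_le hs') hs'
    have h2 := Real.log_nonneg (one_le_re_riemannZeta (σ := 1 + s') (by linarith))
    simp only [hG] at h1 ⊢
    linarith
  have := le_of_tendsto hlim.neg hge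
  simp only [hG] at this
  linarith

theorem sum_Icc_ite_pow_sub_le {r : ℝ} (hr0 : 0 < r) (hr1 : r < 1) (x : ℝ) (N : ℕ) :
    ∑ j ∈ Finset.Icc 1 N, (if x ≤ j then r ^ j - r ^ (j + 1) else 0) ≤
      max (r ^ x - r ^ (N + 1)) 0 := by
  induction N with
  | zero => simp
  | succ N ih =>
    rw [Finset.sum_Icc_succ_top (by omega)]
    split_ifs with h
    · have h1 : r ^ (N + 1) ≤ r ^ x := by
        rw [← Real.rpow_natCast]
        exact Real.rpow_le_rpow_of_exponent_ge hr0 hr1.le h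
      rw [max_eq_left (by linarith)] at ih
      exact le_max_of_le_left (by linarith)
    · have h1 : r ^ x ≤ r ^ (N + 1) := by
        rw [← Real.rpow_natCast]
        exact Real.rpow_le_rpow_of_exponent_ge hr0 hr1.le (not_le.1 h).le
      rw [max_eq_right (by linarith)] at ih
      exact le_max_of_le_right (by linarith)

theorem sum_pow_sub_mul_mangoldtWeightSum_le {s : ℝ} (hs : 0 < s) (N : ℕ) :
    ∑ j ∈ Finset.Icc 1 N, (Real.exp (-s) ^ j - Real.exp (-s) ^ (j + 1)) * mangoldtWeightSum j ≤
      Real.log (riemannZeta (1 + s : ℝ)).re := by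
  set r := Real.exp (-s) with hr
  have hr0 : 0 < r := Real.exp_pos _
  have hr1 : r < 1 := by rw [hr, Real.exp_lt_one_iff]; linarith
  have hd : ∀ j : ℕ, 0 ≤ r ^ j - r ^ (j + 1) := fun j =>
    sub_nonneg.2 (pow_le_pow_of_le_one hr0.le hr1.le (Nat.le_succ j))
  calc _ ≤ ∑ j ∈ Finset.Icc 1 N, ∑ m ∈ Finset.Icc 1 ⌊Real.exp N⌋₊,
        mangoldtWeight m * (if Real.log m ≤ j then r ^ j - r ^ (j + 1) else 0) := by
        refine Finset.sum_le_sum fun j hj => ?_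
        rw [Finset.mem_Icc] at hj
        have hj0 : (0 : ℝ) < j := by exact_mod_cast hj.1
        have h1 : mangoldtWeightSum j ≤ ∑ m ∈ Finset.Icc 1 ⌊Real.exp N⌋₊,
            mangoldtWeight m * (if Real.log m ≤ j then 1 else 0) := by
          calc mangoldtWeightSum j ≤ ∑ m ∈ Finset.Icc 1 ⌊Real.exp j⌋₊,
                mangoldtWeight m * (if Real.log m ≤ j then 1 else 0) := by
                refine Finset.sum_le_sum fun m hm => ?_
                rw [Finset.mem_Icc] at hm
                have hm2 := (Nat.le_floor_iff (Real.exp_pos _).le).1 hm.2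
                have hm0 : (0 : ℝ) < m := by exact_mod_cast hm.1
                rw [if_pos ((Real.log_le_iff_le_exp hm0).2 hm2), mul_one]
                have := mul_nonneg (ArithmeticFunction.vonMangoldt_nonneg (n := m))
                  (div_nonneg (Real.exp_pos (-(j : ℝ))).le hj0.le)
                linarith
            _ ≤ _ := by
                refine Finset.sum_le_sum_of_subset_of_nonneg (Finset.Icc_subset_Icc le_rfl
                  (Nat.floor_le_floor (Real.exp_le_exp.2 (by exact_mod_cast hj.2)))) ?_
                intro m _ _
                exact mul_nonneg (mangoldtWeight_nonneg m) (by split_ifs <;> simp)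
        refine (mul_le_mul_of_nonneg_left h1 (hd j)).trans_eq ?_
        rw [Finset.mul_sum]
        refine Finset.sum_congr rfl fun m _ => ?_
        split_ifs <;> ring
    _ = ∑ m ∈ Finset.Icc 1 ⌊Real.exp N⌋₊, mangoldtWeight m *
        ∑ j ∈ Finset.Icc 1 N, (if Real.log m ≤ j then r ^ j - r ^ (j + 1) else 0) := by
        rw [Finset.sum_comm]
        simp_rw [Finset.mul_sum]
    _ ≤ ∑ m ∈ Finset.Icc 1 ⌊Real.exp N⌋₊, mangoldtWeight m * Real.exp (-s * Real.log m) := by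
        refine Finset.sum_le_sum fun m _ => ?_
        refine mul_le_mul_of_nonneg_left ?_ (mangoldtWeight_nonneg m)
        refine (sum_Icc_ite_pow_sub_le hr0 hr1 _ N).trans ?_
        have h2 : r ^ Real.log m = Real.exp (-s * Real.log m) := by
          rw [hr, ← Real.exp_mul]
        rw [h2]
        exact max_le (by linarith [pow_pos hr0 (N + 1)]) (Real.exp_pos _).le
    _ ≤ _ := sum_mangoldtWeight_le_log_riemannZeta hs _

theorem sum_pow_sub_mul_harmonic (r : ℝ) (N : ℕ) :
    ∑ j ∈ Finset.Icc 1 N, (r ^ j - r ^ (j + 1)) * (harmonic j : ℝ) =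
      ∑ k ∈ Finset.range N, r ^ (k + 1) / ((k : ℝ) + 1) - r ^ (N + 1) * harmonic N := by
  induction N with
  | zero => simp
  | succ N ih =>
    rw [Finset.sum_Icc_succ_top (by omega), ih, Finset.sum_range_succ, harmonic_succ]
    push_cast
    ring

theorem sum_pow_sub (r : ℝ) (N : ℕ) :
    ∑ j ∈ Finset.Icc 1 N, (r ^ j - r ^ (j + 1)) = r - r ^ (N + 1) := by
  induction N with
  | zero => simp
  | succ N ih => rw [Finset.sum_Icc_succ_top (by omega), ih]; ring

theorem tendsto_log_riemannZeta_add_log :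
    Tendsto (fun s : ℝ => Real.log (riemannZeta (1 + s : ℝ)).re + Real.log (1 - Real.exp (-s)))
      (𝓝[>] 0) (𝓝 0) := by
  have h1 : Tendsto (fun s : ℝ => s * (riemannZeta (1 + s : ℝ)).re) (𝓝[>] 0) (𝓝 1) := by
    have h0 : Tendsto (fun s : ℝ => ((1 + s : ℝ) : ℂ)) (𝓝[>] 0) (𝓝[≠] 1) := by
      refine tendsto_nhdsWithin_iff.2 ⟨?_, ?_⟩
      · refine tendsto_nhdsWithin_of_tendsto_nhds ?_
        have : Continuous fun s : ℝ => ((1 + s : ℝ) : ℂ) := by fun_prop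
        simpa using this.tendsto 0
      · filter_upwards [self_mem_nhdsWithin] with s hs
        have hs : 0 < s := hs
        rw [mem_compl_singleton_iff]
        exact_mod_cast (by linarith : 1 + s ≠ 1)
    have := (continuous_re.tendsto _).comp (riemannZeta_residue_one.comp h0)
    refine this.congr fun s => ?_
    simp only [Function.comp_apply]
    rw [show ((1 + s : ℝ) : ℂ) - 1 = (s : ℂ) by push_cast; ring, re_ofReal_mul]
  have h2 : Tendsto (fun s : ℝ => (1 - Real.exp (-s)) / s) (𝓝[>] 0) (𝓝 1) := by
    have hd : HasDerivAt (fun s : ℝ => 1 - Real.exp (-s)) 1 0 :=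
      ((hasDerivAt_neg (0 : ℝ)).exp.const_sub 1).congr_deriv (by simp)
    have := (hasDerivAt_iff_tendsto_slope.1 hd).mono_left
      (nhdsWithin_mono 0 (fun x (hx : 0 < x) => hx.ne'))
    refine this.congr fun s => ?_
    rw [slope_def_field]; simp
  have h3 := ((h1.mul h2).log (by norm_num))
  rw [mul_one, Real.log_one] at h3
  refine h3.congr' ?_
  filter_upwards [self_mem_nhdsWithin] with s hs
  have hs : 0 < s := hs
  have hz := one_le_re_riemannZeta (σ := 1 + s) (by linarith)
  have he : Real.exp (-s) < 1 := by rw [Real.exp_lt_one_iff]; linarith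
  rw [← Real.log_mul (by linarith) (by linarith)]
  congr 1
  field_simp

theorem not_eventually_harmonic_add_le {ε : ℝ} (hε : 0 < ε) :
    ¬ ∀ᶠ j : ℕ in atTop, (harmonic j : ℝ) + ε ≤ mangoldtWeightSum j := by
  intro h
  obtain ⟨J, hJ⟩ := eventually_atTop.1 h
  set M : ℝ := harmonic J + ε with hM
  have hM0 : 0 ≤ M := by
    have : (0 : ℚ) ≤ harmonic J := Finset.sum_nonneg fun i _ => by positivity
    have : (0 : ℝ) ≤ harmonic J := by exact_mod_cast this
    linarith
  have hSge : ∀ j : ℕ, 1 ≤ j →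
      (harmonic j : ℝ) + ε - (if j < J then M else 0) ≤ mangoldtWeightSum j := by
    intro j hj
    split_ifs with h
    · have h1 : (harmonic j : ℝ) ≤ harmonic J := by
        have : harmonic j ≤ harmonic J :=
          Finset.sum_le_sum_of_subset_of_nonneg (Finset.range_mono h.le) fun i _ _ => by positivity
        exact_mod_cast this
      have h2 : 0 ≤ mangoldtWeightSum j := Finset.sum_nonneg fun m hm =>
        mangoldtWeight_sub_nonneg (by exact_mod_cast hj)
          ((Nat.le_floor_iff (Real.exp_pos _).le).1 (Finset.mem_Icc.1 hm).2)
      linarith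
    · rw [sub_zero]; exact hJ j (not_lt.1 h)
  have key : ∀ s : ℝ, 0 < s → ε * Real.exp (-s) - M * (1 - Real.exp (-s) ^ (J + 1)) ≤
      Real.log (riemannZeta (1 + s : ℝ)).re + Real.log (1 - Real.exp (-s)) := by
    intro s hs
    set r := Real.exp (-s) with hr
    have hr0 : 0 < r := Real.exp_pos _
    have hr1 : r < 1 := by rw [hr, Real.exp_lt_one_iff]; linarith
    have hd : ∀ j : ℕ, 0 ≤ r ^ j - r ^ (j + 1) := fun j =>
      sub_nonneg.2 (pow_le_pow_of_le_one hr0.le hr1.le (Nat.le_succ j))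
    have hN : ∀ N : ℕ, J ≤ N → ∑ k ∈ Finset.range N, r ^ (k + 1) / ((k : ℝ) + 1) -
        r ^ (N + 1) * harmonic N + ε * (r - r ^ (N + 1)) - M * (1 - r ^ (J + 1)) ≤
        Real.log (riemannZeta (1 + s : ℝ)).re := by
      intro N hJN
      refine le_trans ?_ (sum_pow_sub_mul_mangoldtWeightSum_le hs N)
      have h1 : ∑ j ∈ Finset.Icc 1 N, (r ^ j - r ^ (j + 1)) *
          ((harmonic j : ℝ) + ε - (if j < J then M else 0)) ≤
          ∑ j ∈ Finset.Icc 1 N, (r ^ j - r ^ (j + 1)) * mangoldtWeightSum j :=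
        Finset.sum_le_sum fun j hj =>
          mul_le_mul_of_nonneg_left (hSge j (Finset.mem_Icc.1 hj).1) (hd j)
      refine le_trans ?_ h1
      have h2 : ∑ j ∈ Finset.Icc 1 N, (r ^ j - r ^ (j + 1)) * (if j < J then M else 0) ≤
          M * (1 - r ^ (J + 1)) := by
        have h3 : ∑ j ∈ Finset.Icc 1 N, (r ^ j - r ^ (j + 1)) * (if j < J then M else 0) ≤
            ∑ j ∈ Finset.Icc 1 J, (r ^ j - r ^ (j + 1)) * M := by
          calc _ = ∑ j ∈ Finset.Icc 1 N with j < J, (r ^ j - r ^ (j + 1)) * M := by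
                rw [Finset.sum_filter]
                refine Finset.sum_congr rfl fun j _ => ?_
                split_ifs <;> simp
            _ ≤ _ := by
                refine Finset.sum_le_sum_of_subset_of_nonneg ?_ fun j _ _ => mul_nonneg (hd j) hM0
                intro j hj
                simp only [Finset.mem_filter, Finset.mem_Icc] at hj ⊢
                omega
        rw [← Finset.sum_mul, sum_pow_sub] at h3
        nlinarith
      simp_rw [mul_sub, mul_add]
      rw [Finset.sum_sub_distrib, Finset.sum_add_distrib, sum_pow_sub_mul_harmonic,
        ← Finset.sum_mul, sum_pow_sub]
      linarith
    have hl1 : Tendsto (fun N : ℕ => ∑ k ∈ Finset.range N, r ^ (k + 1) / ((k : ℝ) + 1)) atTop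
        (𝓝 (-Real.log (1 - r))) :=
      (Real.hasSum_pow_div_log_of_abs_lt_one (by rwa [abs_of_pos hr0])).tendsto_sum_nat
    have hl2 : Tendsto (fun N : ℕ => r ^ (N + 1)) atTop (𝓝 0) :=
      (tendsto_pow_atTop_nhds_zero_of_lt_one hr0.le hr1).comp (tendsto_add_atTop_nat 1)
    have hl3 : Tendsto (fun N : ℕ => r ^ (N + 1) * (harmonic N : ℝ)) atTop (𝓝 0) := by
      have h4 := (tendsto_self_mul_const_pow_of_lt_one hr0.le hr1).const_mul r
      rw [mul_zero] at h4
      refine squeeze_zero (fun N => ?_) (fun N => ?_) h4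
      · have : (0 : ℚ) ≤ harmonic N := Finset.sum_nonneg fun i _ => by positivity
        have : (0 : ℝ) ≤ harmonic N := by exact_mod_cast this
        positivity
      · have : harmonic N ≤ N := by
          calc harmonic N ≤ ∑ i ∈ Finset.range N, (1 : ℚ) :=
                Finset.sum_le_sum fun i _ => inv_le_one_of_one_le₀ (by simp)
            _ = N := by simp
        have : (harmonic N : ℝ) ≤ N := by exact_mod_cast this
        have h5 := mul_le_mul_of_nonneg_left this (pow_nonneg hr0.le (N + 1))
        refine h5.trans_eq (by ring)
    have := le_of_tendsto (((hl1.sub hl3).add ((hl2.const_sub r).const_mul ε)).sub_const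
      (M * (1 - r ^ (J + 1)))) (eventually_atTop.2 ⟨J, hN⟩)
    simp only [sub_zero] at this
    linarith
  have hlim : Tendsto (fun s : ℝ => ε * Real.exp (-s) - M * (1 - Real.exp (-s) ^ (J + 1)))
      (𝓝[>] 0) (𝓝 ε) := by
    refine tendsto_nhdsWithin_of_tendsto_nhds ?_
    have : Continuous fun s : ℝ => ε * Real.exp (-s) - M * (1 - Real.exp (-s) ^ (J + 1)) := by
      fun_prop
    simpa using this.tendsto 0
  have := le_of_tendsto_of_tendsto hlim tendsto_log_riemannZeta_add_log
    (by filter_upwards [self_mem_nhdsWithin] with s hs using key s hs)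
  linarith

theorem hasDerivAt_tailWeight {v : ℝ} (hv : v ≠ 0) :
    HasDerivAt (fun v : ℝ => 1 / v + 1 / v ^ 2) (-(1 / v ^ 2 + 2 / v ^ 3)) v := by
  have h1 := (hasDerivAt_inv hv).add ((hasDerivAt_pow 2 v).inv (pow_ne_zero 2 hv))
  simp only [one_div]
  refine h1.congr_deriv ?_
  push_cast
  field_simp
  ring

theorem hasDerivAt_deriv_tailWeight {v : ℝ} (hv : v ≠ 0) :
    HasDerivAt (fun v : ℝ => -(1 / v ^ 2 + 2 / v ^ 3)) (2 / v ^ 3 + 6 / v ^ 4) v := by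
  have h1 := (((hasDerivAt_pow 2 v).inv (pow_ne_zero 2 hv)).add
    (((hasDerivAt_pow 3 v).inv (pow_ne_zero 3 hv)).const_mul 2)).neg
  simp only [one_div, div_eq_mul_inv (2 : ℝ)]
  refine h1.congr_deriv ?_
  push_cast
  field_simp
  ring

theorem hasDerivAt_weight_term {v : ℝ} (hv : v ≠ 0) (m : ℕ) :
    HasDerivAt (fun v : ℝ => mangoldtWeight m - vonMangoldt m * (Real.exp (-v) / v) -
      (1 / v + 1 / v ^ 2) * (vonMangoldt m * (1 / m - Real.exp (-v))))
      ((1 / v ^ 2 + 2 / v ^ 3) * (vonMangoldt m * (1 / m - Real.exp (-v)))) v := by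
  have he : HasDerivAt (fun v : ℝ => Real.exp (-v)) (-Real.exp (-v)) v := by
    simpa using (hasDerivAt_neg v).exp
  have h1 := (((he.div (hasDerivAt_id v) hv).const_mul (vonMangoldt m)).const_sub
    (mangoldtWeight m)).sub ((hasDerivAt_tailWeight hv).mul
      ((he.const_sub (1 / (m : ℝ))).const_mul (vonMangoldt m)))
  refine h1.congr_deriv ?_
  simp only [id]
  field_simp
  ring

theorem weight_term_eq_zero {m : ℕ} {v : ℝ} (hv : v ≠ 0) (h : (m : ℝ) = Real.exp v) :
    mangoldtWeight m - vonMangoldt m * (Real.exp (-v) / v) -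
      (1 / v + 1 / v ^ 2) * (vonMangoldt m * (1 / m - Real.exp (-v))) = 0 := by
  have h2 : (1 : ℝ) / m = Real.exp (-v) := by rw [h, Real.exp_neg, one_div]
  rw [h2, sub_self, mul_zero, mul_zero, sub_zero, mangoldtWeight, h, Real.log_exp, Real.exp_neg]
  have := Real.exp_pos v
  field_simp
  ring

theorem hasDerivAt_ite_weight_term {v : ℝ} (hv : v ≠ 0) {m : ℕ} (hm : 1 ≤ m) :
    HasDerivAt (fun v : ℝ => if (m : ℝ) ≤ Real.exp v then mangoldtWeight m -
      vonMangoldt m * (Real.exp (-v) / v) -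
      (1 / v + 1 / v ^ 2) * (vonMangoldt m * (1 / m - Real.exp (-v))) else 0)
      ((1 / v ^ 2 + 2 / v ^ 3) * (vonMangoldt m * max (1 / m - Real.exp (-v)) 0)) v := by
  have hg := hasDerivAt_weight_term hv m
  have hiff := le_exp_iff_inv (m := m) (by omega) v
  rcases lt_trichotomy (m : ℝ) (Real.exp v) with h | h | h
  · rw [max_eq_left (hiff.1 h.le)]
    refine hg.congr_of_eventuallyEq ?_
    filter_upwards [Real.continuous_exp.continuousAt.eventually (lt_mem_nhds h)] with x hx
    rw [if_pos (le_of_lt hx)]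
  · have h2 : (1 : ℝ) / m = Real.exp (-v) := by rw [h, Real.exp_neg, one_div]
    have h3 : (1 : ℝ) / m - Real.exp (-v) = 0 := by rw [h2, sub_self]
    rw [h3, mul_zero, mul_zero] at hg
    rw [h3, max_self, mul_zero, mul_zero]
    have hu : HasDerivWithinAt (fun v : ℝ => if (m : ℝ) ≤ Real.exp v then mangoldtWeight m -
        vonMangoldt m * (Real.exp (-v) / v) -
        (1 / v + 1 / v ^ 2) * (vonMangoldt m * (1 / m - Real.exp (-v))) else 0) 0
        (Iic v ∪ Ici v) v := by
      refine HasDerivWithinAt.union ?_ ?_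
      · refine (hasDerivWithinAt_const v (Iic v) (0 : ℝ)).congr (fun x hx => ?_) ?_
        · split_ifs with hc
          · have : x = v := by
              refine le_antisymm hx ?_
              rwa [h, Real.exp_le_exp] at hc
            rw [this]
            exact weight_term_eq_zero hv h
          · rfl
        · rw [if_pos h.le]
          exact weight_term_eq_zero hv h
      · refine hg.hasDerivWithinAt.congr (fun x hx => ?_) ?_
        · exact if_pos (h.le.trans (Real.exp_le_exp.2 hx))
        · exact if_pos h.le
    rwa [Iic_union_Ici, hasDerivWithinAt_univ] at hu
  · rw [max_eq_right (not_lt.1 fun hc => absurd (hiff.2 hc.le) (not_le.2 h)), mul_zero, mul_zero]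
    refine (hasDerivAt_const v (0 : ℝ)).congr_of_eventuallyEq ?_
    filter_upwards [Real.continuous_exp.continuousAt.eventually (gt_mem_nhds h)] with x hx
    rw [if_neg (not_le.2 hx)]

theorem hasDerivAt_mangoldtWeightSum_sub {v : ℝ} (hv : v ≠ 0) :
    HasDerivAt (fun v => mangoldtWeightSum v - (1 / v + 1 / v ^ 2) * mangoldtSum v)
      ((1 / v ^ 2 + 2 / v ^ 3) * mangoldtSum v) v := by
  obtain ⟨N, hN⟩ := exists_nat_ge (Real.exp (v + 1))
  have hvN : Real.exp v ≤ N := (Real.exp_le_exp.2 (by linarith)).trans hN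
  rw [mangoldtSum_eq hvN, Finset.mul_sum]
  have h := HasDerivAt.fun_sum (u := Finset.Icc 1 N) fun m hm =>
    hasDerivAt_ite_weight_term hv (Finset.mem_Icc.1 hm).1
  refine h.congr_of_eventuallyEq ?_
  filter_upwards [gt_mem_nhds (lt_add_one v)] with x hx
  have hxN : Real.exp x ≤ N := (Real.exp_le_exp.2 (le_of_lt hx)).trans hN
  rw [mangoldtWeightSum, mangoldtSum, Finset.mul_sum, ← Finset.sum_sub_distrib,
    ← Finset.sum_filter]
  refine Finset.sum_congr ?_ fun m _ => rfl
  ext m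
  rw [Finset.mem_filter, Finset.mem_Icc, Finset.mem_Icc, Nat.le_floor_iff (Real.exp_pos x).le]
  constructor
  · rintro ⟨h1, h2⟩
    exact ⟨⟨h1, by exact_mod_cast h2.trans hxN⟩, h2⟩
  · rintro ⟨⟨h1, _⟩, h2⟩
    exact ⟨h1, h2⟩

/-- The error `mangoldtWeightSum v - log v + 1 / v` with its two leading oscillating parts removed. -/
noncomputable def smoothedWeightError (v : ℝ) : ℝ :=
  mangoldtWeightSum v - Real.log v + 1 / v - (1 / v + 1 / v ^ 2) * mangoldtError v +
    (1 / v ^ 2 + 2 / v ^ 3) * mangoldtErrorTail v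

theorem hasDerivAt_smoothedWeightError {v : ℝ} (hv : 0 < v) :
    HasDerivAt smoothedWeightError (-(2 / v ^ 3 + 6 / v ^ 4) * mangoldtErrorTail v) v := by
  have hv0 := hv.ne'
  have h1 := hasDerivAt_mangoldtWeightSum_sub hv0
  have h2 := (hasDerivAt_tailWeight hv0).mul
    ((hasDerivAt_id v).const_sub (1 + Real.eulerMascheroniConstant))
  have h3 := (hasDerivAt_deriv_tailWeight hv0).mul (hasDerivAt_mangoldtErrorTail hv)
  have h4 := ((((h1.sub (Real.hasDerivAt_log hv0)).add (hasDerivAt_inv hv0)).sub h2).sub h3)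
  refine (h4.congr_of_eventuallyEq (Eventually.of_forall fun x => ?_)).congr_deriv ?_
  · simp only [smoothedWeightError, mangoldtError, Pi.add_apply, Pi.sub_apply, Pi.mul_apply, id,
      one_div]
    ring
  · simp only [mangoldtError, id]
    field_simp
    ring

theorem smoothedWeightError_le {a K : ℝ} (ha : 0 < a)
    (hK : ∀ v, a ≤ v → |mangoldtErrorTail v| ≤ K) :
    smoothedWeightError a ≤ Real.eulerMascheroniConstant + K * (1 / a ^ 2 + 2 / a ^ 3) := by
  have hK0 : 0 ≤ K := (abs_nonneg _).trans (hK a le_rfl)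
  have hd : ∀ v ∈ Ici a, HasDerivAt (fun v => smoothedWeightError v +
      K * (-(1 / v ^ 2 + 2 / v ^ 3))) (-(2 / v ^ 3 + 6 / v ^ 4) * mangoldtErrorTail v +
        K * (2 / v ^ 3 + 6 / v ^ 4)) v := fun v hv =>
    (hasDerivAt_smoothedWeightError (ha.trans_le hv)).add
      ((hasDerivAt_deriv_tailWeight (ha.trans_le hv).ne').const_mul K)
  have hmono : MonotoneOn (fun v => smoothedWeightError v +
      K * (-(1 / v ^ 2 + 2 / v ^ 3))) (Ici a) := by
    refine monotoneOn_of_deriv_nonneg (convex_Ici a)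
      (fun x hx => (hd x hx).continuousAt.continuousWithinAt)
      (fun x hx => (hd x (interior_subset hx)).differentiableAt.differentiableWithinAt) ?_
    intro x hx
    have hx' := interior_subset hx
    rw [(hd x hx').deriv]
    have hx0 : 0 < x := ha.trans_le hx'
    have h1 := (le_abs_self _).trans (hK x hx')
    have h2 : 0 ≤ 2 / x ^ 3 + 6 / x ^ 4 := by positivity
    nlinarith
  by_contra! hlt
  obtain ⟨ε, hε, hε2⟩ : ∃ ε > 0, smoothedWeightError a + K * (-(1 / a ^ 2 + 2 / a ^ 3)) =
      Real.eulerMascheroniConstant + 3 * ε :=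
    ⟨(smoothedWeightError a + K * (-(1 / a ^ 2 + 2 / a ^ 3)) - Real.eulerMascheroniConstant) / 3,
      by linarith, by ring⟩
  obtain ⟨M, hM⟩ := exists_abs_mangoldtError_le
  have hM0 : 0 ≤ M := (abs_nonneg _).trans (hM 0 le_rfl)
  have hlim : Tendsto (fun j : ℕ => (1 + 2 * M + 6 * K) / (j : ℝ)) atTop (𝓝 0) :=
    tendsto_const_div_atTop_nhds_zero_nat _
  refine not_eventually_harmonic_add_le hε ?_
  filter_upwards [hlim.eventually (gt_mem_nhds hε),
    Real.tendsto_harmonic_sub_log.eventually (gt_mem_nhds (lt_add_of_pos_right _ hε)),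
    eventually_ge_atTop 1, tendsto_natCast_atTop_atTop.eventually (eventually_ge_atTop a)]
    with j h1 h2 hj1 hja
  have hj1' : (1 : ℝ) ≤ j := by exact_mod_cast hj1
  have hj0 : (0 : ℝ) < j := by linarith
  have h3 := hmono self_mem_Ici (show (j : ℝ) ∈ Ici a from hja) hja
  simp only [smoothedWeightError] at h3 hε2
  have hy := abs_le.1 (hM j hj0.le)
  have hY := abs_le.1 (hK j hja)
  have i2 : 1 / (j : ℝ) ^ 2 ≤ 1 / j := one_div_le_one_div_of_le hj0 (by nlinarith)
  have i3 : 1 / (j : ℝ) ^ 3 ≤ 1 / j := one_div_le_one_div_of_le hj0 (by nlinarith [sq_nonneg (j : ℝ)])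
  have i20 : 0 ≤ 1 / (j : ℝ) ^ 2 := by positivity
  have i30 : 0 ≤ 1 / (j : ℝ) ^ 3 := by positivity
  have e3 : 2 / (j : ℝ) ^ 3 = 2 * (1 / (j : ℝ) ^ 3) := by ring
  have e1 : (1 + 2 * M + 6 * K) / (j : ℝ) = (1 + 2 * M + 6 * K) * (1 / j) := by ring
  rw [e1] at h1
  rw [e3] at h3
  have i10 : 0 < 1 / (j : ℝ) := by positivity
  generalize 1 / (j : ℝ) = p at *
  generalize 1 / (j : ℝ) ^ 2 = q at *
  generalize 1 / (j : ℝ) ^ 3 = r at *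
  have b1 : -(2 * M * p) ≤ (p + q) * mangoldtError j := by nlinarith
  have b2 : (q + 2 * r) * mangoldtErrorTail j ≤ 3 * K * p := by nlinarith
  have b3 : 0 ≤ K * (q + 2 * r) := by positivity
  have b4 : 0 ≤ K * p := by positivity
  linarith

theorem mangoldtWeightSum_le {v K : ℝ} (hv : 0 < v)
    (hK : ∀ x, v ≤ x → |mangoldtErrorTail x| ≤ K) :
    mangoldtWeightSum v ≤ Real.log v - 1 / v + Real.eulerMascheroniConstant +
      (1 / v + 1 / v ^ 2) * mangoldtError v - (1 / v ^ 2 + 2 / v ^ 3) * mangoldtErrorTail v +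
      K * (1 / v ^ 2 + 2 / v ^ 3) := by
  have := smoothedWeightError_le hv hK
  rw [smoothedWeightError] at this
  linarith

theorem exp_neg_le_of_sum {c B : ℝ} (k : ℕ) (hc : 0 ≤ c) (hB : 0 < B)
    (h : 1 ≤ B * ∑ i ∈ Finset.range k, c ^ i / (i.factorial : ℝ)) : Real.exp (-c) ≤ B := by
  rw [Real.exp_neg, inv_le_comm₀ (Real.exp_pos _) hB, ← one_div, div_le_iff₀' hB]
  exact h.trans (mul_le_mul_of_nonneg_left (Real.sum_le_exp_of_nonneg hc k) hB.le)

theorem exp_neg_sub_one_add_le {s : ℝ} (hs : |s| ≤ 0.3) :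
    Real.exp (-s) - 1 + s ≤ 0.555 * s ^ 2 := by
  have h := Real.exp_bound (x := -s) (n := 4) (by rw [abs_neg]; linarith) (by norm_num)
  rw [abs_neg] at h
  have h1 := (le_abs_self _).trans h
  norm_num [Finset.sum_range_succ, Nat.factorial] at h1
  have h2 : |s| ^ 4 ≤ 0.09 * s ^ 2 := by
    rw [show |s| ^ 4 = |s| ^ 2 * |s| ^ 2 by ring, sq_abs]
    have : s ^ 2 ≤ 0.09 := by rw [← sq_abs]; nlinarith [abs_nonneg s]
    nlinarith [sq_nonneg s]
  have h3 : -(s ^ 3) ≤ 0.3 * s ^ 2 := by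
    nlinarith [sq_nonneg s, (abs_le.1 hs).1]
  nlinarith [sq_nonneg s]

theorem log_add_exp_div_le {u v a : ℝ} (ha : 0 < a) (hu : 0 < u) (hav : a ≤ v)
    (hs : |v - u| ≤ 0.3) :
    Real.log v + (Real.exp (u - v) - 1) / v ≤
      Real.log u + (1 / u + 0.555) / a * (v - u) ^ 2 := by
  have hv : 0 < v := ha.trans_le hav
  have h1 : Real.log v ≤ Real.log u + (v - u) / u := by
    have := Real.log_le_sub_one_of_pos (div_pos hv hu)
    rw [Real.log_div hv.ne' hu.ne'] at this
    rw [sub_div, div_self hu.ne']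
    linarith
  have h2 : 0 ≤ Real.exp (u - v) - 1 + (v - u) := by
    linarith [Real.add_one_le_exp (u - v)]
  have h3 : Real.exp (u - v) - 1 + (v - u) ≤ 0.555 * (v - u) ^ 2 := by
    have := exp_neg_sub_one_add_le hs
    rwa [neg_sub] at this
  have h4 : (Real.exp (u - v) - 1 + (v - u)) / v ≤ 0.555 * (v - u) ^ 2 / a :=
    div_le_div₀ (by positivity) h3 ha hav
  have h5 : (v - u) / u - (v - u) / v ≤ 1 / u * (v - u) ^ 2 / a := by
    have e : (v - u) / u - (v - u) / v = 1 / u * (v - u) ^ 2 / v := by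
      field_simp
    rw [e]
    gcongr
  have e1 : (Real.exp (u - v) - 1) / v =
      (Real.exp (u - v) - 1 + (v - u)) / v - (v - u) / v := by ring
  have e2 : (1 / u + 0.555) / a * (v - u) ^ 2 =
      1 / u * (v - u) ^ 2 / a + 0.555 * (v - u) ^ 2 / a := by ring
  linarith

theorem log_sigma_div_le_of_average {n : ℕ} {u δ : ℝ} (hn : Real.log n = Real.exp u)
    (hδ0 : 0 < δ) (hδ : δ ≤ 0.3) (hu : δ < u) :
    Real.log ((ArithmeticFunction.sigma 1 n : ℝ) / n) ≤
      Real.eulerMascheroniConstant + Real.log u + ((1 / u + 0.555) / (u - δ) * δ ^ 2 / 3 +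
        ((1 / (u - δ) + 1 / (u - δ) ^ 2) / δ + 3 * (1 / (u - δ) ^ 2 + 2 / (u - δ) ^ 3)) *
          tailBound (u - δ)) := by
  set a := u - δ with ha_def
  set Y := tailBound a with hY
  set ℓ := Real.log ((ArithmeticFunction.sigma 1 n : ℝ) / n) with hℓ
  set c := (1 / u + 0.555) / a with hc
  set q := 1 / a ^ 2 + 2 / a ^ 3 with hq
  have ha : 0 < a := by rw [ha_def]; linarith
  have hu0 : 0 < u := by linarith
  have hYv : ∀ v, a ≤ v → |mangoldtErrorTail v| ≤ Y := fun v hv =>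
    (abs_mangoldtErrorTail_le_tailBound (ha.le.trans hv)).trans (antitone_tailBound hv)
  have hY0 : 0 ≤ Y := tailBound_nonneg a
  have hd : ∀ v ∈ Icc a (u + δ), HasDerivAt (fun v => (Real.eulerMascheroniConstant + Real.log u +
      3 * q * Y - ℓ) * v + c * (v - u) ^ 3 / 3 - (1 / v + 1 / v ^ 2) * mangoldtErrorTail v)
      ((Real.eulerMascheroniConstant + Real.log u + 3 * q * Y - ℓ) + c * (v - u) ^ 2 -
        (-(1 / v ^ 2 + 2 / v ^ 3) * mangoldtErrorTail v +
          (1 / v + 1 / v ^ 2) * -mangoldtError v)) v := by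
    intro v hv
    have hv0 : 0 < v := ha.trans_le hv.1
    have h1 := (hasDerivAt_id v).const_mul
      (Real.eulerMascheroniConstant + Real.log u + 3 * q * Y - ℓ)
    have h2 := ((((hasDerivAt_id v).sub_const u).pow 3).const_mul c).div_const 3
    have h3 := (hasDerivAt_tailWeight hv0.ne').mul (hasDerivAt_mangoldtErrorTail hv0)
    refine ((h1.add h2).sub h3).congr_deriv ?_
    simp only [id]
    push_cast
    ring
  have hmono : MonotoneOn (fun v => (Real.eulerMascheroniConstant + Real.log u +
      3 * q * Y - ℓ) * v + c * (v - u) ^ 3 / 3 - (1 / v + 1 / v ^ 2) * mangoldtErrorTail v)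
      (Icc a (u + δ)) := by
    refine monotoneOn_of_deriv_nonneg (convex_Icc _ _)
      (fun x hx => (hd x hx).continuousAt.continuousWithinAt)
      (fun x hx => (hd x (interior_subset hx)).differentiableAt.differentiableWithinAt) ?_
    intro v hv
    have hv' := interior_subset hv
    rw [(hd v hv').deriv]
    have hv0 : 0 < v := ha.trans_le hv'.1
    have h1 := log_sigma_div_le_mangoldtWeightSum n hv0
    have h2 := mangoldtWeightSum_le hv0 fun x hx => hYv x (hv'.1.trans hx)
    have h3 := log_add_exp_div_le ha hu0 hv'.1 (show |v - u| ≤ 0.3 by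
      rw [abs_le]; constructor <;> linarith [hv'.1, hv'.2])
    have e1 : Real.log n * (Real.exp (-v) / v) = 1 / v + (Real.exp (u - v) - 1) / v := by
      rw [hn, sub_eq_add_neg u v, Real.exp_add]; ring
    rw [e1, ← hℓ] at h1
    rw [← hc] at h3
    have hqv : 1 / v ^ 2 + 2 / v ^ 3 ≤ q := by
      have := hv'.1
      rw [hq]; gcongr
    have hqv0 : 0 ≤ 1 / v ^ 2 + 2 / v ^ 3 := by positivity
    have h4 := abs_le.1 (hYv v hv'.1)
    generalize 1 / v ^ 2 + 2 / v ^ 3 = p at *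
    have h5 : p * Y ≤ q * Y := mul_le_mul_of_nonneg_right hqv hY0
    have h6 : -(p * mangoldtErrorTail v) ≤ p * Y := by nlinarith [h4.1]
    linarith
  have h := hmono (left_mem_Icc.2 (by linarith)) (right_mem_Icc.2 (by linarith))
    (show a ≤ u + δ by linarith)
  simp only at h
  have hw : ∀ v, a ≤ v → |(1 / v + 1 / v ^ 2) * mangoldtErrorTail v| ≤ (1 / a + 1 / a ^ 2) * Y := by
    intro v hv
    have hv0 : 0 < v := ha.trans_le hv
    rw [abs_mul, abs_of_pos (show 0 < 1 / v + 1 / v ^ 2 by positivity)]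
    have := hYv v hv
    gcongr
  have hwa := (abs_le.1 (hw a le_rfl)).2
  have hwb := (abs_le.1 (hw (u + δ) (by linarith))).1
  have e1 : a - u = -δ := by rw [ha_def]; ring
  have e2 : u + δ - u = δ := by ring
  rw [e1, e2] at h
  have e3 : a = u - δ := ha_def
  have h7 : 2 * δ * ℓ ≤ 2 * δ * (Real.eulerMascheroniConstant + Real.log u + 3 * q * Y) +
      2 * (c * δ ^ 3 / 3) + 2 * ((1 / a + 1 / a ^ 2) * Y) := by
    have : (Real.eulerMascheroniConstant + Real.log u + 3 * q * Y - ℓ) * (u + δ) -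
      (Real.eulerMascheroniConstant + Real.log u + 3 * q * Y - ℓ) * a =
      2 * δ * (Real.eulerMascheroniConstant + Real.log u + 3 * q * Y) - 2 * δ * ℓ := by
      rw [e3]; ring
    have e4 : c * (-δ) ^ 3 / 3 = -(c * δ ^ 3 / 3) := by ring
    rw [e4] at h
    linarith
  have e5 : 2 * δ * (Real.eulerMascheroniConstant + Real.log u + 3 * q * Y) +
      2 * (c * δ ^ 3 / 3) + 2 * ((1 / a + 1 / a ^ 2) * Y) =
      2 * δ * (Real.eulerMascheroniConstant + Real.log u + (c * δ ^ 2 / 3 +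
        ((1 / a + 1 / a ^ 2) / δ + 3 * q) * Y)) := by
    field_simp
    ring
  rw [e5] at h7
  exact le_of_mul_le_mul_left h7 (by positivity)

theorem pow_three_mul_exp_neg_le {x : ℝ} (h7 : 7 ≤ x ^ 2) :
    x ^ 3 * Real.exp (-(x ^ 2 - 7) / 4) ≤ 18.53 := by
  refine abs_le_of_sq_le_sq' ?_ (by norm_num) |>.2
  have h1 : x ^ 2 / 7 ≤ Real.exp ((x ^ 2 - 7) / 7) := by
    have := Real.add_one_le_exp ((x ^ 2 - 7) / 7)
    linarith
  have h2 : (x ^ 2 / 7) ^ 3 ≤ Real.exp ((x ^ 2 - 7) / 7) ^ 3 := by gcongr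
  rw [← Real.exp_nat_mul] at h2
  have h3 : Real.exp ((3 : ℕ) * ((x ^ 2 - 7) / 7)) ≤ Real.exp ((x ^ 2 - 7) / 2) := by
    rw [Real.exp_le_exp]; push_cast; linarith
  have h4 : (x ^ 3 * Real.exp (-(x ^ 2 - 7) / 4)) ^ 2 =
      343 * ((x ^ 2 / 7) ^ 3 * Real.exp (-((x ^ 2 - 7) / 2))) := by
    rw [mul_pow, ← Real.exp_nat_mul]
    push_cast
    ring_nf
  rw [h4]
  have h5 : (x ^ 2 / 7) ^ 3 * Real.exp (-((x ^ 2 - 7) / 2)) ≤ 1 := by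
    rw [Real.exp_neg, ← div_eq_mul_inv, div_le_one (Real.exp_pos _)]
    exact h2.trans h3
  linarith

theorem tailBound_le {x : ℝ} (hx : 2.6457 ≤ x) (h7 : 7 ≤ x ^ 2) :
    tailBound (x ^ 2 - 0.7746 / x) ≤ 0.0025725 * Real.exp (-(x ^ 2 - 7) / 4) ^ 2 +
      0.004447 * Real.exp (-0.338 * x) := by
  have hx0 : 0 < x := by linarith
  have hδ : 0.7746 / x ≤ 0.2928 := by rw [div_le_iff₀ hx0]; linarith
  set a := x ^ 2 - 0.7746 / x with ha
  have hE1 : Real.exp (-(x ^ 2 - 7) / 4) ≤ 1 := by rw [Real.exp_le_one_iff]; linarith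
  have hE0 := Real.exp_pos (-(x ^ 2 - 7) / 4)
  have hsq : x - 0.0565 ≤ √a := by
    refine Real.le_sqrt_of_sq_le ?_
    have : 0.7746 / x ≤ 0.113 * x - 0.0032 := by rw [div_le_iff₀ hx0]; nlinarith
    nlinarith
  have t1 : Real.exp (-a) ≤ 0.001223 * Real.exp (-(x ^ 2 - 7) / 4) ^ 2 := by
    have h1 : Real.exp (-6.7072) ≤ 0.001223 :=
      exp_neg_le_of_sum 24 (by norm_num) (by norm_num) (by norm_num [Finset.sum_range_succ, Nat.factorial])
    calc Real.exp (-a) ≤ Real.exp (-6.7072 + (2 : ℕ) * (-(x ^ 2 - 7) / 4)) := by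
          rw [Real.exp_le_exp]; push_cast; linarith
      _ ≤ _ := by rw [Real.exp_add, Real.exp_nat_mul]; gcongr
  have t2 : Real.exp (-1.68 - 0.338 * √a) ≤ 0.19 * Real.exp (-0.338 * x) := by
    have h1 : Real.exp (-1.6609) ≤ 0.19 :=
      exp_neg_le_of_sum 14 (by norm_num) (by norm_num) (by norm_num [Finset.sum_range_succ, Nat.factorial])
    calc Real.exp (-1.68 - 0.338 * √a) ≤ Real.exp (-1.6609 + -0.338 * x) := by
          rw [Real.exp_le_exp]; linarith
      _ ≤ _ := by rw [Real.exp_add]; gcongr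
  have t3 : Real.exp (-a / 2) ≤ 0.035 * Real.exp (-(x ^ 2 - 7) / 4) ^ 2 := by
    have h1 : Real.exp (-3.3536) ≤ 0.035 :=
      exp_neg_le_of_sum 18 (by norm_num) (by norm_num) (by norm_num [Finset.sum_range_succ, Nat.factorial])
    calc Real.exp (-a / 2) ≤ Real.exp (-3.3536 + (2 : ℕ) * (-(x ^ 2 - 7) / 4)) := by
          rw [Real.exp_le_exp]; push_cast; linarith
      _ ≤ _ := by rw [Real.exp_add, Real.exp_nat_mul]; gcongr
  rw [tailBound]
  have p1 := sq_nonneg (Real.exp (-(x ^ 2 - 7) / 4))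
  have p2 := Real.exp_pos (-0.338 * x)
  generalize Real.exp (-(x ^ 2 - 7) / 4) ^ 2 = E at *
  generalize Real.exp (-0.338 * x) = F at *
  calc _ ≤ 2 * (0.001223 * E) + 0.0234 * (0.19 * F + 0.035 * E / 6.48) := by gcongr
    _ ≤ _ := by
      have : 0.035 * E / 6.48 ≤ 0.0054013 * E := by
        rw [div_le_iff₀ (by norm_num)]; linarith
      linarith

theorem average_error_mul_le {x θ a₀ f g h : ℝ} (hx : 2.6457 ≤ x) (h7 : 7 ≤ x ^ 2) (hθ : 0 < θ)
    (ha₀ : 0 < a₀) (hθx : θ * x ^ 2 ≤ x ^ 2 - 0.7746 / x) (hax : a₀ ≤ x ^ 2 - 0.7746 / x)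
    (hf : Real.exp (-(x ^ 2 - 7) / 4) ≤ f) (hg : x ^ 3 * Real.exp (-0.338 * x) ≤ g)
    (hh : Real.exp (-0.338 * x) ≤ h) :
    ((1 / x ^ 2 + 0.555) / (x ^ 2 - 0.7746 / x) * (0.7746 / x) ^ 2 / 3 +
      ((1 / (x ^ 2 - 0.7746 / x) + 1 / (x ^ 2 - 0.7746 / x) ^ 2) / (0.7746 / x) +
        3 * (1 / (x ^ 2 - 0.7746 / x) ^ 2 + 2 / (x ^ 2 - 0.7746 / x) ^ 3)) *
          tailBound (x ^ 2 - 0.7746 / x)) * x ^ 4 ≤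
      (1 / x ^ 2 + 0.555) * 0.200002 / θ +
        0.0025725 * ((1 + 1 / a₀) / (0.7746 * θ) * 18.53 + 3 / θ ^ 2 * (1 + 2 / a₀)) * f +
        0.004447 * ((1 + 1 / a₀) / (0.7746 * θ) * g + 3 / θ ^ 2 * (1 + 2 / a₀) * h) := by
  have hx0 : 0 < x := by linarith
  have hY := tailBound_le hx h7
  have hY0 := tailBound_nonneg (x ^ 2 - 0.7746 / x)
  set a := x ^ 2 - 0.7746 / x with ha
  have ha0 : 0 < a := ha₀.trans_le hax
  have hE0 := Real.exp_pos (-(x ^ 2 - 7) / 4)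
  have hE1 : Real.exp (-(x ^ 2 - 7) / 4) ≤ 1 := by rw [Real.exp_le_one_iff]; linarith
  have hE3 := pow_three_mul_exp_neg_le h7
  set E := Real.exp (-(x ^ 2 - 7) / 4) with hE
  set A := (1 + 1 / a₀) / (0.7746 * θ) with hA
  set B := 3 / θ ^ 2 * (1 + 2 / a₀) with hB
  have hA0 : 0 ≤ A := by positivity
  have hB0 : 0 ≤ B := by positivity
  have hxa : x ^ 2 / a ≤ 1 / θ := by
    rw [div_le_div_iff₀ ha0 hθ]; linarith
  have hxa0 : 0 ≤ x ^ 2 / a := by positivity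
  have main : (1 / x ^ 2 + 0.555) / a * (0.7746 / x) ^ 2 / 3 * x ^ 4 ≤
      (1 / x ^ 2 + 0.555) * 0.200002 / θ := by
    have e : (1 / x ^ 2 + 0.555) / a * (0.7746 / x) ^ 2 / 3 * x ^ 4 =
        (1 / x ^ 2 + 0.555) * (0.7746 ^ 2 / 3) * (x ^ 2 / a) := by
      field_simp
    rw [e, div_eq_mul_one_div _ θ]
    have : (0 : ℝ) ≤ 1 / x ^ 2 := by positivity
    gcongr
    norm_num
  have hcoef : ((1 / a + 1 / a ^ 2) / (0.7746 / x) + 3 * (1 / a ^ 2 + 2 / a ^ 3)) * x ^ 4 ≤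
      A * x ^ 3 + B := by
    have e : ((1 / a + 1 / a ^ 2) / (0.7746 / x) + 3 * (1 / a ^ 2 + 2 / a ^ 3)) * x ^ 4 =
        (1 + 1 / a) / 0.7746 * (x ^ 2 / a) * x ^ 3 + 3 * (1 + 2 / a) * (x ^ 2 / a) ^ 2 := by
      field_simp
    have e1 : A = (1 + 1 / a₀) / 0.7746 * (1 / θ) := by rw [hA]; field_simp
    have e2 : B = 3 * (1 + 2 / a₀) * (1 / θ) ^ 2 := by rw [hB]; field_simp
    rw [e, e1, e2]
    gcongr
  have hprod : (A * x ^ 3 + B) * tailBound a ≤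
      0.0025725 * (A * 18.53 + B) * f + 0.004447 * (A * g + B * h) := by
    have h1 : (A * x ^ 3 + B) * E ^ 2 ≤ (A * 18.53 + B) * f := by
      have e : (A * x ^ 3 + B) * E ^ 2 = (A * (x ^ 3 * E) + B * E) * E := by ring
      rw [e]
      have : B * E ≤ B := mul_le_of_le_one_right hB0 hE1
      have : A * (x ^ 3 * E) ≤ A * 18.53 := mul_le_mul_of_nonneg_left hE3 hA0
      have h3 : 0 ≤ A * 18.53 + B := by positivity
      exact mul_le_mul (by linarith) hf hE0.le h3
    have h2 : (A * x ^ 3 + B) * Real.exp (-0.338 * x) ≤ A * g + B * h := by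
      have e : (A * x ^ 3 + B) * Real.exp (-0.338 * x) =
        A * (x ^ 3 * Real.exp (-0.338 * x)) + B * Real.exp (-0.338 * x) := by ring
      rw [e]
      gcongr
    have h3 : 0 ≤ A * x ^ 3 + B := by positivity
    have h4 := mul_le_mul_of_nonneg_left hY h3
    rw [mul_add] at h4
    linarith
  have := mul_le_mul_of_nonneg_right hcoef hY0
  rw [add_mul]
  have e : ((1 / a + 1 / a ^ 2) / (0.7746 / x) + 3 * (1 / a ^ 2 + 2 / a ^ 3)) * tailBound a * x ^ 4 =
    ((1 / a + 1 / a ^ 2) / (0.7746 / x) + 3 * (1 / a ^ 2 + 2 / a ^ 3)) * x ^ 4 * tailBound a := by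
    ring
  rw [e]
  linarith

theorem average_error_mul_le_const {x : ℝ} (hx : 2.6457 ≤ x) (h7 : 7 ≤ x ^ 2) :
    ((1 / x ^ 2 + 0.555) / (x ^ 2 - 0.7746 / x) * (0.7746 / x) ^ 2 / 3 +
      ((1 / (x ^ 2 - 0.7746 / x) + 1 / (x ^ 2 - 0.7746 / x) ^ 2) / (0.7746 / x) +
        3 * (1 / (x ^ 2 - 0.7746 / x) ^ 2 + 2 / (x ^ 2 - 0.7746 / x) ^ 3)) *
          tailBound (x ^ 2 - 0.7746 / x)) * x ^ 4 ≤ 0.3626 := by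
  have hx0 : 0 < x := by linarith
  rcases le_total x 4 with h4 | h4
  · have hδ : 0.7746 / x ≤ 0.2928 := by rw [div_le_iff₀ hx0]; linarith
    have hE1 : Real.exp (-(x ^ 2 - 7) / 4) ≤ 1 := by rw [Real.exp_le_one_iff]; linarith
    have hg : x ^ 3 * Real.exp (-0.338 * x) ≤ 16.564 := by
      have h1 : x / 4 ≤ Real.exp (x / 4 - 1) := by linarith [Real.add_one_le_exp (x / 4 - 1)]
      have h2 : (x / 4) ^ 3 ≤ Real.exp (x / 4 - 1) ^ 3 := by gcongr
      have h3 : Real.exp (-1.352) ≤ 0.2588 :=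
        exp_neg_le_of_sum 12 (by norm_num) (by norm_num) (by norm_num [Finset.sum_range_succ, Nat.factorial])
      have h5 : (x / 4) ^ 3 * Real.exp (-0.338 * x) ≤ Real.exp (-1.352) := by
        calc _ ≤ Real.exp (x / 4 - 1) ^ 3 * Real.exp (-0.338 * x) := by gcongr
          _ ≤ _ := by
            rw [← Real.exp_nat_mul, ← Real.exp_add, Real.exp_le_exp]; push_cast; linarith
      linarith
    have hh : Real.exp (-0.338 * x) ≤ 0.41 := by
      refine le_trans (Real.exp_le_exp.2 (by linarith : -0.338 * x ≤ -0.894)) ?_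
      exact exp_neg_le_of_sum 12 (by norm_num) (by norm_num) (by norm_num [Finset.sum_range_succ, Nat.factorial])
    refine (average_error_mul_le (θ := 0.9581) (a₀ := 6.707) hx h7 (by norm_num) (by norm_num) ?_
      (by linarith) hE1 hg hh).trans ?_
    · nlinarith
    · have : 1 / x ^ 2 ≤ 1 / 7 := one_div_le_one_div_of_le (by norm_num) h7
      generalize 1 / x ^ 2 = p at *
      norm_num
      linarith
  · have h16 : 16 ≤ x ^ 2 := by nlinarith
    have hδ : 0.7746 / x ≤ 0.2 := by rw [div_le_iff₀ hx0]; linarith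
    have hE1 : Real.exp (-(x ^ 2 - 7) / 4) ≤ 0.1055 := by
      refine le_trans (Real.exp_le_exp.2 (by linarith : -(x ^ 2 - 7) / 4 ≤ -2.25)) ?_
      exact exp_neg_le_of_sum 12 (by norm_num) (by norm_num) (by norm_num [Finset.sum_range_succ, Nat.factorial])
    have hg : x ^ 3 * Real.exp (-0.338 * x) ≤ 34.82 := by
      have h1 : 0.338 * x / 3 ≤ Real.exp (0.338 * x / 3 - 1) := by
        linarith [Real.add_one_le_exp (0.338 * x / 3 - 1)]
      have h2 : (0.338 * x / 3) ^ 3 ≤ Real.exp (0.338 * x / 3 - 1) ^ 3 := by gcongr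
      have h3 : Real.exp (-3) ≤ 0.04979 :=
        exp_neg_le_of_sum 18 (by norm_num) (by norm_num) (by norm_num [Finset.sum_range_succ, Nat.factorial])
      have h5 : (0.338 * x / 3) ^ 3 * Real.exp (-0.338 * x) ≤ Real.exp (-3) := by
        calc _ ≤ Real.exp (0.338 * x / 3 - 1) ^ 3 * Real.exp (-0.338 * x) := by gcongr
          _ ≤ _ := by
            rw [← Real.exp_nat_mul, ← Real.exp_add, Real.exp_le_exp]; push_cast; linarith
      linarith
    have hh : Real.exp (-0.338 * x) ≤ 0.2588 := by
      refine le_trans (Real.exp_le_exp.2 (by linarith : -0.338 * x ≤ -1.352)) ?_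
      exact exp_neg_le_of_sum 12 (by norm_num) (by norm_num) (by norm_num [Finset.sum_range_succ, Nat.factorial])
    refine (average_error_mul_le (θ := 0.9875) (a₀ := 15.8) hx h7 (by norm_num) (by norm_num) ?_
      (by linarith) hE1 hg hh).trans ?_
    · nlinarith
    · have : 1 / x ^ 2 ≤ 1 / 16 := one_div_le_one_div_of_le (by norm_num) h16
      generalize 1 / x ^ 2 = p at *
      norm_num
      linarith

theorem exp_eulerMascheroniConstant_lt : Real.exp Real.eulerMascheroniConstant < 1.7811 := by
  refine (Real.exp_lt_exp.2 eulerMascheroniConstant_lt).trans_le ?_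
  have := Real.exp_bound' (x := 0.57722) (by norm_num) (by norm_num) (n := 9) (by norm_num)
  refine this.trans ?_
  norm_num [Finset.sum_range_succ, Nat.factorial]

theorem add_log_add_log_le_log {u : ℝ} (hu : 0 < u) :
    Real.eulerMascheroniConstant + Real.log u + Real.log (1 + 0.36398 / u ^ 2) ≤
      Real.log (Real.exp Real.eulerMascheroniConstant * u + 0.6483 / u) := by
  have h1 := Real.exp_pos Real.eulerMascheroniConstant
  rw [← Real.log_exp Real.eulerMascheroniConstant, ← Real.log_mul (by positivity) (by positivity),
    ← Real.log_mul (by positivity) (by positivity), Real.log_exp]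
  refine Real.log_le_log (by positivity) ?_
  have e : Real.exp Real.eulerMascheroniConstant * u * (1 + 0.36398 / u ^ 2) =
      Real.exp Real.eulerMascheroniConstant * u +
        Real.exp Real.eulerMascheroniConstant * 0.36398 / u := by
    field_simp
  rw [e]
  have h2 := exp_eulerMascheroniConstant_lt
  have : Real.exp Real.eulerMascheroniConstant * 0.36398 ≤ 0.6483 := by linarith
  gcongr

theorem robin_of_log_lt {n : ℕ} (hn : 3 ≤ n)
    (h : Real.log ((ArithmeticFunction.sigma 1 n : ℝ) / n) <
      Real.log (Real.exp Real.eulerMascheroniConstant * Real.log (Real.log n) +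
        0.6483 / Real.log (Real.log n))) :
    (ArithmeticFunction.sigma 1 n : ℝ) <
      Real.exp Real.eulerMascheroniConstant * n * Real.log (Real.log n) +
        0.6483 * n / Real.log (Real.log n) := by
  have hn0 : (0 : ℝ) < n := by positivity
  have hn3 : (3 : ℝ) ≤ n := by exact_mod_cast hn
  have hL : 1 < Real.log n := by
    rw [Real.lt_log_iff_exp_lt hn0]
    linarith [Real.exp_one_lt_d9]
  have hu := Real.log_pos hL
  have hs : 0 < (ArithmeticFunction.sigma 1 n : ℝ) := by
    have : ArithmeticFunction.sigma 1 n ≠ 0 := by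
      rw [Ne, ArithmeticFunction.sigma_eq_zero]; omega
    positivity
  rw [Real.log_lt_log_iff (by positivity) (by positivity), div_lt_iff₀ hn0] at h
  refine h.trans_eq ?_
  ring

theorem robin_of_seven_le {n : ℕ} (hn : 3 ≤ n) (h : 7 ≤ Real.log (Real.log n)) :
    (ArithmeticFunction.sigma 1 n : ℝ) <
      Real.exp Real.eulerMascheroniConstant * n * Real.log (Real.log n) +
        0.6483 * n / Real.log (Real.log n) := by
  apply robin_of_log_lt hn
  set u := Real.log (Real.log n) with hu
  have hL : 0 < Real.log n := Real.log_pos (by exact_mod_cast (by omega : 1 < n))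
  have hx2 : √u ^ 2 = u := Real.sq_sqrt (by linarith)
  have hx : 2.6457 ≤ √u := by
    apply Real.le_sqrt_of_sq_le
    norm_num
    linarith
  have hδ : 0.7746 / √u ≤ 0.3 := by
    rw [div_le_iff₀ (by linarith)]
    linarith
  have h1 := log_sigma_div_le_of_average (n := n) (u := u) (δ := 0.7746 / √u)
    (by rw [hu, Real.exp_log hL]) (by positivity) hδ (by linarith)
  have h2 := average_error_mul_le_const hx (by rw [hx2]; exact h)
  have h4 : √u ^ 4 = u ^ 2 := by rw [show √u ^ 4 = (√u ^ 2) ^ 2 by ring, hx2]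
  rw [h4, hx2] at h2
  refine (h1.trans_lt ?_).trans_le (add_log_add_log_le_log (by linarith))
  have hu2 : (49 : ℝ) ≤ u ^ 2 := by nlinarith
  rw [add_lt_add_iff_left]
  refine lt_of_lt_of_le ?_ (Real.le_log_one_add_of_nonneg (x := 0.36398 / u ^ 2) (by positivity))
  rw [← le_div_iff₀ (by positivity)] at h2
  refine h2.trans_lt ?_
  rw [div_lt_div_iff₀ (by positivity) (by positivity)]
  have e : 2 * (0.36398 / u ^ 2) * u ^ 2 = 0.72796 := by
    field_simp; norm_num
  rw [e]
  have : 0.36398 / u ^ 2 ≤ 0.36398 / 49 := by gcongr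
  norm_num at this ⊢
  linarith

theorem pow_le_exp_of_pow_le {x : ℝ} {a b : ℕ} (hb : b ≠ 0)
    (h : x ^ b ≤ 2.718281828 ^ a) : x ≤ Real.exp (a / b) := by
  refine le_of_pow_le_pow_left₀ hb (Real.exp_pos _).le (h.trans ?_)
  rw [← Real.exp_nat_mul]
  have e : ((b : ℕ) : ℝ) * (a / b) = (a : ℕ) * 1 := by
    have : (b : ℝ) ≠ 0 := by exact_mod_cast hb
    field_simp
  rw [e, Real.exp_nat_mul]
  gcongr
  linarith [Real.exp_one_gt_d9]

theorem exp_le_of_pow_le {x : ℝ} {a b : ℕ} (hb : b ≠ 0) (hx : 0 ≤ x)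
    (h : 2.7182818286 ^ a ≤ x ^ b) : Real.exp (a / b) ≤ x := by
  refine le_of_pow_le_pow_left₀ hb hx (le_trans ?_ h)
  rw [← Real.exp_nat_mul]
  have e : ((b : ℕ) : ℝ) * (a / b) = (a : ℕ) * 1 := by
    have : (b : ℝ) ≠ 0 := by exact_mod_cast hb
    field_simp
  rw [e, Real.exp_nat_mul]
  gcongr
  linarith [Real.exp_one_lt_d9]

theorem log_le_of_pow_le {x : ℝ} {a b : ℕ} (hb : b ≠ 0) (hx : 0 < x)
    (h : x ^ b ≤ 2.718281828 ^ a) : Real.log x ≤ a / b :=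
  (Real.log_le_iff_le_exp hx).2 (pow_le_exp_of_pow_le hb h)

theorem le_log_of_pow_le {x : ℝ} {a b : ℕ} (hb : b ≠ 0) (hx : 0 < x)
    (h : 2.7182818286 ^ a ≤ x ^ b) : a / b ≤ Real.log x :=
  (Real.le_log_iff_exp_le hx).2 (exp_le_of_pow_le hb hx.le h)

/-- Whether `m` is `1` or a prime power. -/
def isMinFacPow (m : ℕ) : Bool := m = Nat.minFac m ^ Nat.log (Nat.minFac m) m

/-- A computable version of `mangoldtWeight`. -/
def mangoldtWeightRat (m : ℕ) : ℚ :=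
  if isMinFacPow m then 1 / (Nat.log (Nat.minFac m) m * m) else 0

/-- A natural number whose logarithm is `Λ m`. -/
def expMangoldt (m : ℕ) : ℕ := if isMinFacPow m then Nat.minFac m else 1

theorem isMinFacPow_of_isPrimePow {m : ℕ} (h : IsPrimePow m) : isMinFacPow m := by
  obtain ⟨p, k, hp, hk, rfl⟩ := (isPrimePow_nat_iff m).1 h
  simp [isMinFacPow, hp.pow_minFac hk.ne', Nat.log_pow hp.one_lt]

theorem mangoldtWeight_le_rat (m : ℕ) : mangoldtWeight m ≤ mangoldtWeightRat m := by
  by_cases h : IsPrimePow m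
  · rw [mangoldtWeightRat, if_pos (isMinFacPow_of_isPrimePow h), mangoldtWeight]
    obtain ⟨p, k, hp, hk, rfl⟩ := (isPrimePow_nat_iff m).1 h
    rw [hp.pow_minFac hk.ne', Nat.log_pow hp.one_lt,
      ArithmeticFunction.vonMangoldt_apply_pow hk.ne',
      ArithmeticFunction.vonMangoldt_apply_prime hp]
    have := Real.log_pos (by exact_mod_cast hp.one_lt : (1 : ℝ) < p)
    have hp0 := hp.pos
    push_cast
    rw [Real.log_pow]
    apply le_of_eq
    field_simp
  · rw [mangoldtWeight, ArithmeticFunction.vonMangoldt_eq_zero_iff.2 h, zero_div,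
      mangoldtWeightRat]
    split_ifs <;> positivity

theorem log_expMangoldt_le (m : ℕ) (hm : m ≠ 0) : Real.log (expMangoldt m) ≤ vonMangoldt m := by
  rw [expMangoldt]
  split_ifs with h
  · rcases eq_or_ne m 1 with rfl | h1
    · simp
    have hp := Nat.minFac_prime h1
    simp only [isMinFacPow, decide_eq_true_eq] at h
    have hk : Nat.log (Nat.minFac m) m ≠ 0 := by
      intro h0
      rw [h0, pow_zero] at h
      exact h1 h
    conv_rhs => rw [h]
    rw [ArithmeticFunction.vonMangoldt_apply_pow hk, ArithmeticFunction.vonMangoldt_apply_prime hp]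
  · simp

theorem expMangoldt_pos (m : ℕ) : 0 < expMangoldt m := by
  rw [expMangoldt]
  split_ifs
  · exact Nat.minFac_pos m
  · exact one_pos

/-- The numbers `x`, `k` satisfy `x log x ≤ k ≤ (x + 1) log (x + 1)`; the parameters `R` and
`V / B` bound `∑ Λ m / (m log m)` and `∑ Λ m` over `m ≤ x`. -/
theorem log_sigma_div_le_line (n : ℕ) {x k a b a' b' V B : ℕ} {R : ℚ} (hk : 0 < k) (hb : b ≠ 0)
    (hb' : b' ≠ 0) (hB : B ≠ 0) (hx : 0 < x)
    (h1 : (x : ℚ) ^ b ≤ 2.718281828 ^ a) (h1' : x * a ≤ k * b)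
    (h2 : 2.7182818286 ^ a' ≤ ((x + 1 : ℕ) : ℚ) ^ b') (h2' : k * b' ≤ (x + 1) * a')
    (hR : ∑ m ∈ Finset.Icc 1 x, mangoldtWeightRat m ≤ R)
    (hV : 2.7182818286 ^ V ≤ ((∏ m ∈ Finset.Icc 1 x, expMangoldt m : ℕ) : ℚ) ^ B) :
    Real.log ((ArithmeticFunction.sigma 1 n : ℝ) / n) ≤
      (R - V / (B * k)) + 1 / k * Real.log n := by
  have hk0 : (0 : ℝ) < k := by exact_mod_cast hk
  have hx0 : (0 : ℝ) < x := by exact_mod_cast hx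
  have l1 : Real.log x ≤ a / b :=
    log_le_of_pow_le hb hx0 (by simpa using (Rat.cast_le (K := ℝ)).2 h1)
  have l2 : a' / b' ≤ Real.log (x + 1 : ℕ) :=
    le_log_of_pow_le hb' (by positivity) (by simpa using (Rat.cast_le (K := ℝ)).2 h2)
  have hb0 : (0 : ℝ) < b := by positivity
  have hb0' : (0 : ℝ) < b' := by positivity
  have m1 : x * Real.log x ≤ k := by
    refine (mul_le_mul_of_nonneg_left l1 hx0.le).trans ?_
    rw [← mul_div_assoc, div_le_iff₀ hb0]
    exact_mod_cast h1'
  have m2 : (k : ℝ) ≤ (x + 1 : ℕ) * Real.log (x + 1 : ℕ) := by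
    refine le_trans ?_ (mul_le_mul_of_nonneg_left l2 (by positivity))
    rw [← mul_div_assoc, le_div_iff₀ hb0']
    exact_mod_cast h2'
  have h3 := log_sigma_div_le_of_sub_nonneg n (x := x) (s := 1 / k) ?_ ?_
  rotate_left
  · intro m hm
    rcases lt_or_ge m 2 with h | h
    · interval_cases m <;> simp [mangoldtWeight]
    have hm1 : (1 : ℝ) < m := by exact_mod_cast h
    have hl := Real.log_pos hm1
    have hmx : (m : ℝ) ≤ x := by exact_mod_cast hm
    rw [mangoldtWeight, sub_nonneg, div_eq_mul_one_div (vonMangoldt m)]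
    refine mul_le_mul_of_nonneg_left ?_ ArithmeticFunction.vonMangoldt_nonneg
    refine one_div_le_one_div_of_le (by positivity) (le_trans ?_ m1)
    gcongr
  · intro m hm
    have hmx : ((x + 1 : ℕ) : ℝ) ≤ m := by exact_mod_cast hm
    have hl : 0 ≤ Real.log (x + 1 : ℕ) := Real.log_natCast_nonneg _
    rw [mangoldtWeight, sub_nonpos, div_eq_mul_one_div (vonMangoldt m)]
    refine mul_le_mul_of_nonneg_left ?_ ArithmeticFunction.vonMangoldt_nonneg
    refine one_div_le_one_div_of_le hk0 (m2.trans ?_)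
    gcongr
  rw [Finset.sum_sub_distrib, ← Finset.sum_mul] at h3
  have h4 : ∑ m ∈ Finset.Icc 1 x, mangoldtWeight m ≤ R := by
    refine (Finset.sum_le_sum fun m _ => mangoldtWeight_le_rat m).trans ?_
    exact_mod_cast (Rat.cast_le (K := ℝ)).2 hR
  have h5 : (V : ℝ) / B ≤ ∑ m ∈ Finset.Icc 1 x, vonMangoldt m := by
    have hpos : ∀ m ∈ Finset.Icc 1 x, ((expMangoldt m : ℕ) : ℝ) ≠ 0 := fun m _ => by
      exact_mod_cast (expMangoldt_pos m).ne'
    refine le_trans ?_ (Finset.sum_le_sum fun m hm => log_expMangoldt_le m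
      (by have := (Finset.mem_Icc.1 hm).1; omega))
    rw [← Real.log_prod hpos]
    refine le_log_of_pow_le hB (Finset.prod_pos fun m _ => by exact_mod_cast expMangoldt_pos m) ?_
    simpa using (Rat.cast_le (K := ℝ)).2 hV
  have h6 : (V : ℝ) / B * (1 / k) ≤ (∑ m ∈ Finset.Icc 1 x, vonMangoldt m) * (1 / k) := by gcongr
  have e : (V : ℝ) / B * (1 / k) = V / (B * k) := by field_simp
  linarith

theorem antitoneOn_exp_neg_mul : AntitoneOn
    (fun u : ℝ => Real.exp (-u) * (2 * u / (u ^ 2 + 0.36398) - 1 / u)) (Ici 1) := by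
  have hd : ∀ u ∈ Ici (1 : ℝ), HasDerivAt
      (fun u : ℝ => Real.exp (-u) * (2 * u / (u ^ 2 + 0.36398) - 1 / u))
      (Real.exp (-u) * ((2 * 0.36398 - 2 * u ^ 2) / (u ^ 2 + 0.36398) ^ 2 + 1 / u ^ 2 -
        (2 * u / (u ^ 2 + 0.36398) - 1 / u))) u := by
    intro u hu
    have hu0 : u ≠ 0 := by have : (1 : ℝ) ≤ u := hu; linarith
    have h1 : u ^ 2 + 0.36398 ≠ 0 := by positivity
    have e1 := (hasDerivAt_neg u).exp
    have e2 := (((hasDerivAt_id u).const_mul 2).div ((hasDerivAt_pow 2 u).add_const 0.36398) h1).sub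
      (hasDerivAt_inv hu0)
    simp only [← one_div] at e2
    refine (e1.mul e2).congr_deriv ?_
    simp only [id, Pi.sub_apply, Pi.div_apply]
    field_simp
    ring
  refine antitoneOn_of_deriv_nonpos (convex_Ici 1)
    (fun u hu => (hd u hu).continuousAt.continuousWithinAt)
    (fun u hu => (hd u (interior_subset hu)).differentiableAt.differentiableWithinAt) ?_
  intro u hu
  have hu' := interior_subset hu
  rw [(hd u hu').deriv]
  have h1 : (1 : ℝ) ≤ u := hu'
  have h0 : 0 < u := by linarith
  refine mul_nonpos_of_nonneg_of_nonpos (Real.exp_pos _).le ?_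
  have e : (2 * 0.36398 - 2 * u ^ 2) / (u ^ 2 + 0.36398) ^ 2 + 1 / u ^ 2 -
      (2 * u / (u ^ 2 + 0.36398) - 1 / u) =
      -(u ^ 5 + u ^ 4 - 4 * 0.36398 * u ^ 2 - 0.36398 ^ 2 * (1 + u)) /
        (u ^ 2 * (u ^ 2 + 0.36398) ^ 2) := by
    field_simp
    ring
  rw [e]
  refine div_nonpos_of_nonpos_of_nonneg ?_ (by positivity)
  have h2 : 1 ≤ u ^ 2 := one_le_pow₀ h1
  have h3 : u ^ 2 ≤ u ^ 4 := by nlinarith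
  have h4 : u ^ 4 ≤ u ^ 5 := by nlinarith [pow_pos h0 4]
  have h5 : u ≤ u ^ 2 := by nlinarith
  norm_num
  linarith

theorem concaveOn_log_log_add : ConcaveOn ℝ (Ici (Real.exp 1))
    (fun L : ℝ => Real.log (Real.log L + 0.36398 / Real.log L)) := by
  have hu : ∀ L ∈ Ici (Real.exp 1), 1 ≤ Real.log L := fun L hL =>
    (Real.le_log_iff_exp_le ((Real.exp_pos 1).trans_le hL)).2 hL
  have hd : ∀ L ∈ Ici (Real.exp 1), HasDerivAt
      (fun L : ℝ => Real.log (Real.log L + 0.36398 / Real.log L))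
      (Real.exp (-Real.log L) * (2 * Real.log L / (Real.log L ^ 2 + 0.36398) - 1 / Real.log L))
      L := by
    intro L hL
    have hL0 : 0 < L := (Real.exp_pos 1).trans_le hL
    have h1 := hu L hL
    have h0 : 0 < Real.log L := by linarith
    have e1 := Real.hasDerivAt_log hL0.ne'
    have e2 := (e1.add ((e1.inv h0.ne').const_mul 0.36398)).log (by
      simp only [Pi.add_apply, Pi.inv_apply]
      positivity)
    simp only [Pi.add_apply, Pi.inv_apply, ← div_eq_mul_inv] at e2
    refine e2.congr_deriv ?_
    rw [Real.exp_neg, Real.exp_log hL0]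
    field_simp
    ring
  refine AntitoneOn.concaveOn_of_deriv (convex_Ici _)
    (fun L hL => (hd L hL).continuousAt.continuousWithinAt)
    (fun L hL => (hd L (interior_subset hL)).differentiableAt.differentiableWithinAt) ?_
  intro a ha b hb hab
  rw [(hd a (interior_subset ha)).deriv, (hd b (interior_subset hb)).deriv]
  exact antitoneOn_exp_neg_mul (hu a (interior_subset ha)) (hu b (interior_subset hb))
    (Real.log_le_log ((Real.exp_pos 1).trans_le (interior_subset ha)) hab)

/-- By concavity a linear bound need only be compared with `log (e ^ γ u + 0.6483 / u)` at the
ends of an interval. -/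
theorem robin_of_line {n : ℕ} {c s u₀ u₁ : ℝ} (hn : 3 ≤ n) (h₀ : 1 ≤ u₀)
    (hu₀ : u₀ ≤ Real.log (Real.log n)) (hu₁ : Real.log (Real.log n) ≤ u₁)
    (hline : Real.log ((ArithmeticFunction.sigma 1 n : ℝ) / n) ≤ c + s * Real.log n)
    (e₀ : c + s * Real.exp u₀ < Real.eulerMascheroniConstant + Real.log (u₀ + 0.36398 / u₀))
    (e₁ : c + s * Real.exp u₁ < Real.eulerMascheroniConstant + Real.log (u₁ + 0.36398 / u₁)) :
    (ArithmeticFunction.sigma 1 n : ℝ) <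
      Real.exp Real.eulerMascheroniConstant * n * Real.log (Real.log n) +
        0.6483 * n / Real.log (Real.log n) := by
  apply robin_of_log_lt hn
  have hL : 0 < Real.log n := Real.log_pos (by exact_mod_cast (by omega : 1 < n))
  have hu : 0 < Real.log (Real.log n) := by linarith
  refine lt_of_lt_of_le ?_ (add_log_add_log_le_log hu)
  have e : Real.log (Real.log (Real.log n)) + Real.log (1 + 0.36398 / Real.log (Real.log n) ^ 2) =
      Real.log (Real.log (Real.log n) + 0.36398 / Real.log (Real.log n)) := by
    rw [← Real.log_mul (by positivity) (by positivity)]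
    congr 1
    field_simp
  rw [add_assoc, e]
  refine hline.trans_lt ?_
  have h1 : Real.exp u₀ ≤ Real.log n := by rwa [← Real.le_log_iff_exp_le hL]
  have h2 : Real.log n ≤ Real.exp u₁ := by rwa [← Real.log_le_iff_le_exp hL]
  have m0 : Real.exp u₀ ∈ Ici (Real.exp 1) := Real.exp_le_exp.2 h₀
  have m1 : Real.exp u₁ ∈ Ici (Real.exp 1) := Real.exp_le_exp.2 (by linarith)
  obtain ⟨a, b, ha, hb, hab, hc⟩ : Real.log n ∈ segment ℝ (Real.exp u₀) (Real.exp u₁) := by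
    rw [segment_eq_Icc (h1.trans h2)]
    exact ⟨h1, h2⟩
  have h3 := concaveOn_log_log_add.2 m0 m1 ha hb hab
  rw [hc] at h3
  simp only [smul_eq_mul, Real.log_exp] at h3 hc
  rw [← hc] at h3 ⊢
  have hb' : b = 1 - a := by linarith
  have h4 : a * (c + s * Real.exp u₀) + b * (c + s * Real.exp u₁) <
      a * (Real.eulerMascheroniConstant + Real.log (u₀ + 0.36398 / u₀)) +
      b * (Real.eulerMascheroniConstant + Real.log (u₁ + 0.36398 / u₁)) := by
    rcases ha.eq_or_lt with h | h
    · have : b = 1 := by linarith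
      rw [← h, this]
      linarith
    · exact add_lt_add_of_lt_of_le (mul_lt_mul_of_pos_left e₀ h)
        (mul_le_mul_of_nonneg_left e₁.le hb)
  subst hb'
  linarith

/-- A certificate for the hypotheses of `robin_of_line`. -/
theorem line_lt {c s u L d : ℝ} {a b i j : ℕ} (hb : b ≠ 0) (hj : j ≠ 0) (hu : u = a / b)
    (hd : d = i / j) (hs : 0 ≤ s) (hL : 0 ≤ L) (h1 : 2.7182818286 ^ a ≤ L ^ b)
    (h2 : c + s * L ≤ 0.57721 + d) (h0 : 0 < u) (h3 : 2.7182818286 ^ i ≤ (u + 0.36398 / u) ^ j) :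
    c + s * Real.exp u < Real.eulerMascheroniConstant + Real.log (u + 0.36398 / u) := by
  have l1 : Real.exp u ≤ L := hu ▸ exp_le_of_pow_le hb hL h1
  have l2 : d ≤ Real.log (u + 0.36398 / u) := hd ▸ le_log_of_pow_le hj (by positivity) h3
  have l3 := mul_le_mul_of_nonneg_left l1 hs
  linarith [eulerMascheroniConstant_gt]

theorem log_sigma_div_le_of_prime_pow (n : ℕ) (hn : n ≠ 0) {ε : ℝ} {c : ℕ → ℝ} {s : Finset ℕ}
    (hc : ∀ p, 0 ≤ c p) (hs : ∀ p ∉ s, c p = 0)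
    (h : ∀ p : ℕ, p.Prime → ∀ k : ℕ,
      Real.log ((ArithmeticFunction.sigma 1 (p ^ k) : ℝ) / ((p ^ k : ℕ) : ℝ)) ≤
        c p + k * Real.log p * ε) :
    Real.log ((ArithmeticFunction.sigma 1 n : ℝ) / n) ≤ ∑ p ∈ s, c p + ε * Real.log n := by
  have key : n ≠ 0 → Real.log ((ArithmeticFunction.sigma 1 n : ℝ) / n) ≤
      ∑ p ∈ n.primeFactors, c p + ε * Real.log n := by
    refine Nat.recOnPrimeCoprime ?_ ?_ ?_ n
    · simp
    · intro p k hp _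
      rcases eq_or_ne k 0 with rfl | hk
      · simp
      refine (h p hp k).trans ?_
      rw [Nat.primeFactors_prime_pow hk hp]
      push_cast
      rw [Real.log_pow, Finset.sum_singleton]
      linarith
    · intro a b ha hb hab iha ihb _
      have hs : ∀ n : ℕ, 1 < n → (ArithmeticFunction.sigma 1 n : ℝ) / n ≠ 0 := by
        intro n hn
        have : ArithmeticFunction.sigma 1 n ≠ 0 := by
          rw [Ne, ArithmeticFunction.sigma_eq_zero]; omega
        have h2 : n ≠ 0 := by omega
        positivity
      have iha := iha (by omega)
      have ihb := ihb (by omega)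
      have ha0 : (a : ℝ) ≠ 0 := by positivity
      have hb0 : (b : ℝ) ≠ 0 := by positivity
      rw [hab.primeFactors_mul, Finset.sum_union hab.disjoint_primeFactors,
        ArithmeticFunction.isMultiplicative_sigma.map_mul_of_coprime hab]
      push_cast
      rw [mul_div_mul_comm, Real.log_mul (hs a ha) (hs b hb), Real.log_mul ha0 hb0]
      linarith
  refine (key hn).trans ?_
  have : ∑ p ∈ n.primeFactors, c p ≤ ∑ p ∈ s, c p := by
    rw [← Finset.sum_filter_add_sum_filter_not n.primeFactors (· ∈ s),
      Finset.sum_eq_zero (s := n.primeFactors.filter (· ∉ s))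
        fun p hp => hs p (Finset.mem_filter.1 hp).2, add_zero]
    exact Finset.sum_le_sum_of_subset_of_nonneg
      (fun p hp => (Finset.mem_filter.1 hp).2) fun p _ _ => hc p
  linarith

theorem log_sigma_prime_pow_succ {p : ℕ} (hp : p.Prime) (k : ℕ) :
    Real.log ((ArithmeticFunction.sigma 1 (p ^ (k + 1)) : ℝ) / ((p ^ (k + 1) : ℕ) : ℝ)) =
      Real.log ((ArithmeticFunction.sigma 1 (p ^ k) : ℝ) / ((p ^ k : ℕ) : ℝ)) +
        Real.log (1 + 1 / (p * ∑ i ∈ Finset.range (k + 1), p ^ i : ℕ)) := by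
  have hp0 := hp.pos
  have hS : 0 < ∑ i ∈ Finset.range (k + 1), p ^ i :=
    Finset.sum_pos (fun _ _ => by positivity) (by simp)
  rw [ArithmeticFunction.sigma_one_apply_prime_pow hp,
    ArithmeticFunction.sigma_one_apply_prime_pow hp, ← Real.log_mul (by positivity) (by positivity)]
  congr 1
  rw [Finset.sum_range_succ' (fun i => p ^ i) (k + 1)]
  have e : ∑ i ∈ Finset.range (k + 1), p ^ (i + 1) = p * ∑ i ∈ Finset.range (k + 1), p ^ i := by
    rw [Finset.mul_sum]
    exact Finset.sum_congr rfl fun i _ => by ring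
  rw [e]
  generalize ∑ i ∈ Finset.range (k + 1), p ^ i = S at hS
  push_cast
  field_simp
  ring

theorem log_sigma_prime_pow_le_of_log_le {p : ℕ} (hp : p.Prime) (a : ℕ) {t : ℝ}
    (h1 : Real.log (1 + 1 / (p * ∑ i ∈ Finset.range (a + 1), p ^ i : ℕ)) ≤ t)
    (h2 : ∀ j, a = j + 1 → t ≤ Real.log (1 + 1 / (p * ∑ i ∈ Finset.range (j + 1), p ^ i : ℕ)))
    (k : ℕ) :
    Real.log ((ArithmeticFunction.sigma 1 (p ^ k) : ℝ) / ((p ^ k : ℕ) : ℝ)) - k * t ≤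
      Real.log ((ArithmeticFunction.sigma 1 (p ^ a) : ℝ) / ((p ^ a : ℕ) : ℝ)) - a * t := by
  have hp0 := hp.pos
  have hS : ∀ k, 0 < ∑ i ∈ Finset.range (k + 1), p ^ i := fun k =>
    Finset.sum_pos (fun _ _ => by positivity) (by simp)
  have mono : ∀ i j, i ≤ j → Real.log (1 + 1 / (p * ∑ l ∈ Finset.range (j + 1), p ^ l : ℕ)) ≤
      Real.log (1 + 1 / (p * ∑ l ∈ Finset.range (i + 1), p ^ l : ℕ)) := by
    intro i j hij
    have hi := hS i
    have hle : ∑ l ∈ Finset.range (i + 1), p ^ l ≤ ∑ l ∈ Finset.range (j + 1), p ^ l :=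
      Finset.sum_le_sum_of_subset (by simpa using hij)
    gcongr
  rcases le_total a k with hk | hk
  · induction k, hk using Nat.le_induction with
    | base => exact le_rfl
    | succ k hk ih =>
      rw [log_sigma_prime_pow_succ hp]
      have := mono a k hk
      rw [Nat.cast_succ]
      linarith
  · induction hk using Nat.decreasingInduction with
    | self => exact le_rfl
    | of_succ k hk ih =>
      refine le_trans ?_ ih
      rw [log_sigma_prime_pow_succ hp]
      obtain ⟨j, rfl⟩ : ∃ j, a = j + 1 := ⟨a - 1, by omega⟩
      have h3 := mono k j (by omega)
      have h4 := h2 j rfl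
      rw [Nat.cast_succ]
      linarith

/-- A certificate that the exponent `a` maximizes `log (σ(p ^ k) / p ^ k) - k log p / m`, and that
the maximum is at most `A / (B m)`. -/
theorem log_sigma_prime_pow_le {p : ℕ} (hp : p.Prime) {a m A B : ℕ} (hm : m ≠ 0) (hB : B ≠ 0)
    (h1 : (p * (∑ i ∈ Finset.range (a + 1), p ^ i) + 1) ^ m ≤
      p * (p * ∑ i ∈ Finset.range (a + 1), p ^ i) ^ m)
    (h2 : a ≠ 0 → p * (p * ∑ i ∈ Finset.range a, p ^ i) ^ m ≤
      (p * (∑ i ∈ Finset.range a, p ^ i) + 1) ^ m)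
    (h3 : (((∑ i ∈ Finset.range (a + 1), p ^ i : ℕ) : ℚ) ^ m / p ^ (a * (m + 1))) ^ B ≤
      2.718281828 ^ A) (k : ℕ) :
    Real.log ((ArithmeticFunction.sigma 1 (p ^ k) : ℝ) / ((p ^ k : ℕ) : ℝ)) ≤
      A / (B * m) + k * Real.log p * (1 / m) := by
  have hp0 : (0 : ℝ) < p := by exact_mod_cast hp.pos
  have hm0 : (0 : ℝ) < m := by positivity
  have hB0 : (0 : ℝ) < B := by positivity
  have hS : ∀ k, 0 < ∑ i ∈ Finset.range (k + 1), p ^ i := fun k =>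
    Finset.sum_pos (fun _ _ => by have := hp.pos; positivity) (by simp)
  have e : ∀ k, (1 + 1 / (p * ∑ i ∈ Finset.range (k + 1), p ^ i : ℕ) : ℝ) =
      (p * (∑ i ∈ Finset.range (k + 1), p ^ i) + 1 : ℕ) /
        (p * ∑ i ∈ Finset.range (k + 1), p ^ i : ℕ) := by
    intro k
    have := hS k
    generalize ∑ i ∈ Finset.range (k + 1), p ^ i = S at this
    push_cast
    field_simp
  have key := log_sigma_prime_pow_le_of_log_le hp a (t := Real.log p / m) ?_ ?_ k
  rotate_left
  · rw [le_div_iff₀ hm0, mul_comm, ← Real.log_pow]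
    have := hS a
    refine Real.log_le_log (by positivity) ?_
    rw [e, div_pow, div_le_iff₀ (by have := hp.pos; positivity)]
    exact_mod_cast h1
  · rintro j rfl
    rw [div_le_iff₀ hm0, mul_comm, ← Real.log_pow]
    have := hS j
    refine Real.log_le_log hp0 ?_
    rw [e, div_pow, le_div_iff₀ (by have := hp.pos; positivity)]
    exact_mod_cast h2 j.succ_ne_zero
  have h4 : Real.log (((∑ i ∈ Finset.range (a + 1), p ^ i : ℕ) : ℝ) ^ m / p ^ (a * (m + 1))) ≤
      A / B := by
    have := hS a
    exact log_le_of_pow_le hB (by positivity) (by simpa using (Rat.cast_le (K := ℝ)).2 h3)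
  have h5 : Real.log (((∑ i ∈ Finset.range (a + 1), p ^ i : ℕ) : ℝ) ^ m / p ^ (a * (m + 1))) =
      m * (Real.log ((ArithmeticFunction.sigma 1 (p ^ a) : ℝ) / ((p ^ a : ℕ) : ℝ)) -
        a * (Real.log p / m)) := by
    rw [ArithmeticFunction.sigma_one_apply_prime_pow hp]
    have := hS a
    have hp1 := hp.pos
    generalize ∑ i ∈ Finset.range (a + 1), p ^ i = S at this
    rw [Real.log_div (by positivity) (by positivity), Real.log_div (by positivity) (by positivity)]
    push_cast
    rw [Real.log_pow, Real.log_pow, Real.log_pow]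
    push_cast
    field_simp
    ring
  rw [h5, ← le_div_iff₀' hm0] at h4
  have e1 : (A : ℝ) / B / m = A / (B * m) := by field_simp
  have e2 : k * (Real.log p / m) = k * Real.log p * (1 / m) := by ring
  linarith

theorem log_sigma_prime_pow_le_of_large {p p₀ m : ℕ} (hp : p.Prime) (hm : m ≠ 0) (h0 : 0 < p₀)
    (hpp : p₀ ≤ p) (h : (p₀ + 1) ^ m ≤ p₀ * p₀ ^ m) (k : ℕ) :
    Real.log ((ArithmeticFunction.sigma 1 (p ^ k) : ℝ) / ((p ^ k : ℕ) : ℝ)) ≤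
      k * Real.log p * (1 / m) := by
  have h1 : (p + 1) ^ m ≤ p * p ^ m := by
    have e1 : p₀ ^ m * (p + 1) ^ m ≤ p ^ m * (p₀ + 1) ^ m := by
      rw [← mul_pow, ← mul_pow]
      gcongr 1
      nlinarith
    have e2 : p ^ m * (p₀ + 1) ^ m ≤ p ^ m * (p * p₀ ^ m) := by gcongr; exact h.trans (by gcongr)
    refine Nat.le_of_mul_le_mul_left (c := p₀ ^ m) ?_ (by positivity)
    calc _ ≤ _ := e1.trans e2
      _ = _ := by ring
  simpa using log_sigma_prime_pow_le hp (a := 0) (A := 0) (B := 1) hm one_ne_zero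
    (by simpa using h1) (by simp) (by simp) k

end

set_option exponentiation.threshold 1000000

theorem robin_of_le_two {n : ℕ} (hn : 3 ≤ n)
    (h₀ : 1.24 ≤ Real.log (Real.log n)) (h₁ : Real.log (Real.log n) ≤ 2.23) :
    (ArithmeticFunction.sigma 1 n : ℝ) <
      Real.exp Real.eulerMascheroniConstant * n * Real.log (Real.log n) +
        0.6483 * n / Real.log (Real.log n) := by
  have key := log_sigma_div_le_of_prime_pow n (by omega) (ε := 1 / (13 : ℕ))
    (s := {2, 3, 5})
    (c := fun p => if p = 2 then 1219 / (200 * 13) else if p = 3 then 529 / (200 * 13) else if p = 5 then 153 / (200 * 13) else 0)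
    (fun p => by positivity)
    (fun p hp => by
      simp only [Finset.mem_insert, Finset.mem_singleton, not_or] at hp
      simp [hp]) ?_
  swap
  · intro p hp k
    rcases lt_or_ge p 7 with h | h
    · interval_cases p <;> first | (exfalso; revert hp; decide) | skip
      · simpa using log_sigma_prime_pow_le hp (a := 3) (m := 13) (A := 1219) (B := 200) (by decide)
          (by decide) (by decide +kernel) (by decide +kernel) (by decide +kernel) k
      · simpa using log_sigma_prime_pow_le hp (a := 1) (m := 13) (A := 529) (B := 200) (by decide)
          (by decide) (by decide +kernel) (by decide +kernel) (by decide +kernel) k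
      · simpa using log_sigma_prime_pow_le hp (a := 1) (m := 13) (A := 153) (B := 200) (by decide)
          (by decide) (by decide +kernel) (by decide +kernel) (by decide +kernel) k
    · repeat rw [if_neg (by omega)]
      rw [zero_add]
      exact log_sigma_prime_pow_le_of_large hp (p₀ := 7) (by decide) (by decide) h (by decide +kernel) k
  norm_num at key
  exact robin_of_line (c := 1901 / 2600) (s := 1 / 13) hn (by norm_num) h₀ h₁ (by linarith)
    (by apply line_lt (L := 3.457) (d := 0.42) (a := 124) (b := 100) (i := 420) (j := 1000) <;> norm_num)
    (by apply line_lt (L := 9.301) (d := 0.87) (a := 223) (b := 100) (i := 870) (j := 1000) <;> norm_num)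

theorem robin_of_le_three {n : ℕ} (hn : 3 ≤ n)
    (h₀ : 2.23 ≤ Real.log (Real.log n)) (h₁ : Real.log (Real.log n) ≤ 3.4) :
    (ArithmeticFunction.sigma 1 n : ℝ) <
      Real.exp Real.eulerMascheroniConstant * n * Real.log (Real.log n) +
        0.6483 * n / Real.log (Real.log n) := by
  have key := log_sigma_div_le_of_prime_pow n (by omega) (ε := 1 / (55 : ℕ))
    (s := {2, 3, 5, 7, 11, 13, 17})
    (c := fun p => if p = 2 then 6759 / (200 * 55) else if p = 3 then 3665 / (200 * 55) else if p = 5 then 1723 / (200 * 55) else if p = 7 then 1080 / (200 * 55) else if p = 11 then 478 / (200 * 55) else if p = 13 then 303 / (200 * 55) else if p = 17 then 63 / (200 * 55) else 0)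
    (fun p => by positivity)
    (fun p hp => by
      simp only [Finset.mem_insert, Finset.mem_singleton, not_or] at hp
      simp [hp]) ?_
  swap
  · intro p hp k
    rcases lt_or_ge p 19 with h | h
    · interval_cases p <;> first | (exfalso; revert hp; decide) | skip
      · simpa using log_sigma_prime_pow_le hp (a := 5) (m := 55) (A := 6759) (B := 200) (by decide)
          (by decide) (by decide +kernel) (by decide +kernel) (by decide +kernel) k
      · simpa using log_sigma_prime_pow_le hp (a := 3) (m := 55) (A := 3665) (B := 200) (by decide)
          (by decide) (by decide +kernel) (by decide +kernel) (by decide +kernel) k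
      · simpa using log_sigma_prime_pow_le hp (a := 2) (m := 55) (A := 1723) (B := 200) (by decide)
          (by decide) (by decide +kernel) (by decide +kernel) (by decide +kernel) k
      · simpa using log_sigma_prime_pow_le hp (a := 1) (m := 55) (A := 1080) (B := 200) (by decide)
          (by decide) (by decide +kernel) (by decide +kernel) (by decide +kernel) k
      · simpa using log_sigma_prime_pow_le hp (a := 1) (m := 55) (A := 478) (B := 200) (by decide)
          (by decide) (by decide +kernel) (by decide +kernel) (by decide +kernel) k
      · simpa using log_sigma_prime_pow_le hp (a := 1) (m := 55) (A := 303) (B := 200) (by decide)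
          (by decide) (by decide +kernel) (by decide +kernel) (by decide +kernel) k
      · simpa using log_sigma_prime_pow_le hp (a := 1) (m := 55) (A := 63) (B := 200) (by decide)
          (by decide) (by decide +kernel) (by decide +kernel) (by decide +kernel) k
    · repeat rw [if_neg (by omega)]
      rw [zero_add]
      exact log_sigma_prime_pow_le_of_large hp (p₀ := 19) (by decide) (by decide) h (by decide +kernel) k
  norm_num at key
  exact robin_of_line (c := 14071 / 11000) (s := 1 / 55) hn (by norm_num) h₀ h₁ (by linarith)
    (by apply line_lt (L := 9.301) (d := 0.872) (a := 223) (b := 100) (i := 872) (j := 1000) <;> norm_num)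
    (by apply line_lt (L := 29.966) (d := 1.247) (a := 340) (b := 100) (i := 1247) (j := 1000) <;> norm_num)

theorem robin_of_le_seven {n : ℕ} (hn : 3 ≤ n)
    (h₀ : 3.4 ≤ Real.log (Real.log n)) (h₇ : Real.log (Real.log n) ≤ 7) :
    (ArithmeticFunction.sigma 1 n : ℝ) <
      Real.exp Real.eulerMascheroniConstant * n * Real.log (Real.log n) +
        0.6483 * n / Real.log (Real.log n) := by
  rcases le_total (Real.log (Real.log n)) 3.96 with h₁ | h₀
  · have hl := log_sigma_div_le_line n (x := 41) (k := 155) (a := 15) (b := 4) (a' := 26) (b' := 7)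
      (V := 2595) (B := 65) (R := 1.89356) (by decide) (by decide) (by decide) (by decide) (by decide)
      (by decide +kernel) (by decide) (by decide +kernel) (by decide) (by decide +kernel) (by decide +kernel)
    exact robin_of_line hn (by norm_num) h₀ h₁ hl
      (by apply line_lt (L := 29.966) (d := 1.253) (a := 340) (b := 100) (i := 1253) (j := 1000) <;> norm_num)
      (by apply line_lt (L := 52.459) (d := 1.398) (a := 396) (b := 100) (i := 1398) (j := 1000) <;> norm_num)
  rcases le_total (Real.log (Real.log n)) 4.55 with h₁ | h₀
  · have hl := log_sigma_div_le_line n (x := 73) (k := 316) (a := 43) (b := 10) (a' := 30) (b' := 7)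
      (V := 2403) (B := 32) (R := 2.04582) (by decide) (by decide) (by decide) (by decide) (by decide)
      (by decide +kernel) (by decide) (by decide +kernel) (by decide) (by decide +kernel) (by decide +kernel)
    exact robin_of_line hn (by norm_num) h₀ h₁ hl
      (by apply line_lt (L := 52.459) (d := 1.397) (a := 396) (b := 100) (i := 1397) (j := 1000) <;> norm_num)
      (by apply line_lt (L := 94.634) (d := 1.531) (a := 455) (b := 100) (i := 1531) (j := 1000) <;> norm_num)
  rcases le_total (Real.log (Real.log n)) 5.13 with h₁ | h₀
  · have hl := log_sigma_div_le_line n (x := 130) (k := 637) (a := 39) (b := 8) (a' := 39) (b' := 8)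
      (V := 2030) (B := 16) (R := 2.15793) (by decide) (by decide) (by decide) (by decide) (by decide)
      (by decide +kernel) (by decide) (by decide +kernel) (by decide) (by decide +kernel) (by decide +kernel)
    exact robin_of_line hn (by norm_num) h₀ h₁ hl
      (by apply line_lt (L := 94.634) (d := 1.531) (a := 455) (b := 100) (i := 1531) (j := 1000) <;> norm_num)
      (by apply line_lt (L := 169.019) (d := 1.647) (a := 513) (b := 100) (i := 1647) (j := 1000) <;> norm_num)
  rcases le_total (Real.log (Real.log n)) 5.7 with h₁ | h₀
  · have hl := log_sigma_div_le_line n (x := 230) (k := 1257) (a := 49) (b := 9) (a' := 234) (b' := 43)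
      (V := 1822) (B := 8) (R := 2.27025) (by decide) (by decide) (by decide) (by decide) (by decide)
      (by decide +kernel) (by decide) (by decide +kernel) (by decide) (by decide +kernel) (by decide +kernel)
    exact robin_of_line hn (by norm_num) h₀ h₁ hl
      (by apply line_lt (L := 169.019) (d := 1.647) (a := 513) (b := 100) (i := 1647) (j := 1000) <;> norm_num)
      (by apply line_lt (L := 298.869) (d := 1.75) (a := 570) (b := 100) (i := 1750) (j := 1000) <;> norm_num)
  rcases le_total (Real.log (Real.log n)) 6.25 with h₁ | h₀
  · have hl := log_sigma_div_le_line n (x := 403) (k := 2420) (a := 6) (b := 1) (a' := 6) (b' := 1)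
      (V := 2019) (B := 5) (R := 2.36988) (by decide) (by decide) (by decide) (by decide) (by decide)
      (by decide +kernel) (by decide) (by decide +kernel) (by decide) (by decide +kernel) (by decide +kernel)
    exact robin_of_line hn (by norm_num) h₀ h₁ hl
      (by apply line_lt (L := 298.869) (d := 1.75) (a := 570) (b := 100) (i := 1750) (j := 1000) <;> norm_num)
      (by apply line_lt (L := 518.014) (d := 1.84) (a := 625) (b := 100) (i := 1840) (j := 1000) <;> norm_num)
  rcases le_total (Real.log (Real.log n)) 6.77 with h₁ | h₀
  · have hl := log_sigma_div_le_line n (x := 684) (k := 4472) (a := 98) (b := 15) (a' := 111) (b' := 17)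
      (V := 2077) (B := 3) (R := 2.45563) (by decide) (by decide) (by decide) (by decide) (by decide)
      (by decide +kernel) (by decide) (by decide +kernel) (by decide) (by decide +kernel) (by decide +kernel)
    exact robin_of_line hn (by norm_num) h₀ h₁ hl
      (by apply line_lt (L := 518.014) (d := 1.84) (a := 625) (b := 100) (i := 1840) (j := 1000) <;> norm_num)
      (by apply line_lt (L := 871.313) (d := 1.919) (a := 677) (b := 100) (i := 1919) (j := 1000) <;> norm_num)
  have hl := log_sigma_div_le_line n (x := 883) (k := 5994) (a := 95) (b := 14) (a' := 156) (b' := 23)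
    (V := 1780) (B := 2) (R := 2.49324) (by decide) (by decide) (by decide) (by decide) (by decide)
    (by decide +kernel) (by decide) (by decide +kernel) (by decide) (by decide +kernel) (by decide +kernel)
  exact robin_of_line hn (by norm_num) h₀ h₇ hl
    (by apply line_lt (L := 871.313) (d := 1.913) (a := 677) (b := 100) (i := 1913) (j := 1000) <;> norm_num)
    (by apply line_lt (L := 1096.635) (d := 1.951) (a := 700) (b := 100) (i := 1951) (j := 1000) <;> norm_num)

theorem exp_eulerMascheroniConstant_gt : 1.78105 < Real.exp Real.eulerMascheroniConstant := by
  refine lt_of_le_of_lt ?_ (Real.exp_lt_exp.2 eulerMascheroniConstant_gt)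
  refine le_trans ?_ (Real.sum_le_exp_of_nonneg (x := 0.57721) (by norm_num) 9)
  norm_num [Finset.sum_range_succ, Nat.factorial]

theorem robin_of_ratio_lt {n : ℕ} (hn : 3 ≤ n)
    (h : (ArithmeticFunction.sigma 1 n : ℝ) / n <
      1.78105 * Real.log (Real.log n) + 0.6483 / Real.log (Real.log n)) :
    (ArithmeticFunction.sigma 1 n : ℝ) <
      Real.exp Real.eulerMascheroniConstant * n * Real.log (Real.log n) +
        0.6483 * n / Real.log (Real.log n) := by
  have hn0 : (0 : ℝ) < n := by positivity
  have hn3 : (3 : ℝ) ≤ n := by exact_mod_cast hn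
  have hL : 1 < Real.log n := by
    rw [Real.lt_log_iff_exp_lt hn0]
    linarith [Real.exp_one_lt_d9]
  have hu := Real.log_pos hL
  rw [div_lt_iff₀ hn0] at h
  have h1 := mul_lt_mul_of_pos_right exp_eulerMascheroniConstant_gt (mul_pos hn0 hu)
  refine h.trans ?_
  have e : (1.78105 * Real.log (Real.log n) + 0.6483 / Real.log (Real.log n)) * n =
      1.78105 * (n * Real.log (Real.log n)) + 0.6483 * n / Real.log (Real.log n) := by ring
  rw [e]
  linarith

theorem robin_of_ratio_le {n : ℕ} (hn : 3 ≤ n)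
    (h : (ArithmeticFunction.sigma 1 n : ℝ) / n ≤ 2.149) :
    (ArithmeticFunction.sigma 1 n : ℝ) <
      Real.exp Real.eulerMascheroniConstant * n * Real.log (Real.log n) +
        0.6483 * n / Real.log (Real.log n) := by
  have hn0 : (0 : ℝ) < n := by positivity
  have hn3 : (3 : ℝ) ≤ n := by exact_mod_cast hn
  have hL : 1 < Real.log n := by
    rw [Real.lt_log_iff_exp_lt hn0]
    linarith [Real.exp_one_lt_d9]
  have hu := Real.log_pos hL
  refine robin_of_ratio_lt hn (h.trans_lt ?_)
  set u := Real.log (Real.log n)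
  have e : 1.78105 * u + 0.6483 / u - 2.149 = (1.78105 * u ^ 2 - 2.149 * u + 0.6483) / u := by
    field_simp
    ring
  have : 0 < (1.78105 * u ^ 2 - 2.149 * u + 0.6483) / u :=
    div_pos (by nlinarith [sq_nonneg (u - 0.6033)]) hu
  linarith

theorem robin_of_le_log_log {n : ℕ} (hn : 3 ≤ n) {q u₀ : ℝ} {a b : ℕ} (hb : b ≠ 0)
    (h₀ : 0.7 ≤ u₀) (ha : u₀ = a / b) {L : ℝ} (hL : 2.7182818286 ^ a ≤ L ^ b) {c d : ℕ}
    (hd : d ≠ 0) (hLn : 2.7182818286 ^ c ≤ (n : ℝ) ^ d) (hLc : L ≤ c / d) (hL0 : 0 < L)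
    (h : (ArithmeticFunction.sigma 1 n : ℝ) / n ≤ q) (hq : q < 1.78105 * u₀ + 0.6483 / u₀) :
    (ArithmeticFunction.sigma 1 n : ℝ) <
      Real.exp Real.eulerMascheroniConstant * n * Real.log (Real.log n) +
        0.6483 * n / Real.log (Real.log n) := by
  have hn0 : (0 : ℝ) < n := by positivity
  have l1 : L ≤ Real.log n := hLc.trans (le_log_of_pow_le hd hn0 hLn)
  have l2 : u₀ ≤ Real.log (Real.log n) :=
    ha ▸ (le_log_of_pow_le hb hL0 hL).trans (Real.log_le_log hL0 l1)
  refine robin_of_ratio_lt hn (h.trans_lt (hq.trans_le ?_))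
  set u := Real.log (Real.log n)
  have h0 : 0 < u₀ := by linarith
  have h1 : 0 < u := by linarith
  have e : 1.78105 * u + 0.6483 / u - (1.78105 * u₀ + 0.6483 / u₀) =
      (u - u₀) * (1.78105 * (u * u₀) - 0.6483) / (u * u₀) := by
    field_simp
    ring
  have h2 : 0.49 ≤ u * u₀ := by nlinarith
  have : 0 ≤ (u - u₀) * (1.78105 * (u * u₀) - 0.6483) / (u * u₀) :=
    div_nonneg (mul_nonneg (by linarith) (by linarith)) (by positivity)
  linarith

theorem robin_of_lt_thirty_two {n : ℕ} (hn : 3 ≤ n) (h : n < 32) :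
    (ArithmeticFunction.sigma 1 n : ℝ) <
      Real.exp Real.eulerMascheroniConstant * n * Real.log (Real.log n) +
        0.6483 * n / Real.log (Real.log n) := by
  have key : 1000 * ArithmeticFunction.sigma 1 n ≤ 2149 * n ∨ n = 12 ∨
      n = 24 ∨ 18 ≤ n ∧ 5 * ArithmeticFunction.sigma 1 n ≤ 12 * n := by
    simp only [ArithmeticFunction.sigma_one_apply]
    interval_cases n <;> decide +kernel
  have hn0 : (0 : ℝ) < n := by positivity
  rcases key with h1 | rfl | rfl | ⟨h1, h2⟩
  · apply robin_of_ratio_le hn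
    have h1' : (1000 : ℝ) * ArithmeticFunction.sigma 1 n ≤ 2149 * n := by exact_mod_cast h1
    rw [div_le_iff₀ hn0]
    linarith
  · have h28 : ArithmeticFunction.sigma 1 12 = 28 := by
      rw [ArithmeticFunction.sigma_one_apply]
      decide +kernel
    apply robin_of_le_log_log hn (u₀ := 0.9102) (a := 9102) (b := 10000) (L := 2.48485)
      (c := 24849) (d := 10000) (q := 7 / 3)
    all_goals norm_num [h28]
  · have h60 : ArithmeticFunction.sigma 1 24 = 60 := by
      rw [ArithmeticFunction.sigma_one_apply]
      decide +kernel
    apply robin_of_le_log_log hn (u₀ := 1.1) (a := 11) (b := 10) (L := 3.01)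
      (c := 301) (d := 100) (q := 5 / 2)
    all_goals norm_num [h60]
  · have h2' : (5 : ℝ) * ArithmeticFunction.sigma 1 n ≤ 12 * n := by exact_mod_cast h2
    have hn18 : (18 : ℝ) ≤ n := by exact_mod_cast h1
    apply robin_of_le_log_log hn (u₀ := 1.05) (a := 105) (b := 100) (L := 2.86)
      (c := 286) (d := 100) (q := 12 / 5)
    case hLn => exact le_trans (by norm_num) (pow_le_pow_left₀ (by norm_num) hn18 100)
    case h => rw [div_le_iff₀ hn0]; linarith
    all_goals norm_num

/-- Robin (1984): for every integer `n ≥ 3`,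
`σ(n) < e^γ n log log n + 0.6483 n / log log n`. -/
theorem robin_sigma_bound (n : ℕ) (hn : 3 ≤ n) :
    (ArithmeticFunction.sigma 1 n : ℝ) <
      Real.exp Real.eulerMascheroniConstant * n * Real.log (Real.log n) +
        0.6483 * n / Real.log (Real.log n) := by
  rcases lt_or_ge n 32 with h | h
  · exact robin_of_lt_thirty_two hn h
  have hn32 : (32 : ℝ) ≤ n := by exact_mod_cast h
  have h0 : 1.24 ≤ Real.log (Real.log n) := by
    have h1 : (3.46 : ℝ) ≤ Real.log n := by
      refine le_trans ?_ (Real.log_le_log (by norm_num) hn32)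
      refine le_trans ?_ (le_log_of_pow_le (a := 346) (b := 100) (by norm_num) (by norm_num) ?_) <;>
        norm_num
    refine le_trans ?_ (Real.log_le_log (by norm_num) h1)
    refine le_trans ?_ (le_log_of_pow_le (a := 124) (b := 100) (by norm_num) (by norm_num) ?_) <;>
      norm_num
  rcases le_total (Real.log (Real.log n)) 2.23 with h1 | h1
  · exact robin_of_le_two hn h0 h1
  rcases le_total (Real.log (Real.log n)) 3.4 with h2 | h2
  · exact robin_of_le_three hn h1 h2
  rcases le_total (Real.log (Real.log n)) 7 with h3 | h3
  · exact robin_of_le_seven hn h2 h3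
  · exact robin_of_seven_le hn h3
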